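/- arXiv:2102.02105 — 2 statements merged into one kernel-verified Lean document; each statement's English description precedes it below -/
import Mathlib

section
/- Let n ≥ 3, let V ∈ RH_q for some q ≥ n/2 with V not almost everywhere zero, and let ρ be its auxiliary function. Fix θ > 0 and 1 < p < ∞, and let w ∈ A_p^{ρ,θ} satisfy condition (1.6). Let (k_t)_{t>0} be measurable kernels on ℝⁿ×ℝⁿ satisfying (K1) and (K2), and assume there is a constant C₀ such that ‖T* f‖_{L^p(w)} ≤ C₀‖f‖_{L^p(w)} and ‖T*_{b'} f‖_{L^p(w)} ≤ C₀‖b'‖_{BMO_θ(ρ)}‖f‖_{L^p(w)} for all f ∈ L^p(w) and all b' ∈ BMO_θ(ρ). If b ∈ CMO_θ(ρ), then the commutator T*_b is a compact operator from L^p(w) to L^p(w); that is, the set {T*_b f : ‖f‖_{L^p(w)} ≤ 1} is relatively compact in L^p(w). -/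
open MeasureTheory Metric Filter Topology
open scoped ENNReal

noncomputable section

/-- Euclidean space `ℝⁿ`. -/
abbrev Eu (n : ℕ) := EuclideanSpace ℝ (Fin n)

/-- Average of `f` over the ball `B(x,r)`. -/
def avgBall (n : ℕ) (f : Eu n → ℝ) (x : Eu n) (r : ℝ) : ℝ :=
  ((volume (ball x r)).toReal)⁻¹ * ∫ y in ball x r, f y

/-- `V` belongs to the reverse Hölder class `RH_q`: `V` is nonnegative, locally
integrable, and the `q`-averages over balls are controlled by the averages. -/
def IsReverseHolder (n : ℕ) (q : ℝ) (V : Eu n → ℝ) : Prop :=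
  (∀ x, 0 ≤ V x) ∧ LocallyIntegrable V volume ∧
    ∃ C > (0:ℝ), ∀ (x : Eu n) (r : ℝ), 0 < r →
      (avgBall n (fun y => V y ^ q) x r) ^ (1 / q) ≤ C * avgBall n V x r

/-- The auxiliary function `ρ` of `V`:
`ρ(x) = sup { r > 0 : r^{2-n} ∫_{B(x,r)} V ≤ 1 }`. -/
def auxRho (n : ℕ) (V : Eu n → ℝ) (x : Eu n) : ℝ :=
  sSup {r : ℝ | 0 < r ∧ (∫ y in ball x r, V y) / r ^ ((n : ℝ) - 2) ≤ 1}

/-- The weight class `A_p^{ρ,θ}` (for `1 < p < ∞`). -/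
def MemApRho (n : ℕ) (p θ : ℝ) (ρ w : Eu n → ℝ) : Prop :=
  (∀ x, 0 ≤ w x) ∧ LocallyIntegrable w volume ∧
    ∃ C > (0:ℝ), ∀ (x : Eu n) (r : ℝ), 0 < r →
      avgBall n w x r * (avgBall n (fun y => w y ^ (-(1 / (p - 1)))) x r) ^ (p - 1)
        ≤ C * (1 + r / ρ x) ^ (θ * p)

/-- The localized maximal operator `M_V^θ`. -/
def MVtheta (n : ℕ) (θ : ℝ) (ρ f : Eu n → ℝ) (x : Eu n) : ℝ :=
  ⨆ (x₀ : Eu n) (r : ℝ) (_ : 0 < r) (_ : x ∈ ball x₀ r),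
    (1 + r / ρ x₀) ^ (-θ) * avgBall n (fun y => |f y|) x₀ r

/-- The variant maximal operator `M_{V,η}` (with parameter `θ`). -/
def MVeta (n : ℕ) (θ η : ℝ) (ρ f : Eu n → ℝ) (x : Eu n) : ℝ :=
  ⨆ (x₀ : Eu n) (r : ℝ) (_ : 0 < r) (_ : x ∈ ball x₀ r),
    (1 + r / ρ x₀) ^ (-(θ * η)) * avgBall n (fun y => |f y|) x₀ r

/-- The class `A_1^{ρ,θ}`. -/
def MemA1Rho (n : ℕ) (θ : ℝ) (ρ w : Eu n → ℝ) : Prop :=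
  (∀ x, 0 ≤ w x) ∧ LocallyIntegrable w volume ∧
    ∃ C > (0:ℝ), ∀ᵐ x ∂(volume : Measure (Eu n)), MVtheta n θ ρ w x ≤ C * w x

/-- The weighted `L^p(w)` norm `(∫ |f|^p w)^{1/p}`, valued in `ℝ≥0∞`. -/
def wLpNorm (n : ℕ) (p : ℝ) (w f : Eu n → ℝ) : ℝ≥0∞ :=
  (∫⁻ x, ENNReal.ofReal (|f x| ^ p * w x)) ^ (1 / p)

/-- Membership in `L^p(w)`. -/
def MemWLp (n : ℕ) (p : ℝ) (w f : Eu n → ℝ) : Prop :=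
  AEStronglyMeasurable f volume ∧ wLpNorm n p w f < ⊤

/-- Condition (1.6): `lim_{A→∞} A^{n-np} ∫_{|x|>1} w(Ax)|x|^{-np} dx = 0`. -/
def Cond16 (n : ℕ) (p : ℝ) (w : Eu n → ℝ) : Prop :=
  Tendsto
    (fun A : ℝ =>
      A ^ ((n : ℝ) - n * p) * ∫ x in {x : Eu n | 1 < ‖x‖}, w (A • x) / ‖x‖ ^ ((n : ℝ) * p))
    atTop (nhds 0)

/-- The Muckenhoupt class `A_p`. -/
def MemMuckenhoupt (n : ℕ) (p : ℝ) (w : Eu n → ℝ) : Prop :=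
  (∀ x, 0 ≤ w x) ∧ LocallyIntegrable w volume ∧
    ∃ C > (0:ℝ), ∀ (x : Eu n) (r : ℝ), 0 < r →
      avgBall n w x r * (avgBall n (fun y => w y ^ (-(1 / (p - 1)))) x r) ^ (p - 1) ≤ C

/-- `C` is an admissible `BMO_θ(ρ)` bound for `f`. -/
def IsBmoBound (n : ℕ) (θ : ℝ) (ρ f : Eu n → ℝ) (C : ℝ) : Prop :=
  0 ≤ C ∧ ∀ (x : Eu n) (r : ℝ), 0 < r →
    avgBall n (fun y => |f y - avgBall n f x r|) x r ≤ C * (1 + r / ρ x) ^ θ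

/-- `f ∈ BMO_θ(ρ)`. -/
def MemBMOTheta (n : ℕ) (θ : ℝ) (ρ f : Eu n → ℝ) : Prop :=
  LocallyIntegrable f volume ∧ ∃ C, IsBmoBound n θ ρ f C

/-- `b ∈ CMO_θ(ρ)`: `b` can be approximated in the `BMO_θ(ρ)` norm by
`C_c^∞` functions. -/
def MemCMOTheta (n : ℕ) (θ : ℝ) (ρ b : Eu n → ℝ) : Prop :=
  LocallyIntegrable b volume ∧
    ∀ ε > (0:ℝ), ∃ g : Eu n → ℝ, ContDiff ℝ (⊤ : ℕ∞) g ∧ HasCompactSupport g ∧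
      ∃ C < ε, IsBmoBound n θ ρ (fun x => b x - g x) C

/-- Kernel estimate (K1). -/
def K1 (n : ℕ) (ρ : Eu n → ℝ) (k : ℝ → Eu n → Eu n → ℝ) : Prop :=
  ∀ N > (0:ℝ), ∃ C > (0:ℝ), ∀ t > (0:ℝ), ∀ x y : Eu n,
    0 < k t x y ∧
      k t x y ≤ C * t ^ (-(n : ℝ) / 2) * Real.exp (-(dist x y) ^ 2 / (5 * t)) *
        (1 + Real.sqrt t / ρ x + Real.sqrt t / ρ y) ^ (-N)

/-- Kernel Hölder estimate (K2) with exponent `δ`. -/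
def K2 (n : ℕ) (ρ : Eu n → ℝ) (k : ℝ → Eu n → Eu n → ℝ) (δ : ℝ) : Prop :=
  ∃ c > (0:ℝ), ∀ N > (0:ℝ), ∃ C > (0:ℝ), ∀ t > (0:ℝ), ∀ x y h : Eu n, ‖h‖ ≤ Real.sqrt t →
    |k t (x + h) y - k t x y| ≤
      C * (‖h‖ / Real.sqrt t) ^ δ * t ^ (-(n : ℝ) / 2) *
        Real.exp (-c * (dist x y) ^ 2 / t) *
        (1 + Real.sqrt t / ρ x + Real.sqrt t / ρ y) ^ (-N)

/-- The semigroup maximal function `T* f(x) = sup_{t>0} |∫ k_t(x,y) f(y) dy|`. -/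
def Tstar (n : ℕ) (k : ℝ → Eu n → Eu n → ℝ) (f : Eu n → ℝ) (x : Eu n) : ℝ :=
  ⨆ (t : ℝ) (_ : 0 < t), |∫ y, k t x y * f y|

/-- The commutator maximal function
`T*_b f(x) = sup_{t>0} |∫ k_t(x,y)(b(x)-b(y)) f(y) dy|`. -/
def TstarB (n : ℕ) (k : ℝ → Eu n → Eu n → ℝ) (b f : Eu n → ℝ) (x : Eu n) : ℝ :=
  ⨆ (t : ℝ) (_ : 0 < t), |∫ y, k t x y * (b x - b y) * f y|

/-- A smooth cutoff `φ` with `0 ≤ φ ≤ 1`, `φ ≡ 1` on `[0,1]`, `φ ≡ 0` on `[2,∞)`. -/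
def IsCutoff (φ : ℝ → ℝ) : Prop :=
  ContDiff ℝ (⊤ : ℕ∞) φ ∧ (∀ s, 0 ≤ φ s ∧ φ s ≤ 1) ∧ (∀ s ≤ (1:ℝ), φ s = 1) ∧
    ∀ s, (2:ℝ) ≤ s → φ s = 0

/-- The truncated kernel `k_{t,γ}(x,y) = k_t(x,y) (1 - φ(γ⁻¹ |x-y|))`. -/
def kGamma (n : ℕ) (φ : ℝ → ℝ) (γ : ℝ) (k : ℝ → Eu n → Eu n → ℝ) :
    ℝ → Eu n → Eu n → ℝ :=
  fun t x y => k t x y * (1 - φ (γ⁻¹ * dist x y))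


/-- uncentred maximal function of the indicator of `E`. -/
def maxE (n : ℕ) (E : Set (Eu n)) (y : Eu n) : ℝ≥0∞ :=
  ⨆ (c : Eu n × ℝ) (_ : 0 < c.2 ∧ y ∈ ball c.1 c.2),
    volume (E ∩ ball c.1 c.2) / volume (ball c.1 c.2)

theorem vol_ball_scale {n : ℕ} (x z : Eu n) {a r : ℝ} (ha : 0 < a) (hr : 0 < r) :
    volume (ball x (a * r)) = ENNReal.ofReal (a ^ n) * volume (ball z r) := by
  rw [Measure.addHaar_ball_of_pos _ _ (by positivity), Measure.addHaar_ball_of_pos _ z hr,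
    ← mul_assoc, ← ENNReal.ofReal_mul (by positivity), finrank_euclideanSpace_fin, mul_pow]

theorem vol_ball_ne_zero {n : ℕ} (x : Eu n) {r : ℝ} (hr : 0 < r) : volume (ball x r) ≠ 0 :=
  (measure_ball_pos _ _ hr).ne'

theorem vol_ball_ne_top {n : ℕ} (x : Eu n) (r : ℝ) : volume (ball x r) ≠ ⊤ :=
  measure_ball_lt_top.ne

theorem maxE_ge {n : ℕ} (E : Set (Eu n)) {y z : Eu n} {s : ℝ} (hs : 0 < s) (hy : y ∈ ball z s) :
    volume (E ∩ ball z s) ≤ maxE n E y * volume (ball z s) := by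
  rw [← ENNReal.div_le_iff (vol_ball_ne_zero z hs) (vol_ball_ne_top z s)]
  exact le_iSup₂_of_le (f := fun (c : Eu n × ℝ) (_ : 0 < c.2 ∧ y ∈ ball c.1 c.2) =>
    volume (E ∩ ball c.1 c.2) / volume (ball c.1 c.2)) (z, s) ⟨hs, hy⟩ le_rfl

theorem maxE_le_one {n : ℕ} (E : Set (Eu n)) (y : Eu n) : maxE n E y ≤ 1 :=
  iSup₂_le fun _ _ => ENNReal.div_le_of_le_mul (by
    rw [one_mul]; exact measure_mono Set.inter_subset_right)

theorem lt_maxE {n : ℕ} {E : Set (Eu n)} {y : Eu n} {l : ℝ≥0∞} (h : l < maxE n E y) :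
    ∃ z s, 0 < s ∧ y ∈ ball z s ∧ l * volume (ball z s) < volume (E ∩ ball z s) := by
  unfold maxE at h
  simp only [lt_iSup_iff] at h
  obtain ⟨c, ⟨h1, h2⟩, h3⟩ := h
  refine ⟨c.1, c.2, h1, h2, ?_⟩
  exact (ENNReal.lt_div_iff_mul_lt (Or.inl (vol_ball_ne_zero _ h1))
    (Or.inl (vol_ball_ne_top _ _))).1 h3

theorem maxE_measurable {n : ℕ} (E : Set (Eu n)) : Measurable (maxE n E) := by
  have : LowerSemicontinuous (maxE n E) := by
    have e : maxE n E = fun y => ⨆ (c : Eu n × ℝ) (_ : 0 < c.2),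
        (ball c.1 c.2).indicator
          (fun _ => volume (E ∩ ball c.1 c.2) / volume (ball c.1 c.2)) y := by
      funext y
      apply le_antisymm
      · refine iSup₂_le fun c hc => ?_
        refine le_iSup₂_of_le c hc.1 ?_
        rw [Set.indicator_of_mem hc.2]
      · refine iSup₂_le fun c hc => ?_
        by_cases hy : y ∈ ball c.1 c.2
        · rw [Set.indicator_of_mem hy]
          exact le_iSup₂_of_le (f := fun (c : Eu n × ℝ) (_ : 0 < c.2 ∧ y ∈ ball c.1 c.2) =>
            volume (E ∩ ball c.1 c.2) / volume (ball c.1 c.2)) c ⟨hc, hy⟩ le_rfl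
        · rw [Set.indicator_of_notMem hy]; exact zero_le
    rw [e]
    exact lowerSemicontinuous_biSup fun c _ => isOpen_ball.lowerSemicontinuous_indicator zero_le
  exact this.measurable

theorem weak_type {n : ℕ} (F : Set (Eu n)) (hF : MeasurableSet F) (r : ℝ) (l : ℝ≥0∞) :
    volume {y : Eu n | ∃ z s, 0 < s ∧ s ≤ r ∧ y ∈ ball z s ∧
      l * volume (ball z s) < volume (F ∩ ball z s)} * l ≤ ENNReal.ofReal (4 ^ n) * volume F := by
  set t : Set (Eu n × ℝ) := {c | 0 < c.2 ∧ c.2 ≤ r ∧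
    l * volume (ball c.1 c.2) < volume (F ∩ ball c.1 c.2)} with ht
  obtain ⟨u, hut, hud, huc⟩ := Vitali.exists_disjoint_subfamily_covering_enlargement_ball t
    (fun c => c.1) (fun c => c.2) r (fun a ha => ha.2.1) 4 (by norm_num)
  have hcount : u.Countable := hud.countable_of_nonempty_interior (fun c hc => by
    rw [isOpen_ball.interior_eq]; exact nonempty_ball.2 (hut hc).1)
  have := hcount.to_subtype
  have hsub : {y : Eu n | ∃ z s, 0 < s ∧ s ≤ r ∧ y ∈ ball z s ∧
      l * volume (ball z s) < volume (F ∩ ball z s)} ⊆ ⋃ c : u, ball c.1.1 (4 * c.1.2) := by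
    rintro y ⟨z, s, hs, hsr, hy, h⟩
    obtain ⟨c, hc, hsubc⟩ := huc (z, s) ⟨hs, hsr, h⟩
    exact Set.mem_iUnion.2 ⟨⟨c, hc⟩, hsubc hy⟩
  calc _ ≤ (∑' c : u, volume (ball c.1.1 (4 * c.1.2))) * l := by
        gcongr; exact (measure_mono hsub).trans (measure_iUnion_le _)
    _ = ∑' c : u, ENNReal.ofReal (4 ^ n) * (l * volume (ball c.1.1 c.1.2)) := by
        rw [← ENNReal.tsum_mul_right]
        congr 1; funext c
        rw [vol_ball_scale c.1.1 c.1.1 (by norm_num) (hut c.2).1]; ring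
    _ ≤ ∑' c : u, ENNReal.ofReal (4 ^ n) * volume (F ∩ ball c.1.1 c.1.2) := by
        refine ENNReal.tsum_le_tsum fun c => ?_
        gcongr; exact (hut c.2).2.2.le
    _ = ENNReal.ofReal (4 ^ n) * volume (⋃ c : u, F ∩ ball c.1.1 c.1.2) := by
        rw [ENNReal.tsum_mul_left, measure_iUnion]
        · intro c d hcd
          have := hud c.2 d.2 (fun h => hcd (Subtype.ext h))
          exact this.mono Set.inter_subset_right Set.inter_subset_right
        · intro c; exact hF.inter measurableSet_ball
    _ ≤ _ := by gcongr; exact Set.iUnion_subset fun c => Set.inter_subset_left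

theorem maxE_weak {n : ℕ} (E : Set (Eu n)) (hE : MeasurableSet E) {x y0 : Eu n} {r : ℝ} (hr : 0 < r)
    (hy0 : y0 ∈ ball x r) {l : ℝ≥0∞} (hl : ENNReal.ofReal (3 ^ n) * maxE n E y0 ≤ l) :
    volume (ball x r ∩ {y | l < maxE n E y}) * l ≤
      ENNReal.ofReal (12 ^ n) * maxE n E y0 * volume (ball x r) := by
  have hsub : ball x r ∩ {y | l < maxE n E y} ⊆ {y : Eu n | ∃ z s, 0 < s ∧ s ≤ r ∧ y ∈ ball z s ∧
      l * volume (ball z s) < volume ((E ∩ ball x (3 * r)) ∩ ball z s)} := by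
    rintro y ⟨hy, hyl⟩
    obtain ⟨z, s, hs, hyz, h⟩ := lt_maxE hyl
    rw [mem_ball] at hy hyz hy0
    have hsr : s ≤ r := by
      by_contra! hcon
      apply absurd h
      rw [not_lt]
      have h1 : y0 ∈ ball z (3 * s) := by
        rw [mem_ball]
        have := dist_triangle y0 x z
        have h2 := dist_triangle x y z
        rw [dist_comm x y] at h2
        linarith
      calc volume (E ∩ ball z s) ≤ volume (E ∩ ball z (3 * s)) := by
            gcongr; linarith
        _ ≤ maxE n E y0 * volume (ball z (3 * s)) := maxE_ge E (by linarith) h1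
        _ = (ENNReal.ofReal (3 ^ n) * maxE n E y0) * volume (ball z s) := by
            rw [vol_ball_scale z z (by norm_num) hs]; ring
        _ ≤ _ := by gcongr
    refine ⟨z, s, hs, hsr, by rwa [mem_ball], ?_⟩
    convert h using 2
    ext v
    simp only [Set.mem_inter_iff, mem_ball]
    constructor
    · rintro ⟨⟨a, b⟩, c⟩; exact ⟨a, c⟩
    · rintro ⟨a, c⟩
      refine ⟨⟨a, ?_⟩, c⟩
      have h1 := dist_triangle v z x
      have h2 := dist_triangle z y x
      rw [dist_comm z y] at h2
      linarith
  calc _ ≤ _ := mul_le_mul_left (measure_mono hsub) _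
    _ ≤ ENNReal.ofReal (4 ^ n) * volume (E ∩ ball x (3 * r)) :=
        weak_type _ (hE.inter measurableSet_ball) r l
    _ ≤ ENNReal.ofReal (4 ^ n) * (maxE n E y0 * volume (ball x (3 * r))) := by
        gcongr
        exact maxE_ge E (by linarith) (ball_subset_ball (by linarith) hy0)
    _ = _ := by
        rw [vol_ball_scale x x (by norm_num) hr, show (12:ℝ) = 4 * 3 by norm_num, mul_pow,
          ENNReal.ofReal_mul (by positivity)]; ring


theorem one_le_rho_pow {θ s : ℝ} (hθ : 0 < θ) (hs : 0 ≤ s) : (1:ℝ) ≤ (1 + s) ^ θ :=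
  Real.one_le_rpow (by linarith) hθ.le

theorem bmo_of_osc {n : ℕ} {θ : ℝ} (hθ : 0 < θ) {ρ f : Eu n → ℝ} (hρ : ∀ x, 0 ≤ ρ x)
    (hf : LocallyIntegrable f volume) {D : ℝ} (hD : 0 ≤ D)
    (h : ∀ (x : Eu n) (r : ℝ), 0 < r → ∃ c : ℝ,
      ∫⁻ y in ball x r, ‖f y - c‖ₑ ≤ ENNReal.ofReal D * volume (ball x r)) :
    IsBmoBound n θ ρ f (2 * D) := by
  refine ⟨by positivity, fun x r hr => ?_⟩
  obtain ⟨c, hc⟩ := h x r hr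
  have hfi : IntegrableOn f (ball x r) :=
    (hf.integrableOn_isCompact (isCompact_closedBall x r)).mono_set ball_subset_closedBall
  set v := (volume (ball x r)).toReal with hv
  have hvpos : 0 < v := ENNReal.toReal_pos (vol_ball_ne_zero x hr) (vol_ball_ne_top x r)
  have hci : IntegrableOn (fun _ : Eu n => c) (ball x r) :=
    integrableOn_const (vol_ball_ne_top x r)
  have hfc : IntegrableOn (fun y => f y - c) (ball x r) := hfi.sub hci
  have hvr : volume.real (ball x r) = v := rfl
  have h1 : ∫ y in ball x r, |f y - c| ≤ D * v := by
    have : ∫ y in ball x r, |f y - c| = (∫⁻ y in ball x r, ‖f y - c‖ₑ).toReal := by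
      rw [← integral_norm_eq_lintegral_enorm hfc.aestronglyMeasurable]; rfl
    rw [this]
    have := ENNReal.toReal_mono (ENNReal.mul_ne_top ENNReal.ofReal_ne_top (vol_ball_ne_top x r)) hc
    rwa [ENNReal.toReal_mul, ENNReal.toReal_ofReal hD] at this
  have h2 : |c - avgBall n f x r| ≤ D := by
    have : c - avgBall n f x r = - (v⁻¹ * ∫ y in ball x r, (f y - c)) := by
      rw [integral_sub hfi hci, setIntegral_const, hvr, avgBall, ← hv, smul_eq_mul]
      field_simp; ring
    rw [this, abs_neg, abs_mul, abs_of_pos (inv_pos.2 hvpos)]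
    rw [inv_mul_le_iff₀ hvpos, mul_comm v]
    exact (abs_integral_le_integral_abs).trans h1
  have h3 : avgBall n (fun y => |f y - avgBall n f x r|) x r ≤ 2 * D := by
    rw [avgBall, ← hv, inv_mul_le_iff₀ hvpos]
    calc ∫ y in ball x r, |f y - avgBall n f x r|
        ≤ ∫ y in ball x r, (|f y - c| + D) := by
          apply integral_mono_of_nonneg
          · exact Eventually.of_forall fun y => abs_nonneg _
          · exact hfc.abs.add (integrableOn_const (vol_ball_ne_top x r))
          · refine Eventually.of_forall fun y => ?_
            have := abs_sub_le (f y) c (avgBall n f x r)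
            simp only
            linarith
      _ = (∫ y in ball x r, |f y - c|) + v * D := by
          rw [integral_add hfc.abs (integrableOn_const (vol_ball_ne_top x r)), setIntegral_const,
            hvr, smul_eq_mul]
      _ ≤ _ := by linarith
  refine h3.trans ?_
  have := one_le_rho_pow hθ (div_nonneg hr.le (hρ x))
  nlinarith

theorem avgBall_neg {n : ℕ} (f : Eu n → ℝ) (x : Eu n) (r : ℝ) :
    avgBall n (fun y => - f y) x r = - avgBall n f x r := by
  simp [avgBall, integral_neg]

theorem bmo_neg {n : ℕ} {θ : ℝ} {ρ f : Eu n → ℝ} {C : ℝ} (h : IsBmoBound n θ ρ f C) :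
    IsBmoBound n θ ρ (fun y => - f y) C := by
  refine ⟨h.1, fun x r hr => ?_⟩
  have := h.2 x r hr
  rw [avgBall_neg]
  convert this using 3 with y
  rw [← abs_neg]; congr 1; ring

theorem bmo_sub {n : ℕ} {θ : ℝ} {ρ f g : Eu n → ℝ} {C D : ℝ}
    (hf : LocallyIntegrable f volume) (hg : LocallyIntegrable g volume)
    (h : IsBmoBound n θ ρ f C) (h' : IsBmoBound n θ ρ g D) :
    IsBmoBound n θ ρ (fun y => f y - g y) (C + D) := by
  refine ⟨add_nonneg h.1 h'.1, fun x r hr => ?_⟩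
  have h1 := h.2 x r hr
  have h2 := h'.2 x r hr
  have hfi : IntegrableOn f (ball x r) :=
    (hf.integrableOn_isCompact (isCompact_closedBall x r)).mono_set ball_subset_closedBall
  have hgi : IntegrableOn g (ball x r) :=
    (hg.integrableOn_isCompact (isCompact_closedBall x r)).mono_set ball_subset_closedBall
  have hc : ∀ c : ℝ, IntegrableOn (fun _ : Eu n => c) (ball x r) :=
    fun c => integrableOn_const (vol_ball_ne_top x r)
  have e : avgBall n (fun y => f y - g y) x r = avgBall n f x r - avgBall n g x r := by
    rw [avgBall, integral_sub hfi hgi, avgBall, avgBall]; ring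
  rw [add_mul]
  refine le_trans ?_ (add_le_add h1 h2)
  rw [e]
  generalize avgBall n f x r = a
  generalize avgBall n g x r = b
  rw [avgBall, avgBall, avgBall, ← mul_add]
  refine mul_le_mul_of_nonneg_left ?_ (by positivity)
  have ha : IntegrableOn (fun y => |f y - a|) (ball x r) := (hfi.sub (hc a)).abs
  have hb : IntegrableOn (fun y => |g y - b|) (ball x r) := (hgi.sub (hc b)).abs
  rw [← integral_add ha hb]
  apply integral_mono_of_nonneg
  · exact Eventually.of_forall fun y => abs_nonneg _
  · exact ha.add hb
  · refine Eventually.of_forall fun y => ?_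
    have := abs_sub (f y - a) (g y - b)
    simp only
    calc |f y - g y - (a - b)| = |(f y - a) - (g y - b)| := by congr 1; ring
      _ ≤ _ := abs_sub _ _

/-- log of the regularised maximal function. -/
def logM (n : ℕ) (E : Set (Eu n)) (κ : ℝ) (y : Eu n) : ℝ := Real.log (κ + (maxE n E y).toReal)

theorem maxE_ne_top {n : ℕ} (E : Set (Eu n)) (y : Eu n) : maxE n E y ≠ ⊤ :=
  ((maxE_le_one E y).trans_lt ENNReal.one_lt_top).ne

theorem maxE_toReal_le {n : ℕ} (E : Set (Eu n)) (y : Eu n) : (maxE n E y).toReal ≤ 1 := by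
  simpa using ENNReal.toReal_mono ENNReal.one_ne_top (maxE_le_one E y)

theorem logM_measurable {n : ℕ} (E : Set (Eu n)) (κ : ℝ) : Measurable (logM n E κ) :=
  Real.measurable_log.comp (measurable_const.add (maxE_measurable E).ennreal_toReal)

theorem logM_bounded {n : ℕ} (E : Set (Eu n)) {κ : ℝ} (hκ : 0 < κ) (y : Eu n) :
    |logM n E κ y| ≤ |Real.log κ| + |Real.log (κ + 1)| := by
  have h0 : 0 ≤ (maxE n E y).toReal := ENNReal.toReal_nonneg
  have h1 := maxE_toReal_le E y
  have a : Real.log κ ≤ logM n E κ y := Real.log_le_log hκ (by linarith)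
  have b : logM n E κ y ≤ Real.log (κ + 1) := Real.log_le_log (by linarith) (by linarith)
  rw [abs_le]
  constructor
  · linarith [neg_abs_le (Real.log κ), abs_nonneg (Real.log (κ + 1))]
  · linarith [le_abs_self (Real.log (κ + 1)), abs_nonneg (Real.log κ)]

theorem logM_locInt {n : ℕ} (E : Set (Eu n)) {κ : ℝ} (hκ : 0 < κ) :
    LocallyIntegrable (logM n E κ) volume := by
  refine (locallyIntegrable_const (|Real.log κ| + |Real.log (κ + 1)|)).mono
    (logM_measurable E κ).aestronglyMeasurable (Eventually.of_forall fun y => ?_)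
  rw [Real.norm_eq_abs, Real.norm_eq_abs]
  exact (logM_bounded E hκ y).trans (le_abs_self _)

theorem lintegral_exp_neg_Ioi : ∫⁻ t in Set.Ioi (0:ℝ), ENNReal.ofReal (Real.exp (-t)) = 1 := by
  rw [← ofReal_integral_eq_lintegral_ofReal]
  · rw [integral_exp_neg_Ioi_zero]; simp
  · exact integrableOn_exp_neg_Ioi 0
  · exact Eventually.of_forall fun t => (Real.exp_pos _).le

theorem logM_osc {n : ℕ} (E : Set (Eu n)) (hE : MeasurableSet E) {κ : ℝ} (hκ : 0 < κ)
    (x : Eu n) (r : ℝ) (hr : 0 < r) : ∃ c : ℝ,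
    ∫⁻ y in ball x r, ‖logM n E κ y - c‖ₑ ≤
      ENNReal.ofReal (Real.log 2 + 2 * 12 ^ n) * volume (ball x r) := by
  set U : Eu n → ℝ := fun y => κ + (maxE n E y).toReal with hU
  have hUκ : ∀ y, κ ≤ U y := fun y => by
    have : 0 ≤ (maxE n E y).toReal := ENNReal.toReal_nonneg
    simp only [hU]; linarith
  have hUm : Measurable U := measurable_const.add (maxE_measurable E).ennreal_toReal
  obtain ⟨y0, hy0, hmin⟩ : ∃ y0 ∈ ball x r, ∀ y ∈ ball x r, U y0 / 2 ≤ U y := by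
    set S := U '' ball x r
    have hne : S.Nonempty := ⟨U x, x, mem_ball_self hr, rfl⟩
    have hbdd : BddBelow S := ⟨κ, by rintro _ ⟨y, _, rfl⟩; exact hUκ y⟩
    have hpos : κ ≤ sInf S := le_csInf hne (by rintro _ ⟨y, _, rfl⟩; exact hUκ y)
    obtain ⟨_, ⟨y0, hy0, rfl⟩, hlt⟩ := exists_lt_of_csInf_lt hne
      (show sInf S < 2 * sInf S by linarith)
    refine ⟨y0, hy0, fun y hy => ?_⟩
    have := csInf_le hbdd ⟨y, hy, rfl⟩
    linarith
  set a := U y0 with ha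
  have hapos : 0 < a := hκ.trans_le (hUκ y0)
  have hma : maxE n E y0 ≤ ENNReal.ofReal a := by
    rw [← ENNReal.ofReal_toReal (maxE_ne_top E y0)]
    apply ENNReal.ofReal_le_ofReal
    simp only [ha, hU]; linarith
  refine ⟨Real.log a, ?_⟩
  set g : Eu n → ℝ := fun y => max (Real.log (U y) - Real.log a) 0 with hg
  have hgm : Measurable g := ((Real.measurable_log.comp hUm).sub measurable_const).max
    measurable_const
  have hlev : ∀ t : ℝ, 0 < t → volume.restrict (ball x r) {y | t < g y} ≤
      ENNReal.ofReal (2 * 12 ^ n) * volume (ball x r) * ENNReal.ofReal (Real.exp (-t)) := by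
    intro t ht
    by_cases hsmall : Real.exp t ≤ 2 * 12 ^ n
    · calc _ ≤ volume.restrict (ball x r) Set.univ := measure_mono (Set.subset_univ _)
        _ = 1 * volume (ball x r) := by simp
        _ ≤ (ENNReal.ofReal (2 * 12 ^ n) * ENNReal.ofReal (Real.exp (-t))) *
              volume (ball x r) := by
            gcongr
            rw [← ENNReal.ofReal_mul (by positivity), ← ENNReal.ofReal_one]
            apply ENNReal.ofReal_le_ofReal
            rw [Real.exp_neg, ← div_eq_mul_inv, le_div_iff₀ (Real.exp_pos _)]
            linarith
        _ = _ := by ring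
    · rw [not_le] at hsmall
      have h12 : (1:ℝ) ≤ 12 ^ n := one_le_pow₀ (by norm_num)
      set l : ℝ := Real.exp t * a / 2 with hl
      have hlpos : 0 < l := by positivity
      have hsub : {y | t < g y} ∩ ball x r ⊆
          ball x r ∩ {y | ENNReal.ofReal l < maxE n E y} := by
        rintro y ⟨hy, hyb⟩
        refine ⟨hyb, ?_⟩
        simp only [hg, Set.mem_ofPred_eq, lt_max_iff] at hy
        rcases hy with hy | hy
        · have hUy : 0 < U y := hκ.trans_le (hUκ y)
          have : Real.exp t * a < U y := by
            have := Real.exp_lt_exp.2 (show t + Real.log a < Real.log (U y) by linarith)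
            rwa [Real.exp_add, Real.exp_log hapos, Real.exp_log hUy] at this
          rw [Set.mem_ofPred_eq, ENNReal.ofReal_lt_iff_lt_toReal hlpos.le (maxE_ne_top E y)]
          have hκa : κ ≤ a := hUκ y0
          have : Real.exp t * a < κ + (maxE n E y).toReal := this
          have h4 : 2 * a ≤ Real.exp t * a := by gcongr; linarith
          rw [hl]; linarith
        · linarith
      have h3 : (3:ℝ) ^ n ≤ 12 ^ n := pow_le_pow_left₀ (by norm_num) (by norm_num) n
      have hw := maxE_weak E hE hr hy0 (l := ENNReal.ofReal l) (by
        calc _ ≤ ENNReal.ofReal (3 ^ n) * ENNReal.ofReal a := by gcongr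
          _ ≤ _ := by
            rw [← ENNReal.ofReal_mul (by positivity)]
            apply ENNReal.ofReal_le_ofReal
            have : (2 * 12 ^ n) * a ≤ Real.exp t * a := by gcongr
            have h5 : (3:ℝ) ^ n * a ≤ 12 ^ n * a := by gcongr
            rw [hl]; linarith)
      rw [Measure.restrict_apply (measurableSet_lt measurable_const hgm)]
      have hlne : ENNReal.ofReal l ≠ 0 := by simpa using hlpos
      calc _ ≤ volume (ball x r ∩ {y | ENNReal.ofReal l < maxE n E y}) := measure_mono hsub
        _ ≤ (ENNReal.ofReal (12 ^ n) * ENNReal.ofReal a * volume (ball x r)) /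
            ENNReal.ofReal l := by
            rw [ENNReal.le_div_iff_mul_le (Or.inl hlne) (Or.inl ENNReal.ofReal_ne_top)]
            refine hw.trans ?_
            gcongr
        _ = _ := by
            rw [div_eq_mul_inv, ← ENNReal.ofReal_inv_of_pos hlpos,
              mul_right_comm, ← ENNReal.ofReal_mul (by positivity),
              ← ENNReal.ofReal_mul (by positivity), mul_right_comm (ENNReal.ofReal (2 * 12 ^ n)),
              ← ENNReal.ofReal_mul (by positivity)]
            congr 2
            rw [hl, Real.exp_neg]; field_simp
  have hpt : ∀ y ∈ ball x r, ‖logM n E κ y - Real.log a‖ₑ ≤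
      ENNReal.ofReal (Real.log 2) + ENNReal.ofReal (g y) := by
    intro y hy
    have hl2 : 0 ≤ Real.log 2 := Real.log_nonneg (by norm_num)
    have hg0 : 0 ≤ g y := le_max_right _ _
    rw [← ENNReal.ofReal_add hl2 hg0, Real.enorm_eq_ofReal_abs]
    apply ENNReal.ofReal_le_ofReal
    have h1 : Real.log a - Real.log 2 ≤ Real.log (U y) := by
      rw [← Real.log_div hapos.ne' (by norm_num)]
      exact Real.log_le_log (by positivity) (hmin y hy)
    have h2 : Real.log (U y) - Real.log a ≤ g y := le_max_left _ _
    change |Real.log (U y) - Real.log a| ≤ _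
    rw [abs_le]; constructor <;> linarith
  calc _ ≤ ∫⁻ y in ball x r, (ENNReal.ofReal (Real.log 2) + ENNReal.ofReal (g y)) :=
        setLIntegral_mono' measurableSet_ball hpt
    _ = ENNReal.ofReal (Real.log 2) * volume (ball x r) +
        ∫⁻ y in ball x r, ENNReal.ofReal (g y) := by
        rw [lintegral_add_left measurable_const, lintegral_const]; simp
    _ ≤ ENNReal.ofReal (Real.log 2) * volume (ball x r) +
        ENNReal.ofReal (2 * 12 ^ n) * volume (ball x r) := by
        gcongr
        have hg0 : 0 ≤ᵐ[volume.restrict (ball x r)] g :=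
          Eventually.of_forall fun y => le_max_right _ _
        rw [lintegral_eq_lintegral_meas_lt _ hg0 hgm.aemeasurable]
        calc _ ≤ ∫⁻ t in Set.Ioi (0:ℝ), ENNReal.ofReal (2 * 12 ^ n) * volume (ball x r) *
                ENNReal.ofReal (Real.exp (-t)) := setLIntegral_mono' measurableSet_Ioi hlev
          _ = _ := by
            rw [lintegral_const_mul _ (by fun_prop), lintegral_exp_neg_Ioi, mul_one]
    _ = _ := by
        rw [← add_mul, ENNReal.ofReal_add (Real.log_nonneg (by norm_num)) (by positivity)]

theorem logM_bmo {n : ℕ} {θ : ℝ} (hθ : 0 < θ) {ρ : Eu n → ℝ} (hρ : ∀ x, 0 ≤ ρ x)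
    (E : Set (Eu n)) (hE : MeasurableSet E) {κ : ℝ} (hκ : 0 < κ) :
    IsBmoBound n θ ρ (logM n E κ) (2 * (Real.log 2 + 2 * 12 ^ n)) :=
  bmo_of_osc hθ hρ (logM_locInt E hκ)
    (add_nonneg (Real.log_nonneg (by norm_num)) (by positivity)) (logM_osc E hE hκ)

theorem logM_on {n : ℕ} {E : Set (Eu n)} (hE : IsOpen E) {κ : ℝ} (hκ : 0 < κ) {y : Eu n}
    (hy : y ∈ E) : 0 ≤ logM n E κ y := by
  obtain ⟨s, hs, hsE⟩ := Metric.isOpen_iff.1 hE y hy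
  have h := maxE_ge E hs (mem_ball_self (x := y) hs)
  rw [Set.inter_eq_right.2 hsE] at h
  have h1 : 1 ≤ maxE n E y := by
    by_contra! hlt
    have := ENNReal.mul_lt_mul_left (vol_ball_ne_zero y hs) (vol_ball_ne_top y s) hlt
    rw [one_mul] at this
    exact absurd h (not_le.2 this)
  have h2 : (1:ℝ) ≤ (maxE n E y).toReal := by
    simpa using ENNReal.toReal_mono (maxE_ne_top E y) h1
  exact Real.log_nonneg (by linarith)

theorem logM_off {n : ℕ} {E : Set (Eu n)} {κ s : ℝ} (hκ : 0 < κ) (hs : 0 < s)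
    (hvol : volume E ≤ ENNReal.ofReal (κ * (s / 2) ^ n) * volume (ball (0 : Eu n) 1)) {x : Eu n}
    (hx : ∀ y ∈ E, s ≤ dist x y) : logM n E κ x ≤ Real.log (2 * κ) := by
  have h : maxE n E x ≤ ENNReal.ofReal κ := by
    refine iSup₂_le fun c hc => ?_
    by_cases hne : (E ∩ ball c.1 c.2).Nonempty
    · obtain ⟨y, hyE, hyb⟩ := hne
      have h1 := hx y hyE
      have hr : s / 2 ≤ c.2 := by
        have := dist_triangle_right x y c.1
        have a := hc.2
        rw [mem_ball] at a hyb
        linarith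
      apply ENNReal.div_le_of_le_mul
      calc volume (E ∩ ball c.1 c.2) ≤ volume E := measure_mono Set.inter_subset_left
        _ ≤ _ := hvol
        _ = ENNReal.ofReal κ * volume (ball c.1 (s / 2)) := by
          rw [Measure.addHaar_ball_of_pos volume c.1 (by positivity : 0 < s / 2), ENNReal.ofReal_mul hκ.le,
            finrank_euclideanSpace_fin, mul_assoc]
        _ ≤ _ := by gcongr
    · rw [Set.not_nonempty_iff_eq_empty.1 hne]; simp
  have h2 : (maxE n E x).toReal ≤ κ := by
    have := ENNReal.toReal_mono ENNReal.ofReal_ne_top h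
    rwa [ENNReal.toReal_ofReal hκ.le] at this
  have h3 : 0 ≤ (maxE n E x).toReal := ENNReal.toReal_nonneg
  exact Real.log_le_log (by linarith) (by linarith)


/-- `L^p` size of a (possibly nonmeasurable) nonnegative function. -/
def NN {α : Type*} [MeasurableSpace α] (μ : Measure α) (p : ℝ) (Φ : α → ℝ≥0∞) : ℝ≥0∞ :=
  (∫⁻ x, Φ x ^ p ∂μ) ^ (1 / p)

section NNlemmas
variable {α : Type*} [MeasurableSpace α] {μ : Measure α} {p : ℝ}

theorem NN_mono_ae (hp : 1 < p) {Φ Ψ : α → ℝ≥0∞} (h : ∀ᵐ x ∂μ, Φ x ≤ Ψ x) :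
    NN μ p Φ ≤ NN μ p Ψ := by
  unfold NN
  refine ENNReal.rpow_le_rpow (lintegral_mono_ae ?_) (by positivity)
  filter_upwards [h] with x hx
  exact ENNReal.rpow_le_rpow hx (by linarith)

theorem NN_mono (hp : 1 < p) {Φ Ψ : α → ℝ≥0∞} (h : ∀ x, Φ x ≤ Ψ x) :
    NN μ p Φ ≤ NN μ p Ψ := NN_mono_ae hp (Eventually.of_forall h)

theorem NN_add_le (hp : 1 < p) {u v : α → ℝ≥0∞} (hv : AEMeasurable v μ) :
    NN μ p (fun x => u x + v x) ≤ NN μ p u + NN μ p v := by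
  have hp0 : 0 < p := by linarith
  obtain ⟨m, hm, hmle, hmeq⟩ := exists_measurable_le_lintegral_eq μ (fun x => (u x + v x) ^ p)
  set z : α → ℝ≥0∞ := fun x => m x ^ (1 / p) - v x with hz
  have hzm : AEMeasurable z μ := (hm.pow_const _).aemeasurable.sub hv
  have hroot : ∀ x, m x ^ (1 / p) ≤ u x + v x := fun x => by
    have := ENNReal.rpow_le_rpow (hmle x) (by positivity : 0 ≤ 1 / p)
    simpa [← ENNReal.rpow_mul, hp0.ne'] using this
  have hzu : ∀ x, z x ≤ u x := fun x => by
    simp only [hz]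
    exact tsub_le_iff_right.2 (hroot x)
  have h1 : ∀ x, m x ≤ (z x + v x) ^ p := fun x => by
    have : m x ^ (1 / p) ≤ z x + v x := le_tsub_add
    have := ENNReal.rpow_le_rpow this hp0.le
    simpa [← ENNReal.rpow_mul, hp0.ne'] using this
  calc NN μ p (fun x => u x + v x) = (∫⁻ x, m x ∂μ) ^ (1 / p) := by rw [NN, hmeq]
    _ ≤ (∫⁻ x, ((z + v) x) ^ p ∂μ) ^ (1 / p) :=
      ENNReal.rpow_le_rpow (lintegral_mono h1) (by positivity)
    _ ≤ NN μ p z + NN μ p v := ENNReal.lintegral_Lp_add_le hzm hv hp.le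
    _ ≤ _ := by
      gcongr
      exact NN_mono hp hzu

theorem NN_const_mul (hp : 1 < p) {c : ℝ≥0∞} (hc : c ≠ ⊤) (Φ : α → ℝ≥0∞) :
    NN μ p (fun x => c * Φ x) = c * NN μ p Φ := by
  have hp0 : 0 < p := by linarith
  unfold NN
  simp_rw [ENNReal.mul_rpow_of_nonneg _ _ hp0.le]
  rw [lintegral_const_mul' _ _ (ENNReal.rpow_ne_top_of_nonneg hp0.le hc),
    ENNReal.mul_rpow_of_nonneg _ _ (by positivity), ← ENNReal.rpow_mul]
  simp [hp0.ne']

theorem NN_zero (hp : 1 < p) : NN μ p (fun _ => 0) = 0 := by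
  have hp0 : 0 < p := by linarith
  simp [NN, hp0]

theorem NN_sum_le (hp : 1 < p) {ι : Type*} (s : Finset ι) (Φ : ι → α → ℝ≥0∞)
    (h : ∀ i ∈ s, AEMeasurable (Φ i) μ) :
    NN μ p (fun x => ∑ i ∈ s, Φ i x) ≤ ∑ i ∈ s, NN μ p (Φ i) := by
  classical
  induction s using Finset.induction_on with
  | empty => simp [NN_zero hp]
  | insert i s hi ih =>
    simp only [Finset.sum_insert hi]
    refine (NN_add_le hp ?_).trans ?_
    · exact Finset.aemeasurable_fun_sum s fun j hj => h j (Finset.mem_insert_of_mem hj)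
    · gcongr
      exact ih fun j hj => h j (Finset.mem_insert_of_mem hj)

theorem NN_ae_lt_top (hp : 1 < p) {Φ : α → ℝ≥0∞} (hm : AEMeasurable Φ μ) (h : NN μ p Φ < ⊤) :
    ∀ᵐ x ∂μ, Φ x < ⊤ := by
  have hp0 : 0 < p := by linarith
  have h1 : ∫⁻ x, Φ x ^ p ∂μ ≠ ⊤ := by
    intro h2
    rw [NN, h2, ENNReal.top_rpow_of_pos (by positivity)] at h
    exact lt_irrefl _ h
  filter_upwards [ae_lt_top' (hm.pow_const p) h1] with x hx
  by_contra h3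
  rw [not_lt, top_le_iff] at h3
  rw [h3, ENNReal.top_rpow_of_pos hp0] at hx
  exact lt_irrefl _ hx

theorem NN_ae_zero (hp : 1 < p) {Φ : α → ℝ≥0∞} (hm : AEMeasurable Φ μ) (h : NN μ p Φ = 0) :
    ∀ᵐ x ∂μ, Φ x = 0 := by
  have hp0 : 0 < p := by linarith
  have h1 : ∫⁻ x, Φ x ^ p ∂μ = 0 := by
    simpa [NN, ENNReal.rpow_eq_zero_iff, hp0, hp0.le, not_lt.2] using h
  filter_upwards [(lintegral_eq_zero_iff' (hm.pow_const p)).1 h1] with x hx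
  simpa [ENNReal.rpow_eq_zero_iff, hp0, not_lt.2 hp0.le] using hx

/-- Monotone convergence. -/
theorem NN_iSup_le (hp : 1 < p) {Φ : ℕ → α → ℝ≥0∞} (hm : ∀ i, AEMeasurable (Φ i) μ)
    (hmono : ∀ x, Monotone fun i => Φ i x) {D : ℝ≥0∞} (h : ∀ i, NN μ p (Φ i) ≤ D) :
    NN μ p (fun x => ⨆ i, Φ i x) ≤ D := by
  have hp0 : 0 < p := by linarith
  have e : ∀ x, (⨆ i, Φ i x) ^ p = ⨆ i, Φ i x ^ p := fun x =>
    (ENNReal.orderIsoRpow p hp0).map_iSup _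
  unfold NN
  simp_rw [e]
  rw [lintegral_iSup' (fun i => (hm i).pow_const p)
    (Eventually.of_forall fun x i j hij => ENNReal.rpow_le_rpow (hmono x hij) hp0.le)]
  have e2 : (⨆ i, ∫⁻ x, Φ i x ^ p ∂μ) ^ (1 / p) = ⨆ i, (∫⁻ x, Φ i x ^ p ∂μ) ^ (1 / p) :=
    (ENNReal.orderIsoRpow (1 / p) (by positivity)).map_iSup _
  rw [e2]
  exact iSup_le h

theorem NN_eq_eLpNorm (hp : 1 < p) (f : α → ℝ) :
    NN μ p (fun x => ‖f x‖ₑ) = eLpNorm f (ENNReal.ofReal p) μ := by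
  have hp0 : 0 < p := by linarith
  rw [eLpNorm_eq_lintegral_rpow_enorm_toReal (by simpa using hp0) ENNReal.ofReal_ne_top,
    ENNReal.toReal_ofReal hp0.le, NN]
end NNlemmas

/-- The weighted measure. -/
def wm (n : ℕ) (w : Eu n → ℝ) : Measure (Eu n) := volume.withDensity fun x => ENNReal.ofReal (w x)

theorem wm_ac (n : ℕ) (w : Eu n → ℝ) : wm n w ≪ volume := withDensity_absolutelyContinuous _ _

theorem wLpNorm_eq {n : ℕ} {p : ℝ} (hp : 1 < p) {w : Eu n → ℝ} (hw0 : ∀ x, 0 ≤ w x)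
    (hw : LocallyIntegrable w volume) (f : Eu n → ℝ) :
    wLpNorm n p w f = NN (wm n w) p (fun x => ‖f x‖ₑ) := by
  have hp0 : 0 < p := by linarith
  unfold wLpNorm NN wm
  rw [lintegral_withDensity_eq_lintegral_mul_non_measurable₀ _
    hw.aestronglyMeasurable.aemeasurable.ennreal_ofReal
    (Eventually.of_forall fun x => ENNReal.ofReal_lt_top)]
  congr 2
  funext x
  simp only [Pi.mul_apply]
  rw [ENNReal.ofReal_mul (by positivity), Real.enorm_eq_ofReal_abs,
    ENNReal.ofReal_rpow_of_nonneg (abs_nonneg _) hp0.le, mul_comm]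

theorem wm_finite {n : ℕ} {w : Eu n → ℝ} (hw : LocallyIntegrable w volume) {K : Set (Eu n)}
    (hK : IsCompact K) : wm n w K < ⊤ := by
  rw [wm, withDensity_apply _ hK.measurableSet]
  have := (hw.integrableOn_isCompact hK).2
  refine lt_of_le_of_lt (lintegral_mono fun x => ?_) this
  exact Real.ofReal_le_enorm _


/-- The part of the hypotheses that is used in the proof. -/
structure Ctx (n : ℕ) (p θ : ℝ) (ρ w : Eu n → ℝ) (k : ℝ → Eu n → Eu n → ℝ) (C₀ : ℝ) : Prop where
  hn : 0 < n
  hp : 1 < p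
  hθ : 0 < θ
  hρ : ∀ x, 0 ≤ ρ x
  hw0 : ∀ x, 0 ≤ w x
  hwl : LocallyIntegrable w volume
  hkm : ∀ t, Measurable (Function.uncurry (k t))
  hk1 : ∃ C > (0:ℝ), ∀ t > (0:ℝ), ∀ x y : Eu n, 0 < k t x y ∧
    k t x y ≤ C * t ^ (-(n : ℝ) / 2) * Real.exp (-(dist x y) ^ 2 / (5 * t))
  hk2 : ∃ δ > (0:ℝ), ∃ c > (0:ℝ), ∃ C > (0:ℝ), ∀ t > (0:ℝ), ∀ x y h : Eu n, ‖h‖ ≤ Real.sqrt t →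
    |k t (x + h) y - k t x y| ≤
      C * (‖h‖ / Real.sqrt t) ^ δ * t ^ (-(n : ℝ) / 2) * Real.exp (-c * (dist x y) ^ 2 / t)
  hC₀ : 0 < C₀
  hT : ∀ f : Eu n → ℝ, MemWLp n p w f →
      wLpNorm n p w (Tstar n k f) ≤ ENNReal.ofReal C₀ * wLpNorm n p w f
  hTb : ∀ (b' : Eu n → ℝ) (Cb : ℝ), MemBMOTheta n θ ρ b' →
      IsBmoBound n θ ρ b' Cb → ∀ f : Eu n → ℝ, MemWLp n p w f →
        wLpNorm n p w (TstarB n k b' f) ≤ ENNReal.ofReal (C₀ * Cb) * wLpNorm n p w f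

/-- Maximal integral of absolute values. -/
def Pg {n : ℕ} (k : ℝ → Eu n → Eu n → ℝ) (c : Eu n → Eu n → ℝ) (f : Eu n → ℝ) (x : Eu n) : ℝ≥0∞ :=
  ⨆ (t : ℝ) (_ : 0 < t), ∫⁻ y, ‖k t x y * c x y * f y‖ₑ

/-- Maximal operator with coefficient. -/
def Tc {n : ℕ} (k : ℝ → Eu n → Eu n → ℝ) (c : Eu n → Eu n → ℝ) (f : Eu n → ℝ) (x : Eu n) : ℝ :=
  ⨆ (t : ℝ) (_ : 0 < t), |∫ y, k t x y * c x y * f y|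

theorem rsup_le {u : ℝ → ℝ} {M : ℝ} (hM : 0 ≤ M) (h : ∀ t, 0 < t → u t ≤ M) :
    (⨆ (t : ℝ) (_ : 0 < t), u t) ≤ M :=
  Real.iSup_le (fun t => Real.iSup_le (fun ht => h t ht) hM) hM

theorem le_rsup {u : ℝ → ℝ} {M : ℝ} (hM : 0 ≤ M) (h : ∀ t, 0 < t → u t ≤ M) {t : ℝ} (ht : 0 < t) :
    u t ≤ ⨆ (t : ℝ) (_ : 0 < t), u t := by
  have hb : BddAbove (Set.range fun t : ℝ => ⨆ (_ : 0 < t), u t) := by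
    refine ⟨M, ?_⟩
    rintro _ ⟨s, rfl⟩
    exact Real.iSup_le (fun hs => h s hs) hM
  refine le_trans ?_ (le_ciSup hb t)
  simp [ht]

theorem rsup_nonneg {u : ℝ → ℝ} (h : ∀ t, 0 ≤ u t) : 0 ≤ ⨆ (t : ℝ) (_ : 0 < t), u t :=
  Real.iSup_nonneg fun t => Real.iSup_nonneg fun _ => h t

theorem Tc_nonneg {n : ℕ} (k : ℝ → Eu n → Eu n → ℝ) (c : Eu n → Eu n → ℝ) (f : Eu n → ℝ)
    (x : Eu n) : 0 ≤ Tc k c f x := rsup_nonneg fun _ => abs_nonneg _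

section
variable {n : ℕ} {p θ : ℝ} {ρ w : Eu n → ℝ} {k : ℝ → Eu n → Eu n → ℝ} {C₀ : ℝ}
variable {c c' : Eu n → Eu n → ℝ} {f : Eu n → ℝ} {x : Eu n}

theorem abs_int_le (h : Pg k c f x < ⊤) {t : ℝ} (ht : 0 < t) :
    |∫ y, k t x y * c x y * f y| ≤ (Pg k c f x).toReal := by
  have h1 : ∫⁻ y, ‖k t x y * c x y * f y‖ₑ ≤ Pg k c f x :=
    le_iSup₂ (f := fun t (_ : 0 < t) => ∫⁻ y, ‖k t x y * c x y * f y‖ₑ) t ht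
  have h2 := (enorm_integral_le_lintegral_enorm (fun y => k t x y * c x y * f y)
    (μ := volume)).trans h1
  rw [Real.enorm_eq_ofReal_abs] at h2
  have h3 := ENNReal.toReal_mono h.ne h2
  rwa [ENNReal.toReal_ofReal (abs_nonneg _)] at h3

theorem Tc_le_Pg : ‖Tc k c f x‖ₑ ≤ Pg k c f x := by
  by_cases h : Pg k c f x < ⊤
  · rw [Real.enorm_eq_ofReal_abs, abs_of_nonneg (Tc_nonneg ..)]
    apply ENNReal.ofReal_le_of_le_toReal
    exact rsup_le ENNReal.toReal_nonneg fun t ht => abs_int_le h ht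
  · rw [not_lt, top_le_iff] at h
    rw [h]; exact le_top

theorem meas_integrand (hk : ∀ t, Measurable (Function.uncurry (k t)))
    (hc : AEStronglyMeasurable (c x) volume) (hf : AEStronglyMeasurable f volume) (t : ℝ) :
    AEStronglyMeasurable (fun y => k t x y * c x y * f y) volume :=
  ((((hk t).comp (measurable_prodMk_left (x := x))).aestronglyMeasurable).mul hc).mul hf

theorem int_integrand (hk : ∀ t, Measurable (Function.uncurry (k t)))
    (hc : AEStronglyMeasurable (c x) volume) (hf : AEStronglyMeasurable f volume)
    (h : Pg k c f x < ⊤) {t : ℝ} (ht : 0 < t) :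
    Integrable (fun y => k t x y * c x y * f y) volume :=
  ⟨meas_integrand hk hc hf t, lt_of_le_of_lt
    (le_iSup₂ (f := fun t (_ : 0 < t) => ∫⁻ y, ‖k t x y * c x y * f y‖ₑ) t ht) h⟩

/-- Lemma D, first form. -/
theorem Tc_sub_le (hk : ∀ t, Measurable (Function.uncurry (k t)))
    (hc : AEStronglyMeasurable (c x) volume) (hc' : AEStronglyMeasurable (c' x) volume)
    (hf : AEStronglyMeasurable f volume)
    (h : Pg k c f x < ⊤) (h' : Pg k c' f x < ⊤) :
    |Tc k c f x - Tc k c' f x| ≤ Tc k (fun x y => c x y - c' x y) f x := by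
  have e : ∀ t, 0 < t → ∫ y, k t x y * (c x y - c' x y) * f y =
      (∫ y, k t x y * c x y * f y) - ∫ y, k t x y * c' x y * f y := fun t ht => by
    rw [← integral_sub (int_integrand hk hc hf h ht) (int_integrand hk hc' hf h' ht)]
    congr 1; funext y; ring
  have hb : ∀ t, 0 < t → |∫ y, k t x y * (c x y - c' x y) * f y| ≤
      (Pg k c f x).toReal + (Pg k c' f x).toReal := fun t ht => by
    rw [e t ht]
    exact (abs_sub _ _).trans (add_le_add (abs_int_le h ht) (abs_int_le h' ht))
  have h0 : 0 ≤ (Pg k c f x).toReal + (Pg k c' f x).toReal := by positivity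
  set R := Tc k (fun x y => c x y - c' x y) f x with hR
  have hRt : ∀ t, 0 < t → |∫ y, k t x y * (c x y - c' x y) * f y| ≤ R := fun t ht =>
    le_rsup h0 hb ht
  rw [abs_sub_le_iff]
  constructor
  · rw [sub_le_iff_le_add]
    refine rsup_le (add_nonneg (Tc_nonneg ..) (Tc_nonneg ..)) fun t ht => ?_
    have h1 := hRt t ht
    have h2 : |∫ y, k t x y * c' x y * f y| ≤ Tc k c' f x :=
      le_rsup (u := fun t => |∫ y, k t x y * c' x y * f y|) ENNReal.toReal_nonneg
        (fun t ht => abs_int_le h' ht) ht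
    rw [e t ht] at h1
    have := abs_sub_abs_le_abs_sub (∫ y, k t x y * c x y * f y) (∫ y, k t x y * c' x y * f y)
    linarith
  · rw [sub_le_iff_le_add]
    refine rsup_le (add_nonneg (Tc_nonneg ..) (Tc_nonneg ..)) fun t ht => ?_
    have h1 := hRt t ht
    have h2 : |∫ y, k t x y * c x y * f y| ≤ Tc k c f x :=
      le_rsup (u := fun t => |∫ y, k t x y * c x y * f y|) ENNReal.toReal_nonneg
        (fun t ht => abs_int_le h ht) ht
    rw [e t ht, abs_sub_comm] at h1
    have := abs_sub_abs_le_abs_sub (∫ y, k t x y * c' x y * f y) (∫ y, k t x y * c x y * f y)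
    linarith

/-- Lemma D, second form. -/
theorem Tc_sub_le_Pg (hk : ∀ t, Measurable (Function.uncurry (k t)))
    (hc : AEStronglyMeasurable (c x) volume) (hc' : AEStronglyMeasurable (c' x) volume)
    (hf : AEStronglyMeasurable f volume)
    (h : Pg k c f x < ⊤) (h' : Pg k c' f x < ⊤) :
    ‖Tc k c f x - Tc k c' f x‖ₑ ≤ Pg k (fun x y => c x y - c' x y) f x := by
  refine le_trans ?_ Tc_le_Pg
  rw [Real.enorm_eq_ofReal_abs, Real.enorm_eq_ofReal_abs]
  exact ENNReal.ofReal_le_ofReal ((Tc_sub_le hk hc hc' hf h h').trans (le_abs_self _))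

theorem Pg_le_Tc (hk : ∀ t, Measurable (Function.uncurry (k t)))
    (hc : AEStronglyMeasurable (c x) volume) (hf : AEStronglyMeasurable f volume)
    (h : Pg k c f x < ⊤) (hpos : ∀ t, 0 < t → ∀ y, 0 ≤ k t x y * c x y * f y) :
    Pg k c f x ≤ ‖Tc k c f x‖ₑ := by
  refine iSup₂_le fun t ht => ?_
  have hi := int_integrand hk hc hf h ht
  have e : ∫⁻ y, ‖k t x y * c x y * f y‖ₑ = ENNReal.ofReal (∫ y, k t x y * c x y * f y) := by
    rw [ofReal_integral_eq_lintegral_ofReal hi (Eventually.of_forall (hpos t ht))]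
    refine lintegral_congr fun y => ?_
    rw [Real.enorm_eq_ofReal (hpos t ht y)]
  rw [e, Real.enorm_eq_ofReal_abs, abs_of_nonneg (Tc_nonneg ..)]
  apply ENNReal.ofReal_le_ofReal
  refine (le_abs_self _).trans ?_
  exact le_rsup (u := fun t => |∫ y, k t x y * c x y * f y|) ENNReal.toReal_nonneg
        (fun t ht => abs_int_le h ht) ht

theorem Pg_mono {f' : Eu n → ℝ} (h : ∀ y, |c x y * f y| ≤ |c' x y * f' y|) :
    Pg k c f x ≤ Pg k c' f' x := by
  refine iSup₂_mono fun t ht => lintegral_mono fun y => ?_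
  rw [mul_assoc, mul_assoc, enorm_mul, enorm_mul (k t x y)]
  gcongr
  rw [Real.enorm_eq_ofReal_abs, Real.enorm_eq_ofReal_abs]
  exact ENNReal.ofReal_le_ofReal (h y)

theorem Pg_add_le (hk : ∀ t, Measurable (Function.uncurry (k t)))
    {c₁ : Eu n → Eu n → ℝ} {f₁ : Eu n → ℝ} {f' : Eu n → ℝ}
    (hc' : AEStronglyMeasurable (c' x) volume) (hf' : AEStronglyMeasurable f' volume)
    (h : ∀ y, |c x y * f y| ≤ |c₁ x y * f₁ y| + |c' x y * f' y|) :
    Pg k c f x ≤ Pg k c₁ f₁ x + Pg k c' f' x := by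
  refine iSup₂_le fun t ht => ?_
  calc ∫⁻ y, ‖k t x y * c x y * f y‖ₑ
      ≤ ∫⁻ y, (‖k t x y * c₁ x y * f₁ y‖ₑ + ‖k t x y * c' x y * f' y‖ₑ) := by
        refine lintegral_mono fun y => ?_
        rw [mul_assoc, mul_assoc, mul_assoc, enorm_mul, enorm_mul (k t x y), enorm_mul (k t x y),
          ← mul_add]
        gcongr
        rw [Real.enorm_eq_ofReal_abs, Real.enorm_eq_ofReal_abs, Real.enorm_eq_ofReal_abs,
          ← ENNReal.ofReal_add (abs_nonneg _) (abs_nonneg _)]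
        exact ENNReal.ofReal_le_ofReal (h y)
    _ = _ := lintegral_add_right' _ (meas_integrand hk hc' hf' t).enorm
    _ ≤ _ := add_le_add
      (le_iSup₂ (f := fun t (_ : 0 < t) => ∫⁻ y, ‖k t x y * c₁ x y * f₁ y‖ₑ) t ht)
      (le_iSup₂ (f := fun t (_ : 0 < t) => ∫⁻ y, ‖k t x y * c' x y * f' y‖ₑ) t ht)

theorem Pg_const_mul (B : ℝ) : Pg k (fun x y => B * c x y) f x = ‖B‖ₑ * Pg k c f x := by
  unfold Pg
  simp_rw [ENNReal.mul_iSup]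
  congr 1; funext t; congr 1; funext ht
  rw [← lintegral_const_mul' _ _ enorm_ne_top]
  refine lintegral_congr fun y => ?_
  rw [← enorm_mul]; congr 1; ring

variable (H : Ctx n p θ ρ w k C₀)
include H

theorem Ctx.gauss : ∃ G : ℝ, 0 ≤ G ∧ ∀ t, 0 < t → ∀ x, ∫⁻ y, ‖k t x y‖ₑ ≤ ENNReal.ofReal G := by
  obtain ⟨C, hC, h⟩ := H.hk1
  refine ⟨C * (5 * Real.pi) ^ ((n:ℝ) / 2), by positivity, fun t ht x => ?_⟩
  have hb : 0 < 1 / (5 * t) := by positivity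
  have e1 := GaussianFourier.integral_rexp_neg_mul_sq_norm (V := Eu n) hb
  rw [finrank_euclideanSpace_fin] at e1
  have hi : Integrable (fun v : Eu n => Real.exp (-(1 / (5 * t)) * ‖v‖ ^ 2)) := by
    by_contra hni
    rw [integral_undef hni] at e1
    have : 0 < (Real.pi / (1 / (5 * t))) ^ ((n:ℝ) / 2) := by positivity
    linarith
  have hi2 : Integrable (fun y : Eu n => Real.exp (-(dist x y) ^ 2 / (5 * t))) := by
    have := hi.comp_sub_left x
    refine this.congr (Eventually.of_forall fun y => ?_)
    simp only [dist_eq_norm]; congr 1; ring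
  have e2 : ∫ y : Eu n, Real.exp (-(dist x y) ^ 2 / (5 * t)) = (5 * Real.pi * t) ^ ((n:ℝ) / 2) := by
    rw [show 5 * Real.pi * t = Real.pi / (1 / (5 * t)) by field_simp, ← e1,
      ← integral_sub_left_eq_self (fun v : Eu n => Real.exp (-(1 / (5 * t)) * ‖v‖ ^ 2)) volume x]
    congr 1; funext y; simp only [dist_eq_norm]; congr 1; ring
  calc ∫⁻ y, ‖k t x y‖ₑ ≤ ∫⁻ y, ENNReal.ofReal (C * t ^ (-(n : ℝ) / 2) *
        Real.exp (-(dist x y) ^ 2 / (5 * t))) := by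
        refine lintegral_mono fun y => ?_
        rw [Real.enorm_eq_ofReal (h t ht x y).1.le]
        exact ENNReal.ofReal_le_ofReal (h t ht x y).2
    _ = ENNReal.ofReal (∫ y, C * t ^ (-(n : ℝ) / 2) * Real.exp (-(dist x y) ^ 2 / (5 * t))) := by
        rw [ofReal_integral_eq_lintegral_ofReal (hi2.const_mul _)]
        exact Eventually.of_forall fun y => by positivity
    _ = _ := by
        congr 1
        rw [integral_const_mul, e2, Real.mul_rpow (by positivity) ht.le]
        have : t ^ (-(n : ℝ) / 2) * t ^ ((n:ℝ) / 2) = 1 := by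
          rw [← Real.rpow_add ht, neg_div, neg_add_cancel, Real.rpow_zero]
        linear_combination C * (5 * Real.pi) ^ ((n:ℝ) / 2) * this

theorem Ctx.k_cont {t : ℝ} (ht : 0 < t) (y : Eu n) : Continuous fun x => k t x y := by
  obtain ⟨δ, hδ, c, hc, C, hC, h⟩ := H.hk2
  rw [continuous_iff_continuousAt]
  intro x
  rw [ContinuousAt, tendsto_iff_dist_tendsto_zero]
  have hst : 0 < Real.sqrt t := Real.sqrt_pos.2 ht
  have hlim : Tendsto (fun z : Eu n => C * (‖z - x‖ / Real.sqrt t) ^ δ * t ^ (-(n : ℝ) / 2) *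
      Real.exp (-c * (dist x y) ^ 2 / t)) (𝓝 x) (𝓝 0) := by
    have hcont : Continuous (fun z : Eu n => C * (‖z - x‖ / Real.sqrt t) ^ δ * t ^ (-(n : ℝ) / 2) *
      Real.exp (-c * (dist x y) ^ 2 / t)) := by
      refine Continuous.mul (Continuous.mul (Continuous.mul continuous_const ?_)
        continuous_const) continuous_const
      refine Continuous.rpow_const ?_ fun _ => Or.inr hδ.le
      fun_prop
    have := hcont.tendsto x
    simpa [Real.zero_rpow hδ.ne'] using this
  refine squeeze_zero' (Eventually.of_forall fun _ => dist_nonneg) ?_ hlim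
  filter_upwards [Metric.ball_mem_nhds x hst] with z hz
  have := h t ht x y (z - x) (by rw [mem_ball, dist_eq_norm] at hz; exact hz.le)
  rw [add_sub_cancel] at this
  rwa [Real.dist_eq]

theorem Ctx.Pg_meas {φ : ℝ → Eu n → ℝ} {β : Eu n → ℝ} (hβ : AEMeasurable β volume)
    (hφc : ∀ y, Continuous fun s => φ s y) (hφm : ∀ s, AEStronglyMeasurable (φ s) volume)
    (hf : AEStronglyMeasurable f volume) :
    AEMeasurable (Pg k (fun x y => φ (β x) y) f) volume := by
  have hl : LowerSemicontinuous fun z : Eu n × ℝ =>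
      ⨆ (t : ℝ) (_ : 0 < t), ∫⁻ y, ‖k t z.1 y * φ z.2 y * f y‖ₑ := by
    refine lowerSemicontinuous_biSup fun t ht => ?_
    rw [lowerSemicontinuous_iff_le_liminf]
    intro z
    refine le_trans (le_of_eq ?_) (lintegral_liminf_le' (u := 𝓝 z)
      (f := fun (z : Eu n × ℝ) y => ‖k t z.1 y * φ z.2 y * f y‖ₑ)
      fun z => (meas_integrand (c := fun _ => φ z.2) (x := z.1) H.hkm (hφm z.2) hf t).enorm)
    refine lintegral_congr fun y => ?_
    have hcont : Continuous fun z : Eu n × ℝ => ‖k t z.1 y * φ z.2 y * f y‖ₑ := by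
      refine continuous_enorm.comp ?_
      exact (((H.k_cont ht y).comp continuous_fst).mul ((hφc y).comp continuous_snd)).mul
        continuous_const
    exact (hcont.tendsto z).liminf_eq.symm
  have hm := hl.measurable
  have hz : AEMeasurable (fun x : Eu n => ((x, β x) : Eu n × ℝ)) volume :=
    aemeasurable_id.prodMk hβ
  have h3 := Measurable.comp_aemeasurable hm hz
  refine h3.congr (Eventually.of_forall fun x => ?_)
  simp only [Function.comp_apply, Pg]

theorem Ctx.Pg_meas_one (hf : AEStronglyMeasurable f volume) :
    AEMeasurable (Pg k (fun _ _ => 1) f) volume :=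
  H.Pg_meas (φ := fun _ _ => 1) (β := fun _ => 0) aemeasurable_const (fun _ => continuous_const)
    (fun _ => aestronglyMeasurable_const) hf

theorem Ctx.Pg_meas_b {b : Eu n → ℝ} (hb : AEStronglyMeasurable b volume)
    (hf : AEStronglyMeasurable f volume) :
    AEMeasurable (Pg k (fun x y => b x - b y) f) volume :=
  H.Pg_meas (φ := fun s y => s - b y) (β := b) hb.aemeasurable (fun _ => by fun_prop)
    (fun _ => aestronglyMeasurable_const.sub hb) hf

theorem Ctx.norm_eq (f : Eu n → ℝ) : wLpNorm n p w f = NN (wm n w) p (fun x => ‖f x‖ₑ) :=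
  wLpNorm_eq H.hp H.hw0 H.hwl f

theorem Ctx.norm_mono {f g : Eu n → ℝ} (h : ∀ x, |f x| ≤ |g x|) :
    wLpNorm n p w f ≤ wLpNorm n p w g := by
  rw [H.norm_eq, H.norm_eq]
  refine NN_mono H.hp fun x => ?_
  rw [Real.enorm_eq_ofReal_abs, Real.enorm_eq_ofReal_abs]
  exact ENNReal.ofReal_le_ofReal (h x)

/-- Lemma B. -/
theorem Ctx.lemB {D : ℝ≥0∞} (hD : ∀ f, MemWLp n p w f → wLpNorm n p w (Tc k c f) ≤
      D * wLpNorm n p w f) (hcm : ∀ x, AEStronglyMeasurable (c x) volume)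
    (hmeas : ∀ g, AEStronglyMeasurable g volume → AEMeasurable (Pg k c g) volume)
    {X Y : Set (Eu n)} {S : ℕ → Set (Eu n)} (hX : NullMeasurableSet X volume)
    (hY : NullMeasurableSet Y volume) (hS : ∀ i, NullMeasurableSet (S i) volume)
    (hSm : Monotone S) (hSu : ∀ y, ∃ i, y ∈ S i) (hSb : ∀ x i, ∃ B, ∀ y ∈ S i, |c x y| ≤ B)
    (hpos : ∀ x ∈ X, ∀ y ∈ Y, 0 ≤ c x y) (hf : MemWLp n p w f) :
    NN (wm n w) p (X.indicator (Pg k c (Y.indicator f))) ≤ D * wLpNorm n p w f := by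
  obtain ⟨G, hG0, hG⟩ := H.gauss
  set F : ℕ → Eu n → ℝ := fun i => (Y ∩ S i).indicator fun y => min |f y| i with hF
  have hF0 : ∀ i y, 0 ≤ F i y := fun i y => by
    simp only [hF]
    exact Set.indicator_nonneg (fun _ _ => le_min (abs_nonneg _) (Nat.cast_nonneg _)) _
  have hFf : ∀ i y, F i y ≤ |f y| := fun i y => by
    simp only [hF]
    exact Set.indicator_le' (fun _ _ => min_le_left _ _) (fun _ _ => abs_nonneg _) _
  have hFi : ∀ i y, F i y ≤ i := fun i y => by
    simp only [hF]
    exact Set.indicator_le' (fun _ _ => min_le_right _ _) (fun _ _ => Nat.cast_nonneg _) _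
  have hFmem : ∀ i y, y ∉ Y ∩ S i → F i y = 0 := fun i y hy => Set.indicator_of_notMem hy _
  have hFm : ∀ i, AEStronglyMeasurable (F i) volume := fun i =>
    AEStronglyMeasurable.indicator₀ (hf.1.norm.inf aestronglyMeasurable_const) (hY.inter (hS i))
  have hFn : ∀ i, wLpNorm n p w (F i) ≤ wLpNorm n p w f := fun i =>
    H.norm_mono fun y => by rw [abs_of_nonneg (hF0 i y)]; exact hFf i y
  have hFmono : ∀ y, Monotone fun i => F i y := fun y i j hij => by
    change F i y ≤ F j y
    by_cases h1 : y ∈ Y ∩ S i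
    · have h2 : y ∈ Y ∩ S j := ⟨h1.1, hSm hij h1.2⟩
      simp only [hF]
      rw [Set.indicator_of_mem h1, Set.indicator_of_mem h2]
      exact min_le_min_left _ (by exact_mod_cast hij)
    · rw [hFmem i y h1]; exact hF0 j y
  have hsup : ∀ y, (⨆ i, ‖F i y‖ₑ) = ‖Y.indicator f y‖ₑ := fun y => by
    by_cases hy : y ∈ Y
    · apply le_antisymm
      · refine iSup_le fun i => ?_
        rw [Set.indicator_of_mem hy, Real.enorm_eq_ofReal_abs, Real.enorm_eq_ofReal_abs,
          abs_of_nonneg (hF0 i y)]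
        exact ENNReal.ofReal_le_ofReal (hFf i y)
      · obtain ⟨i, hi⟩ := hSu y
        obtain ⟨j, hj⟩ := exists_nat_ge |f y|
        refine le_iSup_of_le (max i j) (le_of_eq ?_)
        have : F (max i j) y = |f y| := by
          simp only [hF]
          have hm : y ∈ Y ∩ S (max i j) := ⟨hy, hSm (le_max_left _ _) hi⟩
          rw [Set.indicator_of_mem hm, min_eq_left]
          refine hj.trans ?_
          exact_mod_cast le_max_right _ _
        rw [this, Set.indicator_of_mem hy, Real.enorm_eq_ofReal_abs, Real.enorm_eq_ofReal_abs, abs_abs]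
    · rw [Set.indicator_of_notMem hy]
      simp only [enorm_zero, ENNReal.iSup_eq_zero]
      intro i
      rw [hFmem i y fun h => hy h.1, enorm_zero]
  have hPsup : ∀ x, Pg k c (Y.indicator f) x = ⨆ i, Pg k c (F i) x := fun x => by
    unfold Pg
    rw [iSup_comm]
    congr 1; funext t
    rw [iSup_comm]
    congr 1; funext ht
    rw [← lintegral_iSup' (fun i => (meas_integrand H.hkm (hcm x) (hFm i) t).enorm)]
    · refine lintegral_congr fun y => ?_
      simp_rw [enorm_mul]
      rw [← ENNReal.mul_iSup, hsup]
    · refine Eventually.of_forall fun y i j hij => ?_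
      simp_rw [enorm_mul]
      gcongr
      rw [Real.enorm_eq_ofReal (hF0 i y), Real.enorm_eq_ofReal (hF0 j y)]
      exact ENNReal.ofReal_le_ofReal (hFmono y hij)
  have hPmono : ∀ x, Monotone fun i => Pg k c (F i) x := fun x i j hij => by
    refine Pg_mono fun y => ?_
    rw [abs_mul, abs_mul, abs_of_nonneg (hF0 i y), abs_of_nonneg (hF0 j y)]
    exact mul_le_mul_of_nonneg_left (hFmono y hij) (abs_nonneg _)
  have hfin : ∀ x i, Pg k c (F i) x < ⊤ := fun x i => by
    obtain ⟨B, hB⟩ := hSb x i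
    refine lt_of_le_of_lt (b := ENNReal.ofReal (|B| * i) * ENNReal.ofReal G) ?_
      (ENNReal.mul_lt_top ENNReal.ofReal_lt_top ENNReal.ofReal_lt_top)
    refine iSup₂_le fun t ht => ?_
    calc ∫⁻ y, ‖k t x y * c x y * F i y‖ₑ ≤ ∫⁻ y, ENNReal.ofReal (|B| * i) * ‖k t x y‖ₑ := by
          refine lintegral_mono fun y => ?_
          rw [mul_assoc, enorm_mul, mul_comm]
          gcongr
          rw [Real.enorm_eq_ofReal_abs]
          apply ENNReal.ofReal_le_ofReal
          by_cases hy : y ∈ Y ∩ S i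
          · rw [abs_mul, abs_of_nonneg (hF0 i y)]
            exact mul_le_mul ((hB y hy.2).trans (le_abs_self _)) (hFi i y) (hF0 i y) (abs_nonneg _)
          · rw [hFmem i y hy]; simp; positivity
      _ = ENNReal.ofReal (|B| * i) * ∫⁻ y, ‖k t x y‖ₑ :=
          lintegral_const_mul' _ _ ENNReal.ofReal_ne_top
      _ ≤ _ := by gcongr; exact hG t ht x
  have e : X.indicator (Pg k c (Y.indicator f)) = fun x => ⨆ i, X.indicator (Pg k c (F i)) x := by
    funext x
    by_cases hx : x ∈ X
    · simp only [Set.indicator_of_mem hx]; exact hPsup x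
    · simp [Set.indicator_of_notMem hx]
  rw [e]
  refine NN_iSup_le H.hp (fun i => ?_) (fun x i j hij => ?_) fun i => ?_
  · exact ((hmeas _ (hFm i)).indicator₀ hX).mono_ac (wm_ac n w)
  · exact Set.indicator_le_indicator (hPmono x hij)
  · have hmem : MemWLp n p w (F i) := ⟨hFm i, (hFn i).trans_lt hf.2⟩
    calc NN (wm n w) p (X.indicator (Pg k c (F i))) ≤ NN (wm n w) p (fun x => ‖Tc k c (F i) x‖ₑ) := by
          refine NN_mono H.hp fun x => ?_
          by_cases hx : x ∈ X
          · rw [Set.indicator_of_mem hx]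
            refine Pg_le_Tc H.hkm (hcm x) (hFm i) (hfin x i) fun t ht y => ?_
            by_cases hy : y ∈ Y ∩ S i
            · obtain ⟨C, hC, h⟩ := H.hk1
              exact mul_nonneg (mul_nonneg (h t ht x y).1.le (hpos x hx y hy.1)) (hF0 i y)
            · rw [hFmem i y hy, mul_zero]
          · rw [Set.indicator_of_notMem hx]; exact zero_le
      _ ≤ D * wLpNorm n p w (F i) := by rw [← H.norm_eq]; exact hD _ hmem
      _ ≤ _ := by gcongr; exact hFn i

/-- B1. -/
theorem Ctx.lemB1 (hf : MemWLp n p w f) :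
    NN (wm n w) p (Pg k (fun _ _ => 1) f) ≤ ENNReal.ofReal C₀ * wLpNorm n p w f := by
  have := H.lemB (c := fun _ _ => 1) (D := ENNReal.ofReal C₀) (X := Set.univ) (Y := Set.univ)
    (S := fun _ => Set.univ) (f := f) (fun f hf => ?_) (fun _ => aestronglyMeasurable_const)
    (fun g hg => H.Pg_meas_one hg) .univ .univ (fun _ => .univ) monotone_const
    (fun _ => ⟨0, trivial⟩) (fun _ _ => ⟨1, by simp⟩) (fun _ _ _ _ => zero_le_one) hf
  · simpa using this
  · have e : Tc k (fun _ _ => 1) f = Tstar n k f := by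
      funext x; simp [Tc, Tstar]
    rw [e]; exact H.hT f hf

/-- B2. -/
theorem Ctx.lemB2 {b : Eu n → ℝ} {Cb : ℝ} (hbl : LocallyIntegrable b volume)
    (hb : IsBmoBound n θ ρ b Cb) {X Y : Set (Eu n)} (hX : NullMeasurableSet X volume)
    (hY : NullMeasurableSet Y volume) (hXY : ∀ x ∈ X, ∀ y ∈ Y, b y ≤ b x)
    (hf : MemWLp n p w f) :
    NN (wm n w) p (X.indicator (Pg k (fun x y => b x - b y) (Y.indicator f))) ≤
      ENNReal.ofReal (C₀ * Cb) * wLpNorm n p w f := by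
  have hbm := hbl.aestronglyMeasurable
  refine H.lemB (S := fun i => {y | |b y| ≤ i}) (fun f hf => ?_)
    (fun _ => aestronglyMeasurable_const.sub hbm) (fun g hg => H.Pg_meas_b hbm hg) hX hY
    (fun i => ?_) (fun i j hij y hy => ?_) (fun y => ?_) (fun x i => ⟨|b x| + i, fun y hy => ?_⟩)
    (fun x hx y hy => sub_nonneg.2 (hXY x hx y hy)) hf
  · exact H.hTb b Cb ⟨hbl, Cb, hb⟩ hb f hf
  · exact nullMeasurableSet_le hbm.norm.aemeasurable aemeasurable_const
  · exact le_trans (α := ℝ) hy (by exact_mod_cast hij)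
  · exact exists_nat_ge |b y|
  · exact (abs_sub _ _).trans (add_le_add_right hy _)

/-- B2 with the other sign. -/
theorem Ctx.lemB2' {b : Eu n → ℝ} {Cb : ℝ} (hbl : LocallyIntegrable b volume)
    (hb : IsBmoBound n θ ρ b Cb) {X Y : Set (Eu n)} (hX : NullMeasurableSet X volume)
    (hY : NullMeasurableSet Y volume) (hXY : ∀ x ∈ X, ∀ y ∈ Y, b x ≤ b y)
    (hf : MemWLp n p w f) :
    NN (wm n w) p (X.indicator (Pg k (fun x y => b x - b y) (Y.indicator f))) ≤
      ENNReal.ofReal (C₀ * Cb) * wLpNorm n p w f := by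
  refine le_trans (le_of_eq ?_) (H.lemB2 (b := fun y => - b y) hbl.neg (bmo_neg hb) hX hY
    (fun x hx y hy => neg_le_neg (hXY x hx y hy)) hf)
  congr 2
  funext x
  refine le_antisymm ?_ ?_ <;> refine Pg_mono fun y => le_of_eq ?_ <;>
  · rw [abs_mul, abs_mul, ← abs_neg]; congr 2; ring
end


/-- The positive maximal operator. -/
abbrev Pm {n : ℕ} (k : ℝ → Eu n → Eu n → ℝ) (f : Eu n → ℝ) : Eu n → ℝ≥0∞ :=
  Pg k (fun _ _ => 1) f

section
variable {n : ℕ} {p θ : ℝ} {ρ w : Eu n → ℝ} {k : ℝ → Eu n → Eu n → ℝ} {C₀ : ℝ}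
variable {c c' : Eu n → Eu n → ℝ} {f : Eu n → ℝ} {x : Eu n}
variable (H : Ctx n p θ ρ w k C₀)
include H

theorem Ctx.Pm_lt_top (hf : MemWLp n p w f) : ∀ᵐ x ∂(wm n w), Pm k f x < ⊤ :=
  NN_ae_lt_top H.hp ((H.Pg_meas_one hf.1).mono_ac (wm_ac n w))
    ((H.lemB1 hf).trans_lt (ENNReal.mul_lt_top ENNReal.ofReal_lt_top hf.2))

/-- Lemma C. -/
theorem Ctx.lemC {b : Eu n → ℝ} {Cb : ℝ} (hbl : LocallyIntegrable b volume)
    (hb : IsBmoBound n θ ρ b Cb) (hf : MemWLp n p w f) :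
    ∀ᵐ x ∂(wm n w), Pg k (fun x y => b x - b y) f x < ⊤ := by
  have hbm := hbl.aestronglyMeasurable
  have hlo : ∀ l : ℝ, NullMeasurableSet {y | b y ≤ l} volume := fun l =>
    nullMeasurableSet_le hbm.aemeasurable aemeasurable_const
  have hhi : ∀ l : ℝ, NullMeasurableSet {y | l ≤ b y} volume := fun l =>
    nullMeasurableSet_le aemeasurable_const hbm.aemeasurable
  have h1 : ∀ᵐ x ∂(wm n w), ∀ l : ℚ, (l:ℝ) ≤ b x →
      Pg k (fun x y => b x - b y) ({y | b y ≤ l}.indicator f) x < ⊤ := by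
    rw [ae_all_iff]
    intro l
    have := NN_ae_lt_top H.hp (((H.Pg_meas_b hbm (hf.1.indicator₀ (hlo l))).indicator₀
      (hhi l)).mono_ac (wm_ac n w)) ((H.lemB2 hbl hb (hhi l) (hlo l)
        (fun x hx y hy => le_trans (α := ℝ) hy hx) hf).trans_lt
        (ENNReal.mul_lt_top ENNReal.ofReal_lt_top hf.2))
    filter_upwards [this] with x hx hl
    have hl' : x ∈ {y | (l:ℝ) ≤ b y} := hl
    rwa [Set.indicator_of_mem hl'] at hx
  have h2 : ∀ᵐ x ∂(wm n w), ∀ l : ℚ, b x ≤ l →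
      Pg k (fun x y => b x - b y) ({y | l ≤ b y}.indicator f) x < ⊤ := by
    rw [ae_all_iff]
    intro l
    have := NN_ae_lt_top H.hp (((H.Pg_meas_b hbm (hf.1.indicator₀ (hhi l))).indicator₀
      (hlo l)).mono_ac (wm_ac n w)) ((H.lemB2' hbl hb (hlo l) (hhi l)
        (fun x hx y hy => le_trans (α := ℝ) hx hy) hf).trans_lt
        (ENNReal.mul_lt_top ENNReal.ofReal_lt_top hf.2))
    filter_upwards [this] with x hx hl
    have hl' : x ∈ {y | b y ≤ (l:ℝ)} := hl
    rwa [Set.indicator_of_mem hl'] at hx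
  filter_upwards [h1, h2, H.Pm_lt_top hf] with x hx1 hx2 hx3
  obtain ⟨l₁, ha, ha'⟩ := exists_rat_btwn (show b x - 1 < b x by linarith)
  obtain ⟨l₂, hd, hd'⟩ := exists_rat_btwn (show b x < b x + 1 by linarith)
  have hcx : AEStronglyMeasurable (fun y => b x - b y) volume := aestronglyMeasurable_const.sub hbm
  have e1 : Pg k (fun x y => b x - b y) f x ≤
      Pg k (fun x y => b x - b y) ({y | b y ≤ l₁}.indicator f) x +
      Pg k (fun x y => b x - b y) ({y | b y ≤ l₁}ᶜ.indicator f) x := by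
    refine Pg_add_le H.hkm hcx (hf.1.indicator₀ (hlo l₁).compl) fun y => ?_
    by_cases hy : y ∈ {y | b y ≤ l₁}
    · rw [Set.indicator_of_mem hy]; linarith [abs_nonneg ((b x - b y) * {y | b y ≤ (l₁:ℝ)}ᶜ.indicator f y)]
    · have hy' : y ∈ {y | b y ≤ (l₁:ℝ)}ᶜ := hy
      rw [Set.indicator_of_mem hy', Set.indicator_of_notMem hy]; simp
  have e2 : Pg k (fun x y => b x - b y) ({y | b y ≤ l₁}ᶜ.indicator f) x ≤
      Pg k (fun x y => b x - b y) ({y | l₂ ≤ b y}.indicator f) x + Pm k f x := by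
    refine Pg_add_le (c' := fun _ _ => 1) H.hkm aestronglyMeasurable_const hf.1 fun y => ?_
    by_cases hy : y ∈ {y | b y ≤ (l₁:ℝ)}ᶜ
    · by_cases hy2 : y ∈ {y | (l₂:ℝ) ≤ b y}
      · rw [Set.indicator_of_mem hy, Set.indicator_of_mem hy2]
        linarith [abs_nonneg (1 * f y)]
      · rw [Set.indicator_of_mem hy, Set.indicator_of_notMem hy2, mul_zero, abs_zero, zero_add,
          abs_mul, abs_mul]
        refine mul_le_mul_of_nonneg_right ?_ (abs_nonneg _)
        have a1 : (l₁:ℝ) < b y := not_le.1 hy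
        have a2 : b y < l₂ := not_le.1 hy2
        rw [abs_one, abs_le]; constructor <;> linarith
    · rw [Set.indicator_of_notMem hy, mul_zero, abs_zero]; positivity
  refine (e1.trans (add_le_add_right e2 _)).trans_lt ?_
  exact ENNReal.add_lt_top.2 ⟨hx1 l₁ ha'.le, ENNReal.add_lt_top.2 ⟨hx2 l₂ hd.le, hx3⟩⟩

theorem Ctx.gain {b : Eu n → ℝ} {X Y : Set (Eu n)} {L D : ℝ} (hL : 0 < L)
    (hXY : ∀ x ∈ X, ∀ y ∈ Y, L ≤ |b x - b y|)
    (h : NN (wm n w) p (X.indicator (Pg k (fun x y => b x - b y) (Y.indicator f))) ≤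
      ENNReal.ofReal D * wLpNorm n p w f) :
    NN (wm n w) p (X.indicator (Pm k (Y.indicator f))) ≤
      ENNReal.ofReal (D / L) * wLpNorm n p w f := by
  have h1 : NN (wm n w) p (X.indicator (Pm k (Y.indicator f))) ≤
      NN (wm n w) p (fun x => ENNReal.ofReal L⁻¹ *
        X.indicator (Pg k (fun x y => b x - b y) (Y.indicator f)) x) := by
    refine NN_mono H.hp fun x => ?_
    by_cases hx : x ∈ X
    · rw [Set.indicator_of_mem hx, Set.indicator_of_mem hx]
      have : ENNReal.ofReal L⁻¹ = ‖L⁻¹‖ₑ := (Real.enorm_eq_ofReal (by positivity)).symm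
      rw [this, ← Pg_const_mul]
      refine Pg_mono fun y => ?_
      by_cases hy : y ∈ Y
      · rw [abs_mul, abs_mul]
        refine mul_le_mul_of_nonneg_right ?_ (abs_nonneg _)
        rw [abs_one, abs_mul, abs_of_pos (inv_pos.2 hL), inv_mul_eq_div, one_le_div hL]
        exact hXY x hx y hy
      · rw [Set.indicator_of_notMem hy]; simp
    · rw [Set.indicator_of_notMem hx, Set.indicator_of_notMem hx]; simp
  refine h1.trans ?_
  rw [NN_const_mul H.hp ENNReal.ofReal_ne_top]
  refine (mul_le_mul_right h _).trans (le_of_eq ?_)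
  rw [← mul_assoc, ← ENNReal.ofReal_mul (by positivity), inv_mul_eq_div]

/-- Lemma G. -/
theorem Ctx.lemG {ε : ℝ} (hε : 0 < ε) : ∃ τ > (0:ℝ), ∀ (E : Set (Eu n)) (s : ℝ), IsOpen E → 0 < s →
    volume E ≤ ENNReal.ofReal (τ * s ^ n) * volume (ball (0 : Eu n) 1) → ∀ f, MemWLp n p w f →
    NN (wm n w) p ({x | ∀ y ∈ E, s ≤ dist x y}.indicator (Pm k (E.indicator f))) ≤
      ENNReal.ofReal ε * wLpNorm n p w f ∧
    NN (wm n w) p (E.indicator (Pm k ({x | ∀ y ∈ E, s ≤ dist x y}.indicator f))) ≤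
      ENNReal.ofReal ε * wLpNorm n p w f := by
  set D₀ : ℝ := 2 * (Real.log 2 + 2 * 12 ^ n) with hD₀
  have hD₀' : 0 < D₀ := by
    have := Real.log_pos (by norm_num : (1:ℝ) < 2)
    positivity
  have hC₀ := H.hC₀
  set L : ℝ := C₀ * D₀ / ε with hL
  have hLpos : 0 < L := by positivity
  set κ : ℝ := Real.exp (-L) / 2 with hκ
  have hκ0 : 0 < κ := by positivity
  have hlog : Real.log (2 * κ) = -L := by
    rw [hκ, mul_div_cancel₀ _ two_ne_zero, Real.log_exp]
  refine ⟨κ / 2 ^ n, by positivity, fun E s hE hs hvol f hf => ?_⟩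
  rw [show κ / 2 ^ n * s ^ n = κ * (s / 2) ^ n by rw [div_pow]; ring] at hvol
  have hbm := logM_bmo H.hθ H.hρ E hE.measurableSet hκ0
  have hbl := logM_locInt E hκ0
  have hFar : IsClosed {x | ∀ y ∈ E, s ≤ dist x y} := by
    have : {x | ∀ y ∈ E, s ≤ dist x y} = ⋂ y ∈ E, {x : Eu n | s ≤ dist x y} := by
      ext x; simp
    rw [this]
    exact isClosed_biInter fun y _ => isClosed_le continuous_const (by fun_prop)
  have hon : ∀ y ∈ E, 0 ≤ logM n E κ y := fun y hy => logM_on hE hκ0 hy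
  have hoff : ∀ x ∈ {x | ∀ y ∈ E, s ≤ dist x y}, logM n E κ x ≤ - L := fun x hx => by
    rw [← hlog]; exact logM_off hκ0 hs hvol hx
  have hfin : C₀ * D₀ / L = ε := by rw [hL]; field_simp
  constructor
  · have h1 := H.lemB2' hbl hbm hFar.measurableSet.nullMeasurableSet
      hE.measurableSet.nullMeasurableSet (fun x hx y hy => by
        have := hon y hy; have := hoff x hx; linarith) hf
    have := H.gain hLpos (fun x hx y hy => by
        have := hon y hy; have := hoff x hx
        rw [abs_sub_comm]
        exact le_trans (by linarith) (le_abs_self _)) h1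
    rwa [hfin] at this
  · have h1 := H.lemB2 hbl hbm hE.measurableSet.nullMeasurableSet
      hFar.measurableSet.nullMeasurableSet (fun x hx y hy => by
        have := hon x hx; have := hoff y hy; linarith) hf
    have := H.gain hLpos (fun x hx y hy => by
        have := hon x hx; have := hoff y hy
        exact le_trans (by linarith) (le_abs_self _)) h1
    rwa [hfin] at this
end


/-- Cutoff away from the diagonal. -/
def chi {n : ℕ} (γ : ℝ) (x y : Eu n) : ℝ := max 0 (min 1 (dist x y / γ - 1))

/-- Truncated coefficient. -/
def ctr {n : ℕ} (β : Eu n → ℝ) (γ : ℝ) (Y : Set (Eu n)) (x y : Eu n) : ℝ :=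
  chi γ x y * (β x - β y) * Y.indicator 1 y

theorem chi_nonneg {n : ℕ} (γ : ℝ) (x y : Eu n) : 0 ≤ chi γ x y := le_max_left _ _
theorem chi_le_one {n : ℕ} (γ : ℝ) (x y : Eu n) : chi γ x y ≤ 1 :=
  max_le zero_le_one (min_le_left _ _)
theorem chi_eq_one {n : ℕ} {γ : ℝ} (hγ : 0 < γ) {x y : Eu n} (h : 2 * γ ≤ dist x y) :
    chi γ x y = 1 := by
  have : 1 ≤ dist x y / γ - 1 := by
    have : 2 ≤ dist x y / γ := by rwa [le_div_iff₀ hγ]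
    linarith
  rw [chi, min_eq_left this, max_eq_right zero_le_one]
theorem chi_eq_zero {n : ℕ} {γ : ℝ} (hγ : 0 < γ) {x y : Eu n} (h : dist x y ≤ γ) :
    chi γ x y = 0 := by
  have : dist x y / γ - 1 ≤ 0 := by
    have : dist x y / γ ≤ 1 := by rwa [div_le_one hγ]
    linarith
  rw [chi, max_eq_left ((min_le_right _ _).trans this)]
theorem chi_cont {n : ℕ} (γ : ℝ) (x : Eu n) : Continuous (chi γ x) := by
  unfold chi; fun_prop
theorem chi_lip {n : ℕ} {γ : ℝ} (hγ : 0 < γ) (x x' y : Eu n) :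
    |chi γ x y - chi γ x' y| ≤ dist x x' / γ := by
  unfold chi
  have h1 : |dist x y - dist x' y| ≤ dist x x' := abs_dist_sub_le x x' y
  have h2 := abs_max_sub_max_le_abs (min 1 (dist x y / γ - 1)) (min 1 (dist x' y / γ - 1)) 0
  have h3 := abs_min_sub_min_le_max 1 (dist x y / γ - 1) 1 (dist x' y / γ - 1)
  rw [max_comm 0, max_comm 0]
  refine h2.trans (h3.trans ?_)
  simp only [sub_self, abs_zero]
  refine max_le (by positivity) ?_
  rw [sub_sub_sub_cancel_right, ← sub_div, abs_div, abs_of_pos hγ]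
  gcongr

section
variable {n : ℕ} {p θ : ℝ} {ρ w : Eu n → ℝ} {k : ℝ → Eu n → Eu n → ℝ} {C₀ : ℝ}
variable {c c' : Eu n → Eu n → ℝ} {f : Eu n → ℝ} {x : Eu n}

theorem ctr_meas {β : Eu n → ℝ} (hβ : Continuous β) (γ : ℝ) {Y : Set (Eu n)} (hY : MeasurableSet Y)
    (x : Eu n) : AEStronglyMeasurable (ctr β γ Y x) volume := by
  have h1 : Measurable (chi γ x) := (chi_cont γ x).measurable
  have h2 : Measurable (fun y => Y.indicator (1 : Eu n → ℝ) y) := measurable_one.indicator hY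
  exact ((h1.mul (measurable_const.sub hβ.measurable)).mul h2).aestronglyMeasurable

theorem ind_one_le (Y : Set (Eu n)) (y : Eu n) : |Y.indicator (1 : Eu n → ℝ) y| ≤ 1 := by
  by_cases hy : y ∈ Y
  · rw [Set.indicator_of_mem hy]; simp
  · rw [Set.indicator_of_notMem hy]; simp

theorem ctr_le {β : Eu n → ℝ} {B : ℝ} (hB : ∀ x, |β x| ≤ B) (γ : ℝ) (Y : Set (Eu n))
    (x y : Eu n) : |ctr β γ Y x y| ≤ 2 * B := by
  have h0 : 0 ≤ B := (abs_nonneg _).trans (hB x)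
  have h1 : |β x - β y| ≤ 2 * B := (abs_sub _ _).trans (by linarith [hB x, hB y])
  rw [ctr, abs_mul, abs_mul, abs_of_nonneg (chi_nonneg ..)]
  calc chi γ x y * |β x - β y| * |Y.indicator 1 y| ≤ 1 * (2 * B) * 1 := by
        gcongr
        · exact chi_le_one ..
        · exact ind_one_le Y y
    _ = _ := by ring

theorem exists_scale (hn : 0 < n) {τ R : ℝ} (hτ : 0 < τ) (hR : 0 < R) :
    ∃ s > (0:ℝ), volume (ball (0 : Eu n) R) ≤
      ENNReal.ofReal (τ * s ^ n) * volume (ball (0 : Eu n) 1) := by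
  refine ⟨R * (1 + 1 / τ), by positivity, ?_⟩
  rw [Measure.addHaar_ball_of_pos volume (0 : Eu n) hR, finrank_euclideanSpace_fin]
  gcongr
  rw [mul_pow]
  have h1 : 1 + 1 / τ ≤ (1 + 1 / τ) ^ n := by
    have : (1:ℝ) ≤ 1 + 1 / τ := by have : 0 < 1 / τ := by positivity
                                   linarith
    exact le_self_pow₀ this hn.ne'
  have h2 : 1 ≤ τ * (1 + 1 / τ) ^ n := by
    calc (1:ℝ) ≤ τ * (1 + 1 / τ) := by rw [mul_add, mul_one_div_cancel hτ.ne']; linarith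
      _ ≤ _ := by gcongr
  have : 0 < R ^ n := by positivity
  nlinarith

/-- small weight sets have small measure -/
theorem small_weight {w' : Eu n → ℝ} (hw' : Measurable w') (R : ℝ) {η : ℝ≥0∞} (hη : 0 < η) :
    ∃ M > (0:ℝ), volume ({y | 0 < w' y ∧ w' y < 1 / M} ∩ ball (0 : Eu n) R) < η := by
  have hm : ∀ i : ℕ, MeasurableSet ({y | 0 < w' y ∧ w' y < 1 / ((i:ℝ) + 1)} ∩ ball (0 : Eu n) R) :=
    fun i => ((measurableSet_lt measurable_const hw').inter
      (measurableSet_lt hw' measurable_const)).inter measurableSet_ball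
  have hanti : Antitone fun i : ℕ =>
      ({y | 0 < w' y ∧ w' y < 1 / ((i:ℝ) + 1)} ∩ ball (0 : Eu n) R) := by
    rintro i j hij y ⟨⟨h1, h2⟩, h3⟩
    refine ⟨⟨h1, h2.trans_le ?_⟩, h3⟩
    have : (i:ℝ) ≤ j := by exact_mod_cast hij
    gcongr
  have hlim := tendsto_measure_iInter_atTop (μ := volume) (fun i => (hm i).nullMeasurableSet) hanti
    ⟨0, ((measure_mono Set.inter_subset_right).trans_lt measure_ball_lt_top).ne⟩
  have hempty : (⋂ i : ℕ, ({y | 0 < w' y ∧ w' y < 1 / ((i:ℝ) + 1)} ∩ ball (0 : Eu n) R)) = ∅ := by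
    ext y
    simp only [Set.mem_iInter, Set.mem_empty_iff_false, iff_false, not_forall]
    by_cases hy : 0 < w' y
    · obtain ⟨i, hi⟩ := exists_nat_one_div_lt hy
      exact ⟨i, fun h => lt_irrefl _ (hi.trans h.1.2)⟩
    · exact ⟨0, fun h => hy h.1.1⟩
  rw [hempty, measure_empty] at hlim
  obtain ⟨i, hi⟩ := (hlim.eventually (gt_mem_nhds hη)).exists
  exact ⟨(i:ℝ) + 1, by positivity, hi⟩

theorem far_closed (E : Set (Eu n)) (s : ℝ) : IsClosed {x | ∀ y ∈ E, s ≤ dist x y} := by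
  have : {x | ∀ y ∈ E, s ≤ dist x y} = ⋂ y ∈ E, {x : Eu n | s ≤ dist x y} := by
    ext x; simp
  rw [this]
  exact isClosed_biInter fun y _ => isClosed_le continuous_const (by fun_prop)

theorem Pm_union (hk : ∀ t, Measurable (Function.uncurry (k t)))
    (hf : AEStronglyMeasurable f volume) {S S₁ S₂ : Set (Eu n)} (hS₂ : MeasurableSet S₂)
    (h : S ⊆ S₁ ∪ S₂) :
    Pm k (S.indicator f) x ≤ Pm k (S₁.indicator f) x + Pm k (S₂.indicator f) x := by
  refine Pg_add_le (c' := fun _ _ => 1) hk aestronglyMeasurable_const (hf.indicator hS₂) fun y => ?_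
  simp only [one_mul]
  by_cases hy : y ∈ S
  · rw [Set.indicator_of_mem hy]
    rcases h hy with h1 | h2
    · rw [Set.indicator_of_mem h1]; linarith [abs_nonneg (S₂.indicator f y)]
    · rw [Set.indicator_of_mem h2]; linarith [abs_nonneg (S₁.indicator f y)]
  · rw [Set.indicator_of_notMem hy, abs_zero]; positivity

theorem Pm_empty : Pm k ((∅ : Set (Eu n)).indicator f) x = 0 := by
  simp [Pm, Pg]

theorem Pm_biUnion (hk : ∀ t, Measurable (Function.uncurry (k t)))
    (hf : AEStronglyMeasurable f volume) {ι : Type*} (F : Finset ι) {Q : ι → Set (Eu n)}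
    (hQ : ∀ i, MeasurableSet (Q i)) : ∀ {S : Set (Eu n)}, S ⊆ (⋃ i ∈ F, Q i) →
    Pm k (S.indicator f) x ≤ ∑ i ∈ F, Pm k ((Q i).indicator f) x := by
  classical
  induction F using Finset.induction_on with
  | empty =>
    intro S h
    have : S = ∅ := by simpa using h
    rw [this, Pm_empty]; exact zero_le
  | insert i F hi ih =>
    intro S h
    rw [Finset.sum_insert hi]
    have hm : MeasurableSet (⋃ j ∈ F, Q j) := Finset.measurableSet_biUnion F fun j _ => hQ j
    refine (Pm_union hk hf (S₁ := Q i) hm ?_).trans (add_le_add_right (ih subset_rfl) _)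
    simpa using h

variable (H : Ctx n p θ ρ w k C₀)
include H

theorem Ctx.mem_ind {Y : Set (Eu n)} (hY : MeasurableSet Y) (hf : MemWLp n p w f) :
    MemWLp n p w (Y.indicator f) ∧ wLpNorm n p w (Y.indicator f) ≤ wLpNorm n p w f := by
  have : wLpNorm n p w (Y.indicator f) ≤ wLpNorm n p w f := H.norm_mono fun y => by
    by_cases hy : y ∈ Y
    · rw [Set.indicator_of_mem hy]
    · rw [Set.indicator_of_notMem hy]; simp
  exact ⟨⟨hf.1.indicator hY, this.trans_lt hf.2⟩, this⟩

theorem Ctx.norm_Z {w' : Eu n → ℝ} (hww : w =ᵐ[volume] w')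
    (f : Eu n → ℝ) : wLpNorm n p w ({y | w' y ≤ 0}.indicator f) = 0 := by
  have hp0 : 0 < p := by linarith [H.hp]
  have : ∫⁻ x, ENNReal.ofReal (|{y | w' y ≤ 0}.indicator f x| ^ p * w x) = 0 := by
    rw [← lintegral_zero (μ := (volume : Measure (Eu n)))]
    refine lintegral_congr_ae ?_
    filter_upwards [hww] with x hx
    by_cases hm : x ∈ {y | w' y ≤ 0}
    · have : w x = 0 := le_antisymm (hx ▸ hm) (H.hw0 x)
      simp [this]
    · rw [Set.indicator_of_notMem hm, abs_zero, Real.zero_rpow hp0.ne']; simp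
  rw [wLpNorm, this]
  simp [hp0]

/-- Lemma F: approximation by truncated operators. -/
theorem Ctx.lemF {β : Eu n → ℝ} (hβc : Continuous β) {Λ B R : ℝ} (hΛ : 0 < Λ) (hB0 : 0 < B)
    (hR : 0 < R)
    (hLip : ∀ x y, |β x - β y| ≤ Λ * dist x y) (hB : ∀ x, |β x| ≤ B)
    (hsupp : ∀ x, x ∉ ball (0 : Eu n) R → β x = 0) {ε : ℝ} (hε : 0 < ε) :
    ∃ A γ R' M : ℝ, 0 < γ ∧ 0 < M ∧ ∃ Y : Set (Eu n), MeasurableSet Y ∧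
      Y ⊆ ball 0 R' ∧ (∀ᵐ y ∂(volume : Measure (Eu n)), y ∈ Y → 1 / M ≤ w y) ∧
      ∀ f, MemWLp n p w f → ∃ Err : Eu n → ℝ≥0∞, AEMeasurable Err (wm n w) ∧
        NN (wm n w) p Err ≤ ENNReal.ofReal ε * wLpNorm n p w f ∧
        ∀ᵐ x ∂(wm n w), ‖TstarB n k β f x -
          (closedBall 0 A).indicator (Tc k (ctr β γ Y) f) x‖ₑ ≤ Err x := by
  have hC₀ := H.hC₀
  have hp := H.hp
  -- parameters
  set e₁ : ℝ := ε / (4 * (2 * B)) with he₁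
  have he₁0 : 0 < e₁ := by positivity
  set γ : ℝ := ε / (4 * (2 * Λ * C₀)) with hγdef
  have hγ : 0 < γ := by positivity
  obtain ⟨τ, hτ, hG⟩ := H.lemG he₁0
  obtain ⟨s, hs, hsvol⟩ := exists_scale H.hn hτ hR
  set A : ℝ := R + s with hA
  obtain ⟨s', hs', hsvol'⟩ := exists_scale H.hn hτ (by linarith : 0 < A + 1)
  set R' : ℝ := A + 1 + s' with hR'
  obtain ⟨T, -, hTfin, hTcov⟩ := (isCompact_closedBall (0 : Eu n) R').finite_cover_balls
    (by positivity : 0 < γ / 4)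
  set m := hTfin.toFinset.card with hm
  have he₂0 : 0 < e₁ / (m + 1) := by positivity
  obtain ⟨τ₂, hτ₂, hG₂⟩ := H.lemG he₂0
  obtain ⟨w', hw's, hww⟩ := H.hwl.aestronglyMeasurable
  have hw'm : Measurable w' := hw's.measurable
  have hη : 0 < ENNReal.ofReal (τ₂ * γ ^ n) * volume (ball (0 : Eu n) 1) :=
    ENNReal.mul_pos (by simp; positivity) (vol_ball_ne_zero _ one_pos)
  obtain ⟨M, hM, hMvol⟩ := small_weight hw'm R' hη
  obtain ⟨U, hUsub, hUo, hUvol⟩ := Set.exists_isOpen_lt_of_lt _ _ hMvol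
  set Y : Set (Eu n) := ball 0 R' ∩ {y | 1 / M ≤ w' y} with hYdef
  have hYm : MeasurableSet Y := measurableSet_ball.inter (measurableSet_le measurable_const hw'm)
  refine ⟨A, γ, R', M, hγ, hM, Y, hYm, Set.inter_subset_left, ?_, fun f hf => ?_⟩
  · filter_upwards [hww] with y hy hyY
    rw [hy]; exact hyY.2
  set Z : Set (Eu n) := {y | w' y ≤ 0} with hZ
  have hZm : MeasurableSet Z := measurableSet_le hw'm measurable_const
  set Far : Set (Eu n) → ℝ → Set (Eu n) := fun E s => {x | ∀ y ∈ E, s ≤ dist x y} with hFar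
  have hFarm : ∀ E s, MeasurableSet (Far E s) := fun E s => (far_closed E s).measurableSet
  set Q : Eu n → Set (Eu n) := fun z => U ∩ ball z (γ / 4) with hQ
  have hQo : ∀ z, IsOpen (Q z) := fun z => hUo.inter isOpen_ball
  have hQm : ∀ z, MeasurableSet (Q z) := fun z => (hQo z).measurableSet
  have hQvol : ∀ z, volume (Q z) ≤ ENNReal.ofReal (τ₂ * γ ^ n) * volume (ball (0 : Eu n) 1) :=
    fun z => (measure_mono Set.inter_subset_left).trans hUvol.le
  have hPmm : ∀ S : Set (Eu n), MeasurableSet S → AEMeasurable (Pm k (S.indicator f)) (wm n w) :=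
    fun S hS => (H.Pg_meas_one (hf.1.indicator hS)).mono_ac (wm_ac n w)
  set t1 : Eu n → ℝ≥0∞ := (Far (ball 0 R) s).indicator (Pm k ((ball 0 R).indicator f)) with ht1
  set t2 : Eu n → ℝ≥0∞ := Pm k f with ht2
  set t3 : Eu n → ℝ≥0∞ := (ball 0 (A + 1)).indicator (Pm k ((Far (ball 0 (A + 1)) s').indicator f))
    with ht3
  set t4 : Eu n → ℝ≥0∞ := Pm k (Z.indicator f) with ht4
  set t5 : Eu n → ℝ≥0∞ := fun x => ∑ z ∈ hTfin.toFinset,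
    (Far (Q z) γ).indicator (Pm k ((Q z).indicator f)) x with ht5
  have m1 : AEMeasurable t1 (wm n w) := (hPmm _ measurableSet_ball).indicator (hFarm _ _)
  have m2 : AEMeasurable t2 (wm n w) := (H.Pg_meas_one hf.1).mono_ac (wm_ac n w)
  have m3 : AEMeasurable t3 (wm n w) := (hPmm _ (hFarm _ _)).indicator measurableSet_ball
  have m4 : AEMeasurable t4 (wm n w) := hPmm _ hZm
  have m5' : ∀ z ∈ hTfin.toFinset, AEMeasurable
      ((Far (Q z) γ).indicator (Pm k ((Q z).indicator f))) (wm n w) := fun z _ =>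
    (hPmm _ (hQm z)).indicator (hFarm _ _)
  have m5 : AEMeasurable t5 (wm n w) := Finset.aemeasurable_fun_sum _ m5'
  set N := wLpNorm n p w f with hN
  have n1 : NN (wm n w) p t1 ≤ ENNReal.ofReal e₁ * N := (hG _ s isOpen_ball hs hsvol f hf).1
  have n2 : NN (wm n w) p t2 ≤ ENNReal.ofReal C₀ * N := H.lemB1 hf
  have n3 : NN (wm n w) p t3 ≤ ENNReal.ofReal e₁ * N := (hG _ s' isOpen_ball hs' hsvol' f hf).2
  have n4 : NN (wm n w) p t4 = 0 := by
    have h1 := H.lemB1 (H.mem_ind hZm hf).1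
    rw [H.norm_Z hww, mul_zero] at h1
    exact le_antisymm h1 zero_le
  have n5 : NN (wm n w) p t5 ≤ ENNReal.ofReal e₁ * N := by
    refine (NN_sum_le hp _ _ m5').trans ?_
    refine (Finset.sum_le_sum fun z _ => (hG₂ _ γ (hQo z) hγ (hQvol z) f hf).1).trans ?_
    rw [Finset.sum_const, nsmul_eq_mul, ← mul_assoc]
    gcongr
    rw [← hm, ← ENNReal.ofReal_natCast, ← ENNReal.ofReal_mul (Nat.cast_nonneg _)]
    apply ENNReal.ofReal_le_ofReal
    rw [mul_div_assoc', div_le_iff₀ (by positivity)]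
    nlinarith
  set b₂ : ℝ≥0∞ := ‖2 * B‖ₑ with hb₂
  set g₂ : ℝ≥0∞ := ‖2 * γ * Λ‖ₑ with hg₂
  have hb₂e : b₂ = ENNReal.ofReal (2 * B) := Real.enorm_eq_ofReal (by positivity)
  have hg₂e : g₂ = ENNReal.ofReal (2 * γ * Λ) := Real.enorm_eq_ofReal (by positivity)
  have hb₂t : b₂ ≠ ⊤ := enorm_ne_top
  have hg₂t : g₂ ≠ ⊤ := enorm_ne_top
  refine ⟨fun x => b₂ * t1 x + (g₂ * t2 x + (b₂ * t3 x + (b₂ * t4 x + b₂ * t5 x))), ?_, ?_, ?_⟩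
  · exact (m1.const_mul _).add ((m2.const_mul _).add ((m3.const_mul _).add
      ((m4.const_mul _).add (m5.const_mul _))))
  · have k5 := m5.const_mul b₂
    have k4 := (m4.const_mul b₂).add k5
    have k3 := (m3.const_mul b₂).add k4
    have k2 := (m2.const_mul g₂).add k3
    have q1 : NN (wm n w) p (fun x => b₂ * t1 x) ≤ ENNReal.ofReal (ε / 4) * N := by
      rw [NN_const_mul hp hb₂t]
      refine (mul_le_mul_right n1 _).trans (le_of_eq ?_)
      rw [← mul_assoc, hb₂e, ← ENNReal.ofReal_mul (by positivity)]
      congr 2; rw [he₁]; field_simp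
    have q2 : NN (wm n w) p (fun x => g₂ * t2 x) ≤ ENNReal.ofReal (ε / 4) * N := by
      rw [NN_const_mul hp hg₂t]
      refine (mul_le_mul_right n2 _).trans (le_of_eq ?_)
      rw [← mul_assoc, hg₂e, ← ENNReal.ofReal_mul (by positivity)]
      congr 2; rw [hγdef]; field_simp
    have q3 : NN (wm n w) p (fun x => b₂ * t3 x) ≤ ENNReal.ofReal (ε / 4) * N := by
      rw [NN_const_mul hp hb₂t]
      refine (mul_le_mul_right n3 _).trans (le_of_eq ?_)
      rw [← mul_assoc, hb₂e, ← ENNReal.ofReal_mul (by positivity)]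
      congr 2; rw [he₁]; field_simp
    have q4 : NN (wm n w) p (fun x => b₂ * t4 x) = 0 := by
      rw [NN_const_mul hp hb₂t, n4, mul_zero]
    have q5 : NN (wm n w) p (fun x => b₂ * t5 x) ≤ ENNReal.ofReal (ε / 4) * N := by
      rw [NN_const_mul hp hb₂t]
      refine (mul_le_mul_right n5 _).trans (le_of_eq ?_)
      rw [← mul_assoc, hb₂e, ← ENNReal.ofReal_mul (by positivity)]
      congr 2; rw [he₁]; field_simp
    refine (NN_add_le hp k2).trans ?_
    refine (add_le_add q1 ((NN_add_le hp k3).trans (add_le_add q2 ((NN_add_le hp k4).trans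
      (add_le_add q3 ((NN_add_le hp k5).trans (add_le_add q4.le q5))))))).trans (le_of_eq ?_)
    rw [zero_add, ← add_mul, ← add_mul, ← add_mul, ← ENNReal.ofReal_add (by positivity)
      (by positivity), ← ENNReal.ofReal_add (by positivity) (by positivity),
      ← ENNReal.ofReal_add (by positivity) (by positivity)]
    congr 2; ring
  · have hfull : ∀ x y, |β x - β y| ≤ 2 * B := fun x y =>
      (abs_sub _ _).trans (by linarith [hB x, hB y])
    filter_upwards [H.Pm_lt_top hf] with x hx
    have hconst : Pg k (fun _ _ => 2 * B) f x < ⊤ := by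
      have := Pg_const_mul (k := k) (c := fun _ _ => 1) (f := f) (x := x) (2 * B)
      simp only [mul_one] at this
      rw [this]
      exact ENNReal.mul_lt_top hb₂t.lt_top hx
    have hPc : Pg k (fun x y => β x - β y) f x < ⊤ := by
      refine lt_of_le_of_lt (Pg_mono (c' := fun _ _ => 2 * B) fun y => ?_) hconst
      rw [abs_mul, abs_mul]
      exact mul_le_mul_of_nonneg_right ((hfull x y).trans (le_abs_self _)) (abs_nonneg _)
    have hPc' : Pg k (ctr β γ Y) f x < ⊤ := by
      refine lt_of_le_of_lt (Pg_mono (c' := fun _ _ => 2 * B) fun y => ?_) hconst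
      rw [abs_mul, abs_mul]
      exact mul_le_mul_of_nonneg_right ((ctr_le hB γ Y x y).trans (le_abs_self _)) (abs_nonneg _)
    have hcm : AEStronglyMeasurable (fun y => β x - β y) volume :=
      (continuous_const.sub hβc).aestronglyMeasurable
    by_cases hxK : x ∈ closedBall (0 : Eu n) A
    · rw [Set.indicator_of_mem hxK]
      set W : Set (Eu n) := {y | y ∉ Y ∧ 2 * γ ≤ dist x y} with hW
      have hWm : MeasurableSet W := by
        have hcl : IsClosed {y : Eu n | 2 * γ ≤ dist x y} :=
          isClosed_le continuous_const (by fun_prop)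
        exact hYm.compl.inter hcl.measurableSet
      have s0 : ‖TstarB n k β f x - Tc k (ctr β γ Y) f x‖ₑ ≤
          Pg k (fun x y => (β x - β y) - ctr β γ Y x y) f x :=
        Tc_sub_le_Pg (c := fun x y => β x - β y) H.hkm hcm (ctr_meas hβc γ hYm x) hf.1 hPc hPc'
      have s1 : Pg k (fun x y => (β x - β y) - ctr β γ Y x y) f x ≤
          Pg k (fun x y => (2 * γ * Λ) * 1) f x +
          Pg k (fun x y => (2 * B) * 1) (W.indicator f) x := by
        refine Pg_add_le H.hkm aestronglyMeasurable_const (hf.1.indicator hWm) fun y => ?_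
        rw [mul_one, mul_one, abs_mul]
        have key1 : dist x y < 2 * γ ∨ y ∈ Y → |β x - β y - ctr β γ Y x y| ≤ 2 * γ * Λ := by
          intro hor
          by_cases hd : 2 * γ ≤ dist x y
          · have hyY : y ∈ Y := hor.resolve_left (not_lt.2 hd)
            rw [ctr, chi_eq_one hγ hd, Set.indicator_of_mem hyY]
            simp; positivity
          · rw [not_le] at hd
            have e : β x - β y - ctr β γ Y x y =
                (β x - β y) * (1 - chi γ x y * Y.indicator 1 y) := by rw [ctr]; ring
            have hi : 0 ≤ chi γ x y * Y.indicator 1 y ∧ chi γ x y * Y.indicator 1 y ≤ 1 := by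
              by_cases hyY : y ∈ Y
              · rw [Set.indicator_of_mem hyY]
                simp only [Pi.one_apply, mul_one]
                exact ⟨chi_nonneg .., chi_le_one ..⟩
              · rw [Set.indicator_of_notMem hyY]; simp
            rw [e, abs_mul]
            have a1 : |1 - chi γ x y * Y.indicator 1 y| ≤ 1 := by
              rw [abs_le]; constructor <;> linarith [hi.1, hi.2]
            have a2 : |β x - β y| ≤ 2 * γ * Λ := (hLip x y).trans (by nlinarith)
            calc _ ≤ 2 * γ * Λ * 1 := mul_le_mul a2 a1 (abs_nonneg _) (by positivity)
              _ = _ := mul_one _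
        by_cases hyW : y ∈ W
        · rw [Set.indicator_of_mem hyW, ctr, Set.indicator_of_notMem hyW.1]
          simp only [mul_zero, sub_zero]
          rw [abs_mul (2 * B), abs_of_pos (by positivity : 0 < 2 * B)]
          have := mul_le_mul_of_nonneg_right (hfull x y) (abs_nonneg (f y))
          linarith [abs_nonneg (2 * γ * Λ * f y)]
        · have hor : dist x y < 2 * γ ∨ y ∈ Y := by
            by_contra hcon
            rw [not_or, not_lt] at hcon
            exact hyW ⟨hcon.2, hcon.1⟩
          rw [Set.indicator_of_notMem hyW, mul_zero, abs_zero, add_zero, abs_mul]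
          exact mul_le_mul_of_nonneg_right ((key1 hor).trans (le_abs_self _)) (abs_nonneg _)
      rw [Pg_const_mul, Pg_const_mul] at s1
      have hxb : x ∈ ball (0 : Eu n) (A + 1) := closedBall_subset_ball (by linarith) hxK
      have hballW : MeasurableSet (W ∩ ball (0 : Eu n) R') := hWm.inter measurableSet_ball
      have s2 : Pm k (W.indicator f) x ≤ Pm k ((Far (ball 0 (A + 1)) s').indicator f) x +
          Pm k ((W ∩ ball 0 R').indicator f) x := by
        refine Pm_union H.hkm hf.1 hballW fun y hy => ?_
        by_cases hyR : y ∈ ball (0 : Eu n) R'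
        · exact Or.inr ⟨hy, hyR⟩
        · left
          intro z hz
          rw [mem_ball, not_lt] at hyR
          rw [mem_ball] at hz
          have := dist_triangle y z 0
          linarith
      have s3 : Pm k ((W ∩ ball 0 R').indicator f) x ≤ Pm k (Z.indicator f) x +
          Pm k ((W ∩ ball 0 R' ∩ U).indicator f) x := by
        refine Pm_union H.hkm hf.1 (hballW.inter hUo.measurableSet) fun y hy => ?_
        by_cases hyZ : y ∈ Z
        · exact Or.inl hyZ
        · refine Or.inr ⟨hy, hUsub ⟨⟨not_le.1 hyZ, ?_⟩, hy.2⟩⟩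
          by_contra hcon
          exact hy.1.1 ⟨hy.2, not_lt.1 hcon⟩
      have s4 : Pm k ((W ∩ ball 0 R' ∩ U).indicator f) x ≤ t5 x := by
        classical
        have := Pm_biUnion (x := x) (k := k) (f := f) H.hkm hf.1 hTfin.toFinset
          (Q := fun z => if x ∈ Far (Q z) γ then Q z else ∅)
          (fun z => by split_ifs; exacts [hQm z, MeasurableSet.empty])
          (S := W ∩ ball 0 R' ∩ U) ?_
        · refine this.trans (Finset.sum_le_sum fun z _ => ?_)
          by_cases hxz : x ∈ Far (Q z) γ
          · rw [if_pos hxz, Set.indicator_of_mem hxz]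
          · rw [if_neg hxz, Pm_empty]; exact zero_le
        · rintro y ⟨⟨hyW, hyR⟩, hyU⟩
          obtain ⟨z, hzT, hyz⟩ := Set.mem_iUnion₂.1 (hTcov (ball_subset_closedBall hyR))
          have hfar : x ∈ Far (Q z) γ := by
            intro y' hy'
            have h1 := hyW.2
            have h2 : dist y' z < γ / 4 := hy'.2
            have h3 : dist y z < γ / 4 := hyz
            have h4 := dist_triangle x y' y
            have h5 := dist_triangle_right y' y z
            linarith
          refine Set.mem_iUnion₂.2 ⟨z, hTfin.mem_toFinset.2 hzT, ?_⟩
          rw [if_pos hfar]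
          exact ⟨hyU, hyz⟩
      have s3' : t3 x = Pm k ((Far (ball 0 (A + 1)) s').indicator f) x := Set.indicator_of_mem hxb _
      refine s0.trans (s1.trans ?_)
      have s5 : Pm k (W.indicator f) x ≤ t3 x + (t4 x + t5 x) := by
        rw [s3']
        exact s2.trans (add_le_add_right (s3.trans (add_le_add_right s4 _)) _)
      calc g₂ * Pm k f x + b₂ * Pm k (W.indicator f) x
          ≤ g₂ * t2 x + b₂ * (t3 x + (t4 x + t5 x)) := by gcongr
        _ = g₂ * t2 x + (b₂ * t3 x + (b₂ * t4 x + b₂ * t5 x)) := by rw [mul_add, mul_add]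
        _ ≤ _ := le_add_self
    · rw [Set.indicator_of_notMem hxK, sub_zero]
      rw [mem_closedBall, not_le] at hxK
      have hxR : x ∉ ball (0 : Eu n) R := by
        rw [mem_ball, not_lt]; linarith
      have hxF : x ∈ Far (ball 0 R) s := by
        intro y hy
        rw [mem_ball] at hy
        have := dist_triangle x y 0
        linarith
      refine (Tc_le_Pg (c := fun x y => β x - β y)).trans ?_
      have a1 : Pg k (fun x y => β x - β y) f x ≤
          Pg k (fun x y => (2 * B) * 1) ((ball 0 R).indicator f) x := by
        refine Pg_mono fun y => ?_
        by_cases hy : y ∈ ball (0 : Eu n) R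
        · rw [Set.indicator_of_mem hy, abs_mul, abs_mul, mul_one]
          exact mul_le_mul_of_nonneg_right ((hfull x y).trans (le_abs_self _)) (abs_nonneg _)
        · rw [hsupp x hxR, hsupp y hy]; simp; try positivity
      rw [Pg_const_mul] at a1
      have a2 : t1 x = Pm k ((ball 0 R).indicator f) x := Set.indicator_of_mem hxF _
      rw [← show Pm k ((ball 0 R).indicator f) x = Pg k (fun _ _ => 1) ((ball 0 R).indicator f) x from rfl, ← a2] at a1
      exact a1.trans le_self_add
end


theorem rpow_exp_bound {m a : ℝ} (hm : 0 ≤ m) (ha : 0 < a) :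
    ∃ D > (0:ℝ), ∀ t > (0:ℝ), t ^ (-m) * Real.exp (-a / t) ≤ D := by
  set N := ⌈m⌉₊ with hN
  refine ⟨a ^ (-m) * N.factorial, by positivity, fun t ht => ?_⟩
  have hu : 0 < a / t := by positivity
  have key : (a / t) ^ m ≤ N.factorial * Real.exp (a / t) := by
    have hfac : (1:ℝ) ≤ N.factorial := by exact_mod_cast Nat.one_le_iff_ne_zero.2 (Nat.factorial_ne_zero N)
    rcases le_total (a / t) 1 with h | h
    · have h1 : (a / t) ^ m ≤ 1 := Real.rpow_le_one hu.le h hm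
      have h2 : 1 ≤ Real.exp (a / t) := Real.one_le_exp hu.le
      nlinarith
    · have h1 : (a / t) ^ m ≤ (a / t) ^ (N : ℝ) :=
        Real.rpow_le_rpow_of_exponent_le h (Nat.le_ceil m)
      have h2 := Real.pow_div_factorial_le_exp (a / t) hu.le N
      rw [div_le_iff₀ (by positivity)] at h2
      rw [Real.rpow_natCast] at h1
      linarith
  have e : t ^ (-m) = a ^ (-m) * (a / t) ^ m := by
    rw [Real.div_rpow ha.le ht.le, Real.rpow_neg ha.le, Real.rpow_neg ht.le]
    field_simp
  rw [e, mul_assoc]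
  refine mul_le_mul_of_nonneg_left ?_ (by positivity)
  have : Real.exp (-a / t) = (Real.exp (a / t))⁻¹ := by rw [neg_div, Real.exp_neg]
  rw [this, ← div_eq_mul_inv, div_le_iff₀ (Real.exp_pos _)]
  exact key

theorem rsup_sub_le {u v : ℝ → ℝ} {M e : ℝ} (hM : 0 ≤ M) (he : 0 ≤ e)
    (hu0 : ∀ t, 0 ≤ u t) (hv0 : ∀ t, 0 ≤ v t)
    (hu : ∀ t, 0 < t → u t ≤ M) (hv : ∀ t, 0 < t → v t ≤ M)
    (h : ∀ t, 0 < t → |u t - v t| ≤ e) :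
    |(⨆ (t : ℝ) (_ : 0 < t), u t) - ⨆ (t : ℝ) (_ : 0 < t), v t| ≤ e := by
  rw [abs_sub_le_iff]
  constructor
  · rw [sub_le_iff_le_add']
    refine rsup_le (add_nonneg (rsup_nonneg hv0) he) fun t ht => ?_
    have := le_rsup hM hv ht
    linarith [(abs_le.1 (h t ht)).2]
  · rw [sub_le_iff_le_add']
    refine rsup_le (add_nonneg (rsup_nonneg hu0) he) fun t ht => ?_
    have := le_rsup hM hu ht
    linarith [(abs_le.1 (h t ht)).1]

section
variable {n : ℕ} {p θ : ℝ} {ρ w : Eu n → ℝ} {k : ℝ → Eu n → Eu n → ℝ} {C₀ : ℝ}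

/-- Off-diagonal size of the kernel. -/
theorem Ctx.k_far (H : Ctx n p θ ρ w k C₀) {s m : ℝ} (hs : 0 < s) (hm : 0 ≤ m) :
    ∃ D > (0:ℝ), ∀ t > (0:ℝ), ∀ x y : Eu n, s ≤ dist x y → k t x y ≤ D * t ^ m := by
  obtain ⟨C, hC, h⟩ := H.hk1
  obtain ⟨D, hD, hD'⟩ := rpow_exp_bound (m := (n:ℝ) / 2 + m) (a := s ^ 2 / 5) (by positivity) (by positivity)
  refine ⟨C * D, by positivity, fun t ht x y hxy => (h t ht x y).2.trans ?_⟩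
  have h1 : Real.exp (-(dist x y) ^ 2 / (5 * t)) ≤ Real.exp (-(s ^ 2 / 5) / t) := by
    rw [Real.exp_le_exp]
    have : -(s ^ 2 / 5) / t = -s ^ 2 / (5 * t) := by field_simp
    rw [this]
    gcongr
  have e : t ^ (-(n:ℝ) / 2) = t ^ (-((n:ℝ) / 2 + m)) * t ^ m := by
    rw [← Real.rpow_add ht]; congr 1; ring
  calc C * t ^ (-(n : ℝ) / 2) * Real.exp (-(dist x y) ^ 2 / (5 * t))
      ≤ C * t ^ (-(n : ℝ) / 2) * Real.exp (-(s ^ 2 / 5) / t) := by gcongr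
    _ = C * (t ^ (-((n:ℝ) / 2 + m)) * Real.exp (-(s ^ 2 / 5) / t)) * t ^ m := by rw [e]; ring
    _ ≤ C * D * t ^ m := by gcongr; exact hD' t ht

theorem Ctx.k_hol (H : Ctx n p θ ρ w k C₀) {s : ℝ} (hs : 0 < s) :
    ∃ δ > (0:ℝ), ∃ D > (0:ℝ), ∀ t > (0:ℝ), ∀ x x' y : Eu n, s ≤ dist x y → s ≤ dist x' y →
      |k t x' y - k t x y| ≤ D * (dist x' x ^ δ + dist x' x ^ 2) := by
  obtain ⟨δ, hδ, c, hc, C, hC, h⟩ := H.hk2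
  obtain ⟨D, hD, hD'⟩ := rpow_exp_bound (m := (n:ℝ) / 2 + δ / 2) (a := c * s ^ 2) (by positivity) (by positivity)
  obtain ⟨E, hE, hE'⟩ := H.k_far hs (m := 1) zero_le_one
  obtain ⟨_, _, hk1⟩ := H.hk1
  refine ⟨δ, hδ, C * D + E, by positivity, fun t ht x x' y hxy hxy' => ?_⟩
  have hst : 0 < Real.sqrt t := Real.sqrt_pos.2 ht
  have hd : 0 ≤ dist x' x := dist_nonneg
  by_cases hh : dist x' x ≤ Real.sqrt t
  · have h0 := h t ht x y (x' - x) (by rwa [← dist_eq_norm])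
    rw [add_sub_cancel, ← dist_eq_norm] at h0
    have h1 : Real.exp (-c * (dist x y) ^ 2 / t) ≤ Real.exp (-(c * s ^ 2) / t) := by
      rw [Real.exp_le_exp]
      have : -c * (dist x y) ^ 2 = -(c * (dist x y) ^ 2) := by ring
      rw [this]
      gcongr
    have e : (dist x' x / Real.sqrt t) ^ δ * t ^ (-(n : ℝ) / 2) =
        dist x' x ^ δ * t ^ (-((n:ℝ) / 2 + δ / 2)) := by
      rw [Real.div_rpow hd hst.le, Real.sqrt_eq_rpow, ← Real.rpow_mul ht.le, div_eq_mul_inv,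
        ← Real.rpow_neg ht.le, mul_assoc, ← Real.rpow_add ht]
      congr 2; ring
    calc |k t x' y - k t x y| ≤ _ := h0
      _ ≤ C * (dist x' x / Real.sqrt t) ^ δ * t ^ (-(n : ℝ) / 2) * Real.exp (-(c * s ^ 2) / t) := by
        gcongr
      _ = C * dist x' x ^ δ * (t ^ (-((n:ℝ) / 2 + δ / 2)) * Real.exp (-(c * s ^ 2) / t)) := by
        rw [mul_assoc C, e]; ring
      _ ≤ C * dist x' x ^ δ * D := by gcongr; exact hD' t ht
      _ ≤ _ := by
        have : 0 ≤ dist x' x ^ δ := by positivity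
        have : 0 ≤ dist x' x ^ 2 := by positivity
        have : 0 ≤ C * D * dist x' x ^ 2 := by positivity
        have : 0 ≤ E * dist x' x ^ 2 := by positivity
        have : 0 ≤ E * dist x' x ^ δ := by positivity
        linarith
  · push Not at hh
    have ht2 : t ≤ dist x' x ^ 2 := by
      have := Real.sq_sqrt ht.le
      nlinarith
    have a1 := hE' t ht x y hxy
    have a2 := hE' t ht x' y hxy'
    rw [Real.rpow_one] at a1 a2
    have a3 : E * t ≤ E * dist x' x ^ 2 := by gcongr
    have p1 := (hk1 t ht x y).1
    have p2 := (hk1 t ht x' y).1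
    have : 0 ≤ C * D * dist x' x ^ 2 := by positivity
    have : 0 ≤ (C * D + E) * dist x' x ^ δ := by positivity
    rw [abs_le]; constructor <;> nlinarith

/-- The truncated kernel is bounded and equicontinuous. -/
theorem Ctx.kappa (H : Ctx n p θ ρ w k C₀) {β : Eu n → ℝ} {Λ B γ : ℝ} (hΛ : 0 < Λ) (hB0 : 0 < B)
    (hγ : 0 < γ) (hLip : ∀ x y, |β x - β y| ≤ Λ * dist x y) (hB : ∀ x, |β x| ≤ B)
    (Y : Set (Eu n)) :
    (∃ D > (0:ℝ), ∀ t > (0:ℝ), ∀ x y, |k t x y * ctr β γ Y x y| ≤ D) ∧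
    ∀ η > (0:ℝ), ∃ d > (0:ℝ), ∀ t > (0:ℝ), ∀ x x' y, dist x' x < d →
      |k t x' y * ctr β γ Y x' y - k t x y * ctr β γ Y x y| ≤ η := by
  have hs : 0 < γ / 2 := by positivity
  obtain ⟨D, hD, hD'⟩ := H.k_far hs (m := 0) le_rfl
  obtain ⟨δ, hδ, E, hE, hE'⟩ := H.k_hol hs
  obtain ⟨_, _, hk1⟩ := H.hk1
  simp only [Real.rpow_zero, mul_one] at hD'
  have hz : ∀ x y, dist x y ≤ γ → ctr β γ Y x y = 0 := fun x y h => by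
    simp [ctr, chi_eq_zero hγ h]
  refine ⟨⟨D * (2 * B), by positivity, fun t ht x y => ?_⟩, fun η hη => ?_⟩
  · by_cases hxy : dist x y ≤ γ
    · rw [hz x y hxy]; simp; positivity
    · rw [abs_mul, abs_of_pos (hk1 t ht x y).1]
      exact mul_le_mul (hD' t ht x y (by push Not at hxy; linarith)) (ctr_le hB γ Y x y)
        (abs_nonneg _) hD.le
  · have hlim : Tendsto (fun r : ℝ => 2 * B * (E * (r ^ δ + r ^ 2)) + D * ((2 * B / γ + Λ) * r))
        (𝓝 0) (𝓝 0) := by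
      have : ContinuousAt (fun r : ℝ => 2 * B * (E * (r ^ δ + r ^ 2)) +
          D * ((2 * B / γ + Λ) * r)) 0 := by
        have := (Real.continuousAt_rpow_const 0 δ (Or.inr hδ.le))
        fun_prop
      have h2 := this.tendsto
      simpa [Real.zero_rpow hδ.ne'] using h2
    obtain ⟨d, hd, hd'⟩ := Metric.eventually_nhds_iff.1 (hlim.eventually_lt_const hη)
    refine ⟨min d (γ / 2), by positivity, fun t ht x x' y hxx => ?_⟩
    have hx1 : dist x' x < d := hxx.trans_le (min_le_left _ _)
    have hx2 : dist x' x < γ / 2 := hxx.trans_le (min_le_right _ _)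
    have t1 := dist_triangle x' x y
    have t2 := dist_triangle x x' y
    rw [dist_comm x x'] at t2
    by_cases c1 : dist x y < γ / 2
    · rw [hz x y (by linarith), hz x' y (by linarith)]; simp [hη.le]
    by_cases c2 : dist x' y < γ / 2
    · rw [hz x y (by linarith), hz x' y (by linarith)]; simp [hη.le]
    push Not at c1 c2
    have hr : 0 ≤ dist x' x := dist_nonneg
    have hval := hd' (y := dist x' x) (by rw [Real.dist_eq, sub_zero, abs_of_nonneg hr]; exact hx1)
    refine le_trans ?_ hval.le
    have hc : |ctr β γ Y x' y - ctr β γ Y x y| ≤ (2 * B / γ + Λ) * dist x' x := by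
      have e : ctr β γ Y x' y - ctr β γ Y x y =
          ((chi γ x' y - chi γ x y) * (β x' - β y) + chi γ x y * (β x' - β x)) *
            Y.indicator 1 y := by
        unfold ctr; ring
      have b1 : |β x' - β y| ≤ 2 * B := (abs_sub _ _).trans (by linarith [hB x', hB y])
      have b2 : |(chi γ x' y - chi γ x y) * (β x' - β y)| ≤ dist x' x / γ * (2 * B) := by
        rw [abs_mul]
        exact mul_le_mul (chi_lip hγ x' x y) b1 (abs_nonneg _) (by positivity)
      have b3 : |chi γ x y * (β x' - β x)| ≤ 1 * (Λ * dist x' x) := by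
        rw [abs_mul, abs_of_nonneg (chi_nonneg γ x y)]
        exact mul_le_mul (chi_le_one γ x y) (hLip x' x) (abs_nonneg _) zero_le_one
      have b4 : |Y.indicator (1 : Eu n → ℝ) y| ≤ 1 := by
        by_cases hy : y ∈ Y <;> simp [hy]
      rw [e, abs_mul]
      refine (mul_le_mul ((abs_add_le _ _).trans (add_le_add b2 b3)) b4 (abs_nonneg _)
        (by positivity)).trans (le_of_eq ?_)
      field_simp
    have e : k t x' y * ctr β γ Y x' y - k t x y * ctr β γ Y x y =
        (k t x' y - k t x y) * ctr β γ Y x' y + k t x y * (ctr β γ Y x' y - ctr β γ Y x y) := by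
      ring
    rw [e]
    refine (abs_add_le _ _).trans (add_le_add ?_ ?_)
    · rw [abs_mul, mul_comm]
      exact mul_le_mul (ctr_le hB γ Y x' y) (hE' t ht x x' y c1 c2) (abs_nonneg _) (by positivity)
    · rw [abs_mul, abs_of_pos (hk1 t ht x y).1]
      exact mul_le_mul (hD' t ht x y c1) hc (abs_nonneg _) hD.le

theorem Ctx.intY (H : Ctx n p θ ρ w k C₀) {R' M : ℝ} (hM : 0 < M) {Y : Set (Eu n)}
    (hYm : MeasurableSet Y) (hYR : Y ⊆ ball 0 R') (hYw : ∀ᵐ y ∂volume, y ∈ Y → 1 / M ≤ w y) :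
    ∃ L > (0:ℝ), ∀ f, MemWLp n p w f → wLpNorm n p w f ≤ 1 →
      ∫⁻ y in Y, ‖f y‖ₑ ≤ ENNReal.ofReal L := by
  have hvt : volume (ball (0 : Eu n) R') ≠ ⊤ := measure_ball_lt_top.ne
  have hp := H.hp
  refine ⟨(volume (ball (0 : Eu n) R')).toReal + M, by positivity, fun f hf hf1 => ?_⟩
  rw [ENNReal.ofReal_add ENNReal.toReal_nonneg hM.le, ENNReal.ofReal_toReal hvt]
  have hI : ∫⁻ x, ENNReal.ofReal (|f x| ^ p * w x) ≤ 1 := by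
    unfold wLpNorm at hf1
    have := ENNReal.rpow_le_rpow hf1 (show 0 ≤ p by linarith)
    rwa [← ENNReal.rpow_mul, one_div_mul_cancel (by linarith), ENNReal.rpow_one,
      ENNReal.one_rpow] at this
  calc ∫⁻ y in Y, ‖f y‖ₑ
      ≤ ∫⁻ y in Y, (1 + ENNReal.ofReal M * ENNReal.ofReal (|f y| ^ p * w y)) := by
        refine lintegral_mono_ae ?_
        filter_upwards [ae_restrict_of_ae hYw, ae_restrict_mem hYm] with y hy hyY
        have hw1 := hy hyY
        rw [div_le_iff₀ hM] at hw1
        rw [Real.enorm_eq_ofReal_abs, ← ENNReal.ofReal_one, ← ENNReal.ofReal_mul hM.le,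
          ← ENNReal.ofReal_add zero_le_one
            (mul_nonneg hM.le (mul_nonneg (by positivity) (H.hw0 y)))]
        refine ENNReal.ofReal_le_ofReal ?_
        have h1 : |f y| ≤ 1 + |f y| ^ p := by
          rcases le_total |f y| 1 with h | h
          · have : 0 ≤ |f y| ^ p := by positivity
            linarith
          · have := Real.rpow_le_rpow_of_exponent_le h hp.le
            rw [Real.rpow_one] at this
            linarith
        have h2 : 0 ≤ |f y| ^ p := by positivity
        nlinarith
    _ = volume Y + ENNReal.ofReal M * ∫⁻ y in Y, ENNReal.ofReal (|f y| ^ p * w y) := by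
        rw [lintegral_add_left measurable_const, lintegral_const_mul' _ _ ENNReal.ofReal_ne_top]
        simp
    _ ≤ volume (ball (0 : Eu n) R') + ENNReal.ofReal M * 1 := by
        gcongr
        exact (setLIntegral_le_lintegral _ _).trans hI
    _ = _ := by rw [mul_one]

theorem Ctx.lemH (H : Ctx n p θ ρ w k C₀) {β : Eu n → ℝ} {Λ B γ R' M : ℝ} (hβc : Continuous β)
    (hΛ : 0 < Λ) (hB0 : 0 < B)
    (hγ : 0 < γ) (hLip : ∀ x y, |β x - β y| ≤ Λ * dist x y) (hB : ∀ x, |β x| ≤ B)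
    (hM : 0 < M) {Y : Set (Eu n)}
    (hYm : MeasurableSet Y) (hYR : Y ⊆ ball 0 R') (hYw : ∀ᵐ y ∂volume, y ∈ Y → 1 / M ≤ w y) :
    (∃ D > (0:ℝ), ∀ f, MemWLp n p w f → wLpNorm n p w f ≤ 1 → ∀ x, |Tc k (ctr β γ Y) f x| ≤ D) ∧
    ∀ η > (0:ℝ), ∃ d > (0:ℝ), ∀ f, MemWLp n p w f → wLpNorm n p w f ≤ 1 → ∀ x x', dist x' x < d →
      |Tc k (ctr β γ Y) f x' - Tc k (ctr β γ Y) f x| ≤ η := by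
  obtain ⟨L, hL, hL'⟩ := H.intY hM hYm hYR hYw
  obtain ⟨⟨D, hD, hD'⟩, heq⟩ := H.kappa hΛ hB0 hγ hLip hB Y
  have hbig : ∀ f, MemWLp n p w f → wLpNorm n p w f ≤ 1 → ∀ (z : Eu n → ℝ) (e : ℝ), 0 ≤ e →
      (∀ y, |z y| ≤ e) → (∀ y, y ∉ Y → z y = 0) →
      ∫⁻ y, ‖z y * f y‖ₑ ≤ ENNReal.ofReal (e * L) := by
    intro f hf hf1 z e he hz hzY
    calc ∫⁻ y, ‖z y * f y‖ₑ ≤ ∫⁻ y, Y.indicator (fun y => ENNReal.ofReal e * ‖f y‖ₑ) y := by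
          refine lintegral_mono fun y => ?_
          by_cases hy : y ∈ Y
          · rw [Set.indicator_of_mem hy, enorm_mul]
            gcongr
            rw [Real.enorm_eq_ofReal_abs]
            exact ENNReal.ofReal_le_ofReal (hz y)
          · rw [hzY y hy]; simp
      _ = ENNReal.ofReal e * ∫⁻ y in Y, ‖f y‖ₑ := by
          rw [lintegral_indicator hYm, lintegral_const_mul' _ _ ENNReal.ofReal_ne_top]
      _ ≤ ENNReal.ofReal e * ENNReal.ofReal L := by gcongr; exact hL' f hf hf1
      _ = _ := by rw [ENNReal.ofReal_mul he]
  have hYz : ∀ t x y, y ∉ Y → k t x y * ctr β γ Y x y = 0 := fun t x y hy => by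
    simp [ctr, hy]
  have hIntegr : ∀ f, MemWLp n p w f → wLpNorm n p w f ≤ 1 → ∀ t > 0, ∀ x,
      Integrable (fun y => k t x y * ctr β γ Y x y * f y) volume := fun f hf hf1 t ht x =>
    ⟨meas_integrand H.hkm (ctr_meas hβc γ hYm x) hf.1 t,
      (hbig f hf hf1 _ D hD.le (hD' t ht x) (hYz t x)).trans_lt ENNReal.ofReal_lt_top⟩
  have habs : ∀ (z : Eu n → ℝ) (e : ℝ), 0 ≤ e → ∫⁻ y, ‖z y‖ₑ ≤ ENNReal.ofReal e → |∫ y, z y| ≤ e := by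
    intro z e he h
    have h2 := (enorm_integral_le_lintegral_enorm z (μ := volume)).trans h
    rw [Real.enorm_eq_ofReal_abs] at h2
    exact (ENNReal.ofReal_le_ofReal_iff he).1 h2
  have hbd : ∀ f, MemWLp n p w f → wLpNorm n p w f ≤ 1 → ∀ x, ∀ t, 0 < t →
      |∫ y, k t x y * ctr β γ Y x y * f y| ≤ D * L := fun f hf hf1 x t ht =>
    habs _ _ (by positivity) (hbig f hf hf1 _ D hD.le (hD' t ht x) (hYz t x))
  refine ⟨⟨D * L, by positivity, fun f hf hf1 x => ?_⟩, fun η hη => ?_⟩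
  · rw [abs_of_nonneg (Tc_nonneg ..)]
    exact rsup_le (by positivity) (hbd f hf hf1 x)
  · obtain ⟨d, hd, hd'⟩ := heq (η / L) (by positivity)
    refine ⟨d, hd, fun f hf hf1 x x' hxx => ?_⟩
    refine rsup_sub_le (M := D * L) (by positivity) hη.le (fun _ => abs_nonneg _)
      (fun _ => abs_nonneg _) (hbd f hf hf1 x') (hbd f hf hf1 x) fun t ht => ?_
    refine (abs_abs_sub_abs_le_abs_sub _ _).trans ?_
    rw [← integral_sub (hIntegr f hf hf1 t ht x') (hIntegr f hf hf1 t ht x)]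
    refine habs _ _ hη.le ?_
    have := hbig f hf hf1 (fun y => k t x' y * ctr β γ Y x' y - k t x y * ctr β γ Y x y) (η / L)
      (by positivity) (fun y => hd' t ht x x' y hxx) (fun y hy => by rw [hYz t x' y hy, hYz t x y hy, sub_zero])
    rw [div_mul_cancel₀ _ hL.ne'] at this
    simpa only [sub_mul] using this
end


theorem bmo_of_bdd {n : ℕ} {θ : ℝ} (hθ : 0 < θ) {ρ f : Eu n → ℝ} (hρ : ∀ x, 0 ≤ ρ x)
    (hf : LocallyIntegrable f volume) {B : ℝ} (hB0 : 0 ≤ B) (hB : ∀ x, |f x| ≤ B) :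
    IsBmoBound n θ ρ f (2 * B) := by
  refine bmo_of_osc hθ hρ hf hB0 fun x r hr => ⟨0, ?_⟩
  calc ∫⁻ y in ball x r, ‖f y - 0‖ₑ ≤ ∫⁻ _ in ball x r, ENNReal.ofReal B := by
        refine lintegral_mono fun y => ?_
        rw [sub_zero, Real.enorm_eq_ofReal_abs]
        exact ENNReal.ofReal_le_ofReal (hB y)
    _ = _ := by simp

section
variable {n : ℕ} {p θ : ℝ} {ρ w : Eu n → ℝ} {k : ℝ → Eu n → Eu n → ℝ} {C₀ : ℝ}

theorem Ctx.step (H : Ctx n p θ ρ w k C₀) {b : Eu n → ℝ} (hb : MemCMOTheta n θ ρ b)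
    {g : ℕ → Eu n → ℝ} (hg : ∀ j, MemWLp n p w (g j) ∧ wLpNorm n p w (g j) ≤ 1)
    {ε : ℝ} (hε : 0 < ε) :
    ∃ β : Eu n → ℝ, LocallyIntegrable β volume ∧ IsBmoBound n θ ρ (fun x => b x - β x) ε ∧
      (∃ C, IsBmoBound n θ ρ β C) ∧ ∃ (A : ℝ) (F : ℕ → Eu n → ℝ),
      (∀ j, ∃ Err : Eu n → ℝ≥0∞, AEMeasurable Err (wm n w) ∧ NN (wm n w) p Err ≤ ENNReal.ofReal ε ∧
        ∀ᵐ x ∂(wm n w), ‖TstarB n k β (g j) x - (closedBall 0 A).indicator (F j) x‖ₑ ≤ Err x) ∧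
      (∃ D, ∀ j x, |F j x| ≤ D) ∧
      ∀ η > (0:ℝ), ∃ d > (0:ℝ), ∀ j x x', dist x' x < d → |F j x' - F j x| ≤ η := by
  obtain ⟨β, hβs, hβcs, C, hC, hCb⟩ := hb.2 ε hε
  have hβc : Continuous β := hβs.continuous
  obtain ⟨Λ, hΛ⟩ := hβs.lipschitzWith_of_hasCompactSupport hβcs (by simp)
  obtain ⟨B, hB⟩ := hβc.bounded_above_of_compact_support hβcs
  obtain ⟨R, hR⟩ := hβcs.isCompact.isBounded.subset_ball 0
  have hβl : LocallyIntegrable β volume := hβc.locallyIntegrable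
  have hB' : ∀ x, |β x| ≤ |B| + 1 := fun x => by
    have := hB x; rw [Real.norm_eq_abs] at this
    linarith [le_abs_self B]
  have hLip : ∀ x y, |β x - β y| ≤ ((Λ : ℝ) + 1) * dist x y := fun x y => by
    have := hΛ.dist_le_mul x y
    rw [Real.dist_eq] at this
    have h0 : 0 ≤ dist x y := dist_nonneg
    linarith
  have hsupp : ∀ x, x ∉ ball (0 : Eu n) (|R| + 1) → β x = 0 := fun x hx => by
    by_contra h
    exact hx (ball_subset_ball (by linarith [le_abs_self R]) (hR (subset_tsupport _ h)))
  obtain ⟨A, γ, R', M, hγ, hM, Y, hYm, hYR, hYw, hErr⟩ := H.lemF hβc (Λ := (Λ:ℝ) + 1)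
    (by positivity) (B := |B| + 1) (by positivity) (R := |R| + 1) (by positivity) hLip hB' hsupp hε
  obtain ⟨⟨D, hD, hD'⟩, heq⟩ := H.lemH hβc (by positivity) (by positivity) hγ hLip hB' hM hYm hYR hYw
  refine ⟨β, hβl, ⟨hε.le, fun x r hr => (hCb.2 x r hr).trans ?_⟩,
    ⟨_, bmo_of_bdd H.hθ H.hρ hβl (by positivity) hB'⟩, A, fun j => Tc k (ctr β γ Y) (g j), fun j => ?_,
    ⟨D, fun j x => hD' _ (hg j).1 (hg j).2 x⟩, fun η hη => ?_⟩
  · have h1 := one_le_rho_pow H.hθ (div_nonneg hr.le (H.hρ x))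
    exact mul_le_mul_of_nonneg_right hC.le (by linarith)
  · obtain ⟨Err, h1, h2, h3⟩ := hErr (g j) (hg j).1
    exact ⟨Err, h1, h2.trans (mul_le_of_le_one_right' (hg j).2), h3⟩
  · obtain ⟨d, hd, hd'⟩ := heq η hη
    exact ⟨d, hd, fun j x x' h => hd' _ (hg j).1 (hg j).2 x x' h⟩

/-- Arzela and Ascoli with a diagonal argument. -/
theorem diag_ascoli (A : ℕ → ℝ) (F : ℕ → ℕ → Eu n → ℝ)
    (hD : ∀ i, ∃ D, ∀ j x, |F i j x| ≤ D)
    (hE : ∀ i, ∀ η > (0:ℝ), ∃ d > (0:ℝ), ∀ j x x', dist x' x < d → |F i j x' - F i j x| ≤ η) :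
    ∃ φ : ℕ → ℕ, StrictMono φ ∧ ∃ h : ℕ → Eu n → ℝ, (∀ i, Measurable (h i)) ∧
      (∀ i, ∃ D, ∀ x, |h i x| ≤ D) ∧ (∀ i x, x ∉ closedBall (0 : Eu n) (A i) → h i x = 0) ∧
      ∀ i, ∀ η > (0:ℝ), ∀ᶠ j in atTop, ∀ x, x ∈ closedBall (0 : Eu n) (A i) →
        |F i (φ j) x - h i x| ≤ η := by
  have hcomp : ∀ i, CompactSpace (closedBall (0 : Eu n) (A i)) := fun i =>
    isCompact_iff_compactSpace.1 (isCompact_closedBall _ _)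
  have hcont : ∀ i j, Continuous (F i j) := fun i j => by
    rw [Metric.continuous_iff]
    intro x e he
    obtain ⟨d, hd, h⟩ := hE i (e / 2) (by positivity)
    exact ⟨d, hd, fun y hy => by rw [Real.dist_eq]; linarith [h j x y hy]⟩
  let u : ℕ → (i : ℕ) → BoundedContinuousFunction (closedBall (0 : Eu n) (A i)) ℝ := fun j i =>
    BoundedContinuousFunction.mkOfCompact ⟨fun x => F i j x, (hcont i j).comp continuous_subtype_val⟩
  have hK : ∀ i, IsCompact (closure (Set.range fun j => u j i)) := fun i => by
    obtain ⟨D, hD⟩ := hD i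
    refine BoundedContinuousFunction.arzela_ascoli (Set.Icc (-D) D) isCompact_Icc _ ?_ ?_
    · rintro _ x ⟨j, rfl⟩
      exact abs_le.1 (hD j x)
    · intro x₀
      rw [Metric.equicontinuousAt_iff]
      intro e he
      obtain ⟨d, hd, h⟩ := hE i (e / 2) (by positivity)
      refine ⟨d, hd, fun x hx => ?_⟩
      rintro ⟨_, j, rfl⟩
      rw [dist_comm, Real.dist_eq]
      have := h j x₀ x hx
      exact lt_of_le_of_lt this (by linarith)
  obtain ⟨G, -, φ, hφ, hlim⟩ := (isCompact_univ_pi hK).tendsto_subseq (x := u)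
    (fun j i _ => subset_closure ⟨j, rfl⟩)
  rw [tendsto_pi_nhds] at hlim
  refine ⟨φ, hφ, fun i => Function.extend Subtype.val (G i) 0, fun i => ?_, fun i => ?_, fun i x hx => ?_,
    fun i η hη => ?_⟩
  · exact (MeasurableEmbedding.subtype_coe measurableSet_closedBall).measurable_extend
      (G i).continuous.measurable measurable_zero
  · refine ⟨‖G i‖, fun x => ?_⟩
    change |Function.extend Subtype.val (G i) 0 x| ≤ _
    by_cases hx : x ∈ closedBall (0 : Eu n) (A i)
    · have := Subtype.val_injective.extend_apply (G i) 0 (⟨x, hx⟩ : closedBall (0 : Eu n) (A i))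
      simp only at this
      rw [this]
      exact (G i).norm_coe_le_norm _
    · rw [Function.extend_apply' _ _ _ (by rintro ⟨y, rfl⟩; exact hx y.2)]
      simp
  · change Function.extend Subtype.val (G i) 0 x = 0
    rw [Function.extend_apply' _ _ _ (by rintro ⟨y, rfl⟩; exact hx y.2)]
    rfl
  · filter_upwards [Metric.tendsto_nhds.1 (hlim i) η hη] with j hj x hx
    change |_ - Function.extend Subtype.val (G i) 0 x| ≤ _
    have := Subtype.val_injective.extend_apply (G i) 0 (⟨x, hx⟩ : closedBall (0 : Eu n) (A i))
    simp only at this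
    rw [this]
    exact (BoundedContinuousFunction.dist_coe_le_dist (f := u (φ j) i) (g := G i) ⟨x, hx⟩).trans hj.le
end

section
variable {n : ℕ} {p θ : ℝ} {ρ w : Eu n → ℝ} {k : ℝ → Eu n → Eu n → ℝ} {C₀ : ℝ}

theorem Ctx.TB_sub (H : Ctx n p θ ρ w k C₀) {c d : Eu n → ℝ} {Cc Cd E : ℝ}
    (hcl : LocallyIntegrable c volume) (hc : IsBmoBound n θ ρ c Cc)
    (hdl : LocallyIntegrable d volume) (hd : IsBmoBound n θ ρ d Cd)
    (hcd : IsBmoBound n θ ρ (fun x => c x - d x) E) {f : Eu n → ℝ} (hf : MemWLp n p w f)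
    (hf1 : wLpNorm n p w f ≤ 1) :
    NN (wm n w) p (fun x => ‖TstarB n k (fun x => c x - d x) f x‖ₑ) ≤ ENNReal.ofReal (C₀ * E) ∧
    ∀ᵐ x ∂(wm n w), ‖TstarB n k c f x - TstarB n k d f x‖ₑ ≤
      ‖TstarB n k (fun x => c x - d x) f x‖ₑ := by
  constructor
  · rw [← H.norm_eq]
    exact (H.hTb _ E ⟨hcl.sub hdl, E, hcd⟩ hcd f hf).trans (mul_le_of_le_one_right' hf1)
  · filter_upwards [H.lemC hcl hc hf, H.lemC hdl hd hf] with x h1 h2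
    have := Tc_sub_le (c := fun x y => c x - c y) (c' := fun x y => d x - d y) (x := x) (f := f) H.hkm
      (aestronglyMeasurable_const.sub hcl.aestronglyMeasurable)
      (aestronglyMeasurable_const.sub hdl.aestronglyMeasurable) hf.1 h1 h2
    have e : Tc k (fun x y => (c x - c y) - (d x - d y)) f x =
        TstarB n k (fun x => c x - d x) f x := by
      unfold Tc TstarB
      congr 1; funext t; congr 1; funext _; congr 2; funext y; ring
    rw [e] at this
    rw [Real.enorm_eq_ofReal_abs, Real.enorm_eq_ofReal_abs]
    exact ENNReal.ofReal_le_ofReal (this.trans (le_abs_self _))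

theorem NN_ind (hp : 1 < p) {α : Type*} [MeasurableSpace α] {μ : Measure α} {K : Set α}
    (hK : MeasurableSet K) (hμ : μ K < ⊤) : NN μ p (K.indicator fun _ => (1:ℝ≥0∞)) < ⊤ := by
  have hp0 : 0 < p := by linarith
  unfold NN
  refine ENNReal.rpow_lt_top_of_nonneg (by positivity) (ne_of_lt ?_)
  refine lt_of_le_of_lt (le_of_eq ?_) hμ
  rw [← lintegral_indicator_one hK]
  refine lintegral_congr fun x => ?_
  by_cases hx : x ∈ K <;> simp [hx, hp0]

theorem Ctx.main (H : Ctx n p θ ρ w k C₀) {b : Eu n → ℝ} (hb : MemCMOTheta n θ ρ b)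
    {g : ℕ → Eu n → ℝ} (hg : ∀ j, MemWLp n p w (g j) ∧ wLpNorm n p w (g j) ≤ 1) :
    ∃ φ : ℕ → ℕ, StrictMono φ ∧ ∃ h₀ : Eu n → ℝ, MemWLp n p w h₀ ∧
        Tendsto (fun j => wLpNorm n p w (fun x => TstarB n k b (g (φ j)) x - h₀ x))
          atTop (nhds 0) := by
  have hp := H.hp
  have hC₀ := H.hC₀
  set μ := wm n w with hμ
  set e : ℕ → ℝ := fun i => (1 / 2 : ℝ) ^ i with he
  have he0 : ∀ i, 0 < e i := fun i => by positivity
  choose β hβl hbβ hβb A F hF hFD hFE using fun i => H.step hb hg (he0 i)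
  choose Cβ hCβ using hβb
  obtain ⟨φ, hφ, h, hhm, hhD, hhz, hlim⟩ := diag_ascoli A F hFD hFE
  have hNt : ∀ i, NN μ p ((closedBall (0 : Eu n) (A i)).indicator fun _ => (1:ℝ≥0∞)) < ⊤ := fun i =>
    NN_ind hp measurableSet_closedBall (wm_finite H.hwl (isCompact_closedBall _ _))
  -- approximation statement
  have happ : ∀ i, ∀ᶠ j in atTop, ∃ E : Eu n → ℝ≥0∞, AEMeasurable E μ ∧
      NN μ p E ≤ ENNReal.ofReal (2 * e i) ∧
      ∀ᵐ x ∂μ, ‖TstarB n k (β i) (g (φ j)) x - h i x‖ₑ ≤ E x := by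
    intro i
    set N := (NN μ p ((closedBall (0 : Eu n) (A i)).indicator fun _ => (1:ℝ≥0∞))).toReal with hN
    have hN0 : 0 ≤ N := ENNReal.toReal_nonneg
    filter_upwards [hlim i (e i / (N + 1)) (by have := he0 i; positivity)] with j hj
    obtain ⟨Err, h1, h2, h3⟩ := hF i (φ j)
    have hkm : AEMeasurable (fun x => ENNReal.ofReal (e i / (N + 1)) *
        (closedBall (0 : Eu n) (A i)).indicator (fun _ => (1:ℝ≥0∞)) x) μ :=
      ((measurable_const.indicator measurableSet_closedBall).const_mul _).aemeasurable
    refine ⟨fun x => Err x + ENNReal.ofReal (e i / (N + 1)) *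
      (closedBall (0 : Eu n) (A i)).indicator (fun _ => (1:ℝ≥0∞)) x, h1.add hkm, ?_, ?_⟩
    · refine (NN_add_le hp hkm).trans ?_
      rw [two_mul, ENNReal.ofReal_add (he0 i).le (he0 i).le]
      refine add_le_add h2 ?_
      rw [NN_const_mul hp ENNReal.ofReal_ne_top, ← ENNReal.ofReal_toReal (hNt i).ne, ← hN,
        ← ENNReal.ofReal_mul (by have := he0 i; positivity)]
      refine ENNReal.ofReal_le_ofReal ?_
      rw [div_mul_eq_mul_div, div_le_iff₀ (by positivity)]
      have := he0 i
      nlinarith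
    · filter_upwards [h3] with x hx
      have e1 : TstarB n k (β i) (g (φ j)) x - h i x =
          (TstarB n k (β i) (g (φ j)) x - (closedBall 0 (A i)).indicator (F i (φ j)) x) +
          ((closedBall 0 (A i)).indicator (F i (φ j)) x - h i x) := by ring
      rw [e1]
      refine (enorm_add_le _ _).trans (add_le_add hx ?_)
      by_cases hxK : x ∈ closedBall (0 : Eu n) (A i)
      · rw [Set.indicator_of_mem hxK, Set.indicator_of_mem hxK, mul_one, Real.enorm_eq_ofReal_abs]
        exact ENNReal.ofReal_le_ofReal (hj x hxK)
      · rw [Set.indicator_of_notMem hxK, hhz i x hxK]; simp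
  have hhmem : ∀ i, MemLp (h i) (ENNReal.ofReal p) μ := fun i => by
    refine ⟨(hhm i).aestronglyMeasurable, ?_⟩
    obtain ⟨D, hD⟩ := hhD i
    rw [← NN_eq_eLpNorm hp]
    refine lt_of_le_of_lt (NN_mono hp (Ψ := fun x => ENNReal.ofReal D *
      (closedBall (0 : Eu n) (A i)).indicator (fun _ => (1:ℝ≥0∞)) x) fun x => ?_) ?_
    · by_cases hxK : x ∈ closedBall (0 : Eu n) (A i)
      · rw [Set.indicator_of_mem hxK, mul_one, Real.enorm_eq_ofReal_abs]
        exact ENNReal.ofReal_le_ofReal (hD x)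
      · rw [hhz i x hxK]; simp
    · rw [NN_const_mul hp ENNReal.ofReal_ne_top]
      exact ENNReal.mul_lt_top ENNReal.ofReal_lt_top (hNt i)
  -- Cauchy estimate
  have hbl := hb.1
  have hcau : ∀ i i', eLpNorm (h i - h i') (ENNReal.ofReal p) μ ≤
      ENNReal.ofReal ((C₀ + 2) * (e i + e i')) := by
    intro i i'
    obtain ⟨j, ⟨E, hE1, hE2, hE3⟩, ⟨E', hE1', hE2', hE3'⟩⟩ := ((happ i).and (happ i')).exists
    have hbm : IsBmoBound n θ ρ (fun x => β i x - β i' x) (e i' + e i) := by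
      have := bmo_sub (hbl.sub (hβl i')) (hbl.sub (hβl i)) (hbβ i') (hbβ i)
      convert this using 2 with x
      simp
    obtain ⟨q1, q2⟩ := H.TB_sub (hβl i) (hCβ i) (hβl i') (hCβ i') hbm (hg (φ j)).1 (hg (φ j)).2
    rw [← NN_eq_eLpNorm hp]
    refine (NN_mono_ae hp (Ψ := fun x => ‖TstarB n k (fun x => β i x - β i' x) (g (φ j)) x‖ₑ +
      (E x + E' x)) ?_).trans ?_
    · filter_upwards [q2, hE3, hE3'] with x a1 a2 a3
      have e1 : (h i - h i') x = (TstarB n k (β i) (g (φ j)) x - TstarB n k (β i') (g (φ j)) x) +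
          (-(TstarB n k (β i) (g (φ j)) x - h i x) + (TstarB n k (β i') (g (φ j)) x - h i' x)) := by
        simp only [Pi.sub_apply]; ring
      rw [e1]
      refine (enorm_add_le _ _).trans (add_le_add a1 ((enorm_add_le _ _).trans (add_le_add ?_ a3)))
      rwa [enorm_neg]
    · refine (NN_add_le hp (hE1.add hE1')).trans ((add_le_add q1 ((NN_add_le hp hE1').trans
        (add_le_add hE2 hE2'))).trans (le_of_eq ?_))
      have := he0 i
      have := he0 i'
      rw [← ENNReal.ofReal_add (by positivity) (by positivity),
        ← ENNReal.ofReal_add (by positivity) (by positivity)]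
      congr 1; ring
  haveI : Fact (1 ≤ ENNReal.ofReal p) := ⟨by rw [← ENNReal.ofReal_one]; exact ENNReal.ofReal_le_ofReal hp.le⟩
  set u : ℕ → Lp ℝ (ENNReal.ofReal p) μ := fun i => (hhmem i).toLp (h i) with hu
  have hcs : CauchySeq u := by
    refine cauchySeq_of_le_geometric (1 / 2) ((C₀ + 2) * 2) (by norm_num) fun i => ?_
    rw [hu, Lp.dist_def]
    simp only
    refine ENNReal.toReal_le_of_le_ofReal (by positivity) ?_
    refine (le_of_eq (eLpNorm_congr_ae ((hhmem i).coeFn_toLp.sub (hhmem (i+1)).coeFn_toLp))).trans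
      ((hcau i (i+1)).trans (ENNReal.ofReal_le_ofReal ?_))
    have : e (i+1) = e i / 2 := by simp only [he, pow_succ]; ring
    have := he0 i
    change _ ≤ (C₀ + 2) * 2 * e i
    nlinarith
  obtain ⟨h₀, hh₀⟩ := cauchySeq_tendsto_of_complete hcs
  have hh₀m := (Lp.stronglyMeasurable h₀)
  refine ⟨φ, hφ, h₀, ⟨hh₀m.aestronglyMeasurable, ?_⟩, ?_⟩
  · rw [H.norm_eq, NN_eq_eLpNorm hp]
    exact Lp.eLpNorm_lt_top h₀
  · have hbb : IsBmoBound n θ ρ b (e 0 + Cβ 0) := by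
      have := bmo_sub (hbl.sub (hβl 0)) (hβl 0).neg (hbβ 0) (bmo_neg (hCβ 0))
      convert this using 2 with x
      simp
    rw [ENNReal.tendsto_nhds_zero]
    intro ε hε
    have hl : Tendsto (fun i => ENNReal.ofReal ((C₀ + 2) * e i) + edist (u i) h₀) atTop (𝓝 0) := by
      have h1 : Tendsto (fun i => ENNReal.ofReal ((C₀ + 2) * e i)) atTop (𝓝 0) := by
        have : Tendsto (fun i => (C₀ + 2) * e i) atTop (𝓝 ((C₀ + 2) * 0)) :=
          (tendsto_pow_atTop_nhds_zero_of_lt_one (by norm_num) (by norm_num)).const_mul _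
        simpa using ENNReal.tendsto_ofReal this
      simpa using h1.add (tendsto_iff_edist_tendsto_0.1 hh₀)
    obtain ⟨i, hi⟩ := ((ENNReal.tendsto_nhds_zero.1 hl) ε hε).exists
    filter_upwards [happ i] with j hj
    obtain ⟨E, hE1, hE2, hE3⟩ := hj
    obtain ⟨q1, q2⟩ := H.TB_sub hbl hbb (hβl i) (hCβ i) (hbβ i) (hg (φ j)).1 (hg (φ j)).2
    refine le_trans ?_ hi
    have hm3 : AEMeasurable (fun x => ‖h i x - h₀ x‖ₑ) μ :=
      ((hhm i).sub hh₀m.measurable).enorm.aemeasurable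
    have hed : edist (u i) h₀ = NN μ p (fun x => ‖h i x - h₀ x‖ₑ) := by
      rw [Lp.edist_def, NN_eq_eLpNorm hp (fun x => h i x - h₀ x)]
      refine eLpNorm_congr_ae ?_
      filter_upwards [(hhmem i).coeFn_toLp] with x hx
      simp only [Pi.sub_apply, hu, hx]
    rw [H.norm_eq]
    refine (NN_mono_ae hp (Ψ := fun x => ‖TstarB n k (fun x => b x - β i x) (g (φ j)) x‖ₑ +
      (E x + ‖h i x - h₀ x‖ₑ)) ?_).trans ?_
    · filter_upwards [q2, hE3] with x a1 a2
      have e1 : TstarB n k b (g (φ j)) x - h₀ x =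
          (TstarB n k b (g (φ j)) x - TstarB n k (β i) (g (φ j)) x) +
          ((TstarB n k (β i) (g (φ j)) x - h i x) + (h i x - h₀ x)) := by ring
      rw [e1]
      exact (enorm_add_le _ _).trans (add_le_add a1 ((enorm_add_le _ _).trans (add_le_add a2 le_rfl)))
    · refine (NN_add_le hp (hE1.add hm3)).trans ((add_le_add q1 ((NN_add_le hp hm3).trans
        (add_le_add hE2 le_rfl))).trans (le_of_eq ?_))
      have := he0 i
      rw [hed, ← add_assoc, ← ENNReal.ofReal_add (by positivity) (by positivity)]
      congr 2; ring

theorem main_ctx (hn : 3 ≤ n) (V : Eu n → ℝ) (hθ : 0 < θ) (hp : 1 < p)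
    (hw : MemApRho n p θ (auxRho n V) w)
    (hkmeas : ∀ t, Measurable (Function.uncurry (k t)))
    (hK1 : K1 n (auxRho n V) k)
    (hK2 : ∃ δ, 0 < δ ∧ δ < 1 ∧ K2 n (auxRho n V) k δ)
    (hC₀ : 0 < C₀)
    (hTbdd : ∀ f : Eu n → ℝ, MemWLp n p w f →
      wLpNorm n p w (Tstar n k f) ≤ ENNReal.ofReal C₀ * wLpNorm n p w f)
    (hTbBdd : ∀ (b' : Eu n → ℝ) (Cb : ℝ), MemBMOTheta n θ (auxRho n V) b' →
      IsBmoBound n θ (auxRho n V) b' Cb → ∀ f : Eu n → ℝ, MemWLp n p w f →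
        wLpNorm n p w (TstarB n k b' f) ≤ ENNReal.ofReal (C₀ * Cb) * wLpNorm n p w f) :
    Ctx n p θ (auxRho n V) w k C₀ := by
  have hρ : ∀ x, 0 ≤ auxRho n V x := fun x => Real.sSup_nonneg fun r hr => hr.1.le
  have hfac : ∀ t x y, (1 + Real.sqrt t / auxRho n V x + Real.sqrt t / auxRho n V y) ^ (-(1:ℝ)) ≤ 1 := by
    intro t x y
    refine Real.rpow_le_one_of_one_le_of_nonpos ?_ (by norm_num)
    have := div_nonneg (Real.sqrt_nonneg t) (hρ x)
    have := div_nonneg (Real.sqrt_nonneg t) (hρ y)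
    linarith
  refine ⟨by omega, hp, hθ, hρ, hw.1, hw.2.1, hkmeas, ?_, ?_, hC₀, hTbdd, hTbBdd⟩
  · obtain ⟨C, hC, h⟩ := hK1 1 one_pos
    refine ⟨C, hC, fun t ht x y => ⟨(h t ht x y).1, (h t ht x y).2.trans ?_⟩⟩
    exact mul_le_of_le_one_right (by positivity) (hfac t x y)
  · obtain ⟨δ, hδ, -, c, hc, h⟩ := hK2
    obtain ⟨C, hC, h⟩ := h 1 one_pos
    refine ⟨δ, hδ, c, hc, C, hC, fun t ht x y z hz => (h t ht x y z hz).trans ?_⟩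
    exact mul_le_of_le_one_right (by positivity) (hfac t x y)
end

/-- weighted compactness of the commutator `T*_b` on `L^p(w)` for
`b ∈ CMO_θ(ρ)` and `w ∈ A_p^{ρ,θ}` satisfying (1.6). Relative compactness of
`{T*_b f : ‖f‖_{L^p(w)} ≤ 1}` is expressed sequentially. -/
theorem commutator_compact {n : ℕ} (hn : 3 ≤ n) (q : ℝ) (hq : (n : ℝ) / 2 ≤ q) (V : Eu n → ℝ)
    (hV : IsReverseHolder n q V) (hV0 : ¬ V =ᵐ[(volume : Measure (Eu n))] (fun _ => (0:ℝ)))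
    (θ : ℝ) (hθ : 0 < θ) (p : ℝ) (hp : 1 < p)
    (w : Eu n → ℝ) (hw : MemApRho n p θ (auxRho n V) w) (hw16 : Cond16 n p w)
    (k : ℝ → Eu n → Eu n → ℝ) (hkmeas : ∀ t, Measurable (Function.uncurry (k t)))
    (hK1 : K1 n (auxRho n V) k)
    (hK2 : ∃ δ, 0 < δ ∧ δ < 1 ∧ K2 n (auxRho n V) k δ)
    (C₀ : ℝ) (hC₀ : 0 < C₀)
    (hTbdd : ∀ f : Eu n → ℝ, MemWLp n p w f →
      wLpNorm n p w (Tstar n k f) ≤ ENNReal.ofReal C₀ * wLpNorm n p w f)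
    (hTbBdd : ∀ (b' : Eu n → ℝ) (Cb : ℝ), MemBMOTheta n θ (auxRho n V) b' →
      IsBmoBound n θ (auxRho n V) b' Cb → ∀ f : Eu n → ℝ, MemWLp n p w f →
        wLpNorm n p w (TstarB n k b' f) ≤ ENNReal.ofReal (C₀ * Cb) * wLpNorm n p w f)
    (b : Eu n → ℝ) (hb : MemCMOTheta n θ (auxRho n V) b) :
    ∀ g : ℕ → Eu n → ℝ, (∀ j, MemWLp n p w (g j) ∧ wLpNorm n p w (g j) ≤ 1) →
      ∃ φ : ℕ → ℕ, StrictMono φ ∧ ∃ h₀ : Eu n → ℝ, MemWLp n p w h₀ ∧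
        Tendsto (fun j => wLpNorm n p w (fun x => TstarB n k b (g (φ j)) x - h₀ x))
          atTop (nhds 0) := by
  intro g hg
  exact (main_ctx hn V hθ hp hw hkmeas hK1 hK2 hC₀ hTbdd hTbBdd).main hb hg

end
end

section
/- Let w be a nonnegative locally integrable function on ℝⁿ such that w^{−1/(p₀−1)} is also nonnegative locally integrable for some p₀ > 1. Let 0 < p < ∞ and let F be a subset of L^p(w). If (i) sup_{f∈F} ‖f‖_{L^p(w)} < ∞, (ii) lim_{N→∞} sup_{f∈F} ∫_{|x|>N} |f(x)|^p w(x) dx = 0, and (iii) lim_{|h|→0} sup_{f∈F} ∫_{ℝⁿ} |f(x+h) − f(x)|^p w(x) dx = 0, then F is sequentially compact in L^p(w): every sequence in F has a subsequence converging in L^p(w) to some element of L^p(w). -/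
open MeasureTheory Metric Filter Topology
open scoped ENNReal

noncomputable section

lemma fk_tri {p : ℝ} (hp : 0 < p) (a b c : ℝ) :
    ‖a - c‖ₑ ^ p ≤ 2 ^ p * (‖a - b‖ₑ ^ p + ‖b - c‖ₑ ^ p) := by
  have h1 : ‖a - c‖ₑ ≤ ‖a - b‖ₑ + ‖b - c‖ₑ := by
    have : a - c = (a - b) + (b - c) := by ring
    rw [this]; exact enorm_add_le _ _
  have h2 : ‖a - c‖ₑ ≤ 2 * max ‖a - b‖ₑ ‖b - c‖ₑ := by
    rw [two_mul]
    exact h1.trans (add_le_add (le_max_left _ _) (le_max_right _ _))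
  calc ‖a - c‖ₑ ^ p ≤ (2 * max ‖a - b‖ₑ ‖b - c‖ₑ) ^ p := ENNReal.rpow_le_rpow h2 hp.le
    _ = 2 ^ p * (max ‖a - b‖ₑ ‖b - c‖ₑ) ^ p := ENNReal.mul_rpow_of_nonneg _ _ hp.le
    _ ≤ _ := by
      gcongr
      rcases max_choice ‖a - b‖ₑ ‖b - c‖ₑ with h | h <;> rw [h]
      · exact le_self_add
      · exact le_add_self

lemma fk_tri_int {α : Type*} [MeasurableSpace α] (μ : Measure α) {p : ℝ} (hp : 0 < p)
    {f g k : α → ℝ} (hf : Measurable f) (hg : Measurable g) :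
    ∫⁻ x, ‖f x - k x‖ₑ ^ p ∂μ ≤
      2 ^ p * (∫⁻ x, ‖f x - g x‖ₑ ^ p ∂μ + ∫⁻ x, ‖g x - k x‖ₑ ^ p ∂μ) := by
  have hm : Measurable fun x => ‖f x - g x‖ₑ ^ p := by fun_prop
  rw [← lintegral_add_left hm, ← lintegral_const_mul' _ _ (by finiteness)]
  exact lintegral_mono fun x => fk_tri hp _ _ _

lemma fk_complete {α : Type*} [MeasurableSpace α] (μ : Measure α) {p : ℝ} (hp : 0 < p)
    (u : ℕ → α → ℝ) (hu : ∀ j, Measurable (u j))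
    (hc : ∀ ε : ℝ≥0∞, ε ≠ 0 → ∃ J, ∀ i ≥ J, ∀ j ≥ J, ∫⁻ x, ‖u i x - u j x‖ₑ ^ p ∂μ ≤ ε) :
    ∃ f : α → ℝ, Measurable f ∧ ∀ ε : ℝ≥0∞, ε ≠ 0 → ∃ J, ∀ i ≥ J,
      ∫⁻ x, ‖u i x - f x‖ₑ ^ p ∂μ ≤ ε := by
  choose J hJ using fun k : ℕ => hc ((4⁻¹ : ℝ≥0∞) ^ k) (by simp)
  obtain ⟨ψ, hψ, hψJ⟩ : ∃ ψ : ℕ → ℕ, StrictMono ψ ∧ ∀ k, J k ≤ ψ k := by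
    obtain ⟨ψ, h1, h2⟩ := extraction_forall_of_eventually (P := fun n k => J n ≤ k)
      (fun n => eventually_ge_atTop (J n))
    exact ⟨ψ, h1, h2⟩
  have hd : ∀ k, ∫⁻ x, 2 ^ k * ‖u (ψ k) x - u (ψ (k+1)) x‖ₑ ^ p ∂μ ≤ (2⁻¹ : ℝ≥0∞) ^ k := by
    intro k
    rw [lintegral_const_mul' _ _ (by finiteness)]
    calc _ ≤ 2 ^ k * (4⁻¹ : ℝ≥0∞) ^ k := by
          gcongr
          exact hJ k _ (hψJ k) _ ((hψJ k).trans (hψ.monotone (Nat.le_succ k)))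
      _ = _ := by
          rw [← mul_pow]
          congr 1
          rw [show (4 : ℝ≥0∞) = 2 * 2 by norm_num, ENNReal.mul_inv (by simp) (by simp), ← mul_assoc,
            ENNReal.mul_inv_cancel (by simp) (by simp), one_mul]
  have hS : ∫⁻ x, ∑' k, 2 ^ k * ‖u (ψ k) x - u (ψ (k+1)) x‖ₑ ^ p ∂μ ≠ ⊤ := by
    rw [lintegral_tsum (fun k => by fun_prop)]
    refine ne_top_of_le_ne_top ?_ (ENNReal.tsum_le_tsum hd)
    rw [ENNReal.tsum_geometric]
    simp
  have hae : ∀ᵐ x ∂μ, ∃ l : ℝ, Tendsto (fun k => u (ψ k) x) atTop (𝓝 l) := by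
    filter_upwards [ae_lt_top (by fun_prop) hS] with x hx
    set S := ∑' k, 2 ^ k * ‖u (ψ k) x - u (ψ (k+1)) x‖ₑ ^ p with hSdef
    refine cauchySeq_tendsto_of_complete ?_
    refine cauchySeq_of_edist_le_geometric ((2⁻¹ : ℝ≥0∞) ^ (1 / p)) (S ^ (1 / p)) ?_ ?_ ?_
    · exact ENNReal.rpow_lt_one (by simp) (by positivity)
    · exact ENNReal.rpow_ne_top_of_nonneg (by positivity) hx.ne
    · intro k
      have h1 : 2 ^ k * ‖u (ψ k) x - u (ψ (k+1)) x‖ₑ ^ p ≤ S := ENNReal.le_tsum k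
      have h2 : ‖u (ψ k) x - u (ψ (k+1)) x‖ₑ ^ p ≤ S * (2⁻¹) ^ k := by
        rw [← ENNReal.inv_pow, ← div_eq_mul_inv, ENNReal.le_div_iff_mul_le (by simp) (by simp),
          mul_comm]
        exact h1
      have h3 := ENNReal.rpow_le_rpow h2 (z := 1 / p) (by positivity)
      rw [← ENNReal.rpow_mul, mul_one_div_cancel hp.ne', ENNReal.rpow_one,
        ENNReal.mul_rpow_of_nonneg _ _ (by positivity)] at h3
      rw [edist_eq_enorm_sub]
      refine h3.trans (le_of_eq ?_)
      congr 1
      rw [← ENNReal.rpow_natCast, ← ENNReal.rpow_natCast, ← ENNReal.rpow_mul, ← ENNReal.rpow_mul,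
        mul_comm]
  obtain ⟨f, hf, hlim⟩ := exists_stronglyMeasurable_limit_of_tendsto_ae
    (fun k => (hu (ψ k)).aestronglyMeasurable) hae
  refine ⟨f, hf.measurable, fun ε hε => ?_⟩
  obtain ⟨K, hK⟩ := hc ε hε
  refine ⟨K, fun i hi => ?_⟩
  calc ∫⁻ x, ‖u i x - f x‖ₑ ^ p ∂μ
      = ∫⁻ x, liminf (fun k => ‖u i x - u (ψ k) x‖ₑ ^ p) atTop ∂μ := by
        refine lintegral_congr_ae ?_
        filter_upwards [hlim] with x hx
        refine (Tendsto.liminf_eq ?_).symm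
        exact ((ENNReal.continuous_rpow_const.tendsto _).comp
          ((continuous_enorm.tendsto _).comp (tendsto_const_nhds.sub hx)))
    _ ≤ liminf (fun k => ∫⁻ x, ‖u i x - u (ψ k) x‖ₑ ^ p ∂μ) atTop :=
        lintegral_liminf_le (fun k => by fun_prop)
    _ ≤ ε := by
        refine liminf_le_of_le (by isBoundedDefault) ?_
        intro b hb
        obtain ⟨m, hm1, hm2⟩ := (hb.and (eventually_ge_atTop K)).exists
        exact hm1.trans (hK i hi _ (hm2.trans (hψ.id_le m)))

/-- Index of the grid cube of side `s` containing `x`. -/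
def fkCell (n : ℕ) (s : ℝ) (x : Eu n) : Fin n → ℤ := fun i => ⌊x i / s⌋

lemma fkCell_measurable (n : ℕ) (s : ℝ) : Measurable (fkCell n s) := by
  unfold fkCell
  refine measurable_pi_lambda _ fun i => ?_
  exact Int.measurable_floor.comp (by fun_prop)

lemma fk_vol_box (n : ℕ) (I : Fin n → Set ℝ) (hI : ∀ i, MeasurableSet (I i)) :
    volume {x : Eu n | ∀ i, x i ∈ I i} = ∏ i, volume (I i) := by
  have h := (PiLp.volume_preserving_ofLp (Fin n)).measure_preimage
    (MeasurableSet.univ_pi hI).nullMeasurableSet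
  rw [volume_pi_pi] at h
  rw [← h]
  congr 1
  ext x
  simp

lemma fk_vol_cell (n : ℕ) {s : ℝ} (hs : 0 < s) (k : Fin n → ℤ) :
    volume (fkCell n s ⁻¹' {k}) = ENNReal.ofReal s ^ n := by
  have : fkCell n s ⁻¹' {k} = {x : Eu n | ∀ i, x i ∈ Set.Ico (k i * s) ((k i + 1) * s)} := by
    ext x
    simp only [Set.mem_preimage, Set.mem_singleton_iff, funext_iff, fkCell, Int.floor_eq_iff,
      Set.mem_ofPred_eq, Set.mem_Ico, le_div_iff₀ hs, div_lt_iff₀ hs]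
  rw [this, fk_vol_box _ _ (fun i => measurableSet_Ico)]
  simp only [Real.volume_Ico]
  simp [add_mul]

lemma fk_vol_P (n : ℕ) (s : ℝ) :
    volume {x : Eu n | ∀ i, x i ∈ Set.Icc (-s) s} = 2 ^ n * ENNReal.ofReal s ^ n := by
  rw [fk_vol_box _ _ (fun i => measurableSet_Icc)]
  simp only [Real.volume_Icc, Finset.prod_const, Finset.card_univ, Fintype.card_fin]
  rw [← mul_pow]
  congr 1
  rw [sub_neg_eq_add, ← two_mul, ENNReal.ofReal_mul (by norm_num)]
  simp

lemma fk_cell_sub {n : ℕ} {s : ℝ} (hs : 0 < s) {x y : Eu n} (h : fkCell n s x = fkCell n s y)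
    (i : Fin n) : (y - x) i ∈ Set.Icc (-s) s := by
  have h1 := congrFun h i
  simp only [fkCell] at h1
  have h2 := Int.abs_sub_lt_one_of_floor_eq_floor h1
  rw [← sub_div, abs_div, abs_of_pos hs, div_lt_one hs, abs_lt] at h2
  constructor <;> simp <;> linarith

lemma fk_step {n : ℕ} (μ : Measure (Eu n)) [SFinite μ] {p : ℝ}
    {f : Eu n → ℝ} (hf : Measurable f) {s : ℝ} (hs : 0 < s) {ε : ℝ≥0∞}
    (hε : ∀ h : Eu n, (∀ i, h i ∈ Set.Icc (-s) s) → ∫⁻ x, ‖f (x + h) - f x‖ₑ ^ p ∂μ ≤ ε) :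
    ∃ c : (Fin n → ℤ) → ℝ, ∫⁻ x, ‖f x - c (fkCell n s x)‖ₑ ^ p ∂μ ≤ 2 ^ n * ε := by
  set q : ℝ≥0∞ := ENNReal.ofReal s ^ n with hq
  have hq0 : q ≠ 0 := by simp [hq, hs]
  have hqt : q ≠ ⊤ := by simp [hq]
  set Q : (Fin n → ℤ) → Set (Eu n) := fun k => fkCell n s ⁻¹' {k} with hQ
  have hQm : ∀ k, MeasurableSet (Q k) := fun k =>
    fkCell_measurable n s (measurableSet_singleton k)
  have hQv : ∀ k, volume (Q k) = q := fk_vol_cell n hs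
  set P : Set (Eu n) := {x : Eu n | ∀ i, x i ∈ Set.Icc (-s) s} with hP
  have hPm : MeasurableSet P := by
    have : P = ⋂ i, (fun x : Eu n => x i) ⁻¹' Set.Icc (-s) s := by ext; simp [hP]
    rw [this]
    exact MeasurableSet.iInter fun i => measurableSet_Icc.preimage (by fun_prop)
  have hG : Measurable fun z : Eu n × Eu n => ‖f z.2 - f z.1‖ₑ ^ p := by fun_prop
  have hex : ∀ k, ∃ y ∈ Q k, ∫⁻ x in Q k, ‖f x - f y‖ₑ ^ p ∂μ ≤
      ⨍⁻ y in Q k, (∫⁻ x in Q k, ‖f x - f y‖ₑ ^ p ∂μ) ∂volume := by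
    intro k
    refine exists_le_setLAverage (by rw [hQv]; exact hq0) (by rw [hQv]; exact hqt) ?_
    exact (Measurable.lintegral_prod_right (ν := μ.restrict (Q k)) hG).aemeasurable
  choose y hy hyle using hex
  have huniv : (⋃ k, Q k) = Set.univ := by ext x; simp [hQ]
  have hdisj : Pairwise (Function.onFun Disjoint Q) := by
    intro a b hab
    refine Set.disjoint_left.2 fun x hxa hxb => hab ?_
    simp only [hQ, Set.mem_preimage, Set.mem_singleton_iff] at hxa hxb
    rw [← hxa, ← hxb]
  have hsum : ∀ G : Eu n → ℝ≥0∞, ∫⁻ x, G x ∂μ = ∑' k, ∫⁻ x in Q k, G x ∂μ := by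
    intro G
    rw [← lintegral_iUnion hQm hdisj, huniv, Measure.restrict_univ]
  refine ⟨fun k => f (y k), ?_⟩
  have hcell : ∀ k, ∫⁻ x in Q k, ‖f x - f (y (fkCell n s x))‖ₑ ^ p ∂μ ≤
      q⁻¹ * ∫⁻ x in Q k, ∫⁻ h in P, ‖f (x + h) - f x‖ₑ ^ p ∂volume ∂μ := by
    intro k
    calc _ = ∫⁻ x in Q k, ‖f x - f (y k)‖ₑ ^ p ∂μ := by
          refine setLIntegral_congr_fun (hQm k) fun x hx => ?_
          have : fkCell n s x = k := hx
          simp only [this]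
      _ ≤ q⁻¹ * ∫⁻ y in Q k, ∫⁻ x in Q k, ‖f x - f y‖ₑ ^ p ∂μ := by
          refine (hyle k).trans (le_of_eq ?_)
          rw [setLAverage_eq, hQv, ENNReal.div_eq_inv_mul]
      _ = q⁻¹ * ∫⁻ x in Q k, (∫⁻ y in Q k, ‖f x - f y‖ₑ ^ p) ∂μ := by
          rw [lintegral_lintegral_swap hG.aemeasurable]
      _ ≤ _ := by
          gcongr 1
          refine setLIntegral_mono' (hQm k) fun x hx => ?_
          rw [← lintegral_indicator (hQm k), ← lintegral_indicator hPm,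
            ← lintegral_add_left_eq_self _ x]
          refine lintegral_mono fun h => ?_
          by_cases hh : x + h ∈ Q k
          · have hhP : h ∈ P := by
              intro i
              have := fk_cell_sub hs (x := x) (y := x + h) (Eq.trans hx (Eq.symm hh)) i
              simpa using this
            rw [Set.indicator_of_mem hh, Set.indicator_of_mem hhP, ← enorm_neg, neg_sub]
          · rw [Set.indicator_of_notMem hh]; exact zero_le
  have hG2 : Measurable fun z : Eu n × Eu n => ‖f (z.1 + z.2) - f z.1‖ₑ ^ p := by fun_prop
  calc _ = ∑' k, ∫⁻ x in Q k, ‖f x - f (y (fkCell n s x))‖ₑ ^ p ∂μ := hsum _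
    _ ≤ ∑' k, q⁻¹ * ∫⁻ x in Q k, ∫⁻ h in P, ‖f (x + h) - f x‖ₑ ^ p ∂volume ∂μ :=
        ENNReal.tsum_le_tsum hcell
    _ = q⁻¹ * ∫⁻ x, ∫⁻ h in P, ‖f (x + h) - f x‖ₑ ^ p ∂volume ∂μ := by
        rw [ENNReal.tsum_mul_left, ← hsum]
    _ = q⁻¹ * ∫⁻ h in P, ∫⁻ x, ‖f (x + h) - f x‖ₑ ^ p ∂μ := by
        rw [lintegral_lintegral_swap hG2.aemeasurable]
    _ ≤ q⁻¹ * ∫⁻ h in P, ε := by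
        gcongr 1
        exact setLIntegral_mono' hPm fun h hh => hε h hh
    _ = 2 ^ n * ε := by
        rw [setLIntegral_const, fk_vol_P, ← hq]
        calc q⁻¹ * (ε * (2 ^ n * q)) = (q⁻¹ * q) * (2 ^ n * ε) := by ring
          _ = _ := by rw [ENNReal.inv_mul_cancel hq0 hqt, one_mul]

lemma fk_bdd_cell (n : ℕ) {s : ℝ} (hs : 0 < s) (k : Fin n → ℤ) :
    Bornology.IsBounded (fkCell n s ⁻¹' {k}) := by
  rcases Set.eq_empty_or_nonempty (fkCell n s ⁻¹' {k}) with h | ⟨x, hx⟩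
  · rw [h]; exact Bornology.isBounded_empty
  rw [Metric.isBounded_iff_subset_closedBall x]
  refine ⟨√(n * s ^ 2), fun y hy => ?_⟩
  rw [mem_closedBall, dist_eq_norm, EuclideanSpace.norm_eq]
  refine Real.sqrt_le_sqrt ?_
  calc ∑ i, ‖(y - x) i‖ ^ 2 ≤ ∑ i : Fin n, s ^ 2 := by
        refine Finset.sum_le_sum fun i _ => ?_
        have := fk_cell_sub hs (x := x) (y := y) (Eq.trans hx (Eq.symm hy)) i
        gcongr
        rw [Real.norm_eq_abs]
        exact abs_le.2 this
    _ = _ := by simp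

lemma fk_fin_cells (n : ℕ) {s : ℝ} (hs : 0 < s) (N : ℝ) :
    ∃ K : Finset (Fin n → ℤ), ∀ x : Eu n, ‖x‖ ≤ N → fkCell n s x ∈ K := by
  refine ⟨Fintype.piFinset fun _ => Finset.Icc ⌊-N / s⌋ ⌊N / s⌋, fun x hx => ?_⟩
  rw [Fintype.mem_piFinset]
  intro i
  have h : |x i| ≤ N := (PiLp.norm_apply_le x i).trans hx
  rw [abs_le] at h
  rw [Finset.mem_Icc]
  exact ⟨Int.floor_le_floor (by gcongr; exact h.1), Int.floor_le_floor (by gcongr; exact h.2)⟩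

lemma fk_core {n : ℕ} (μ : Measure (Eu n)) [SFinite μ]
    (hμ : ∀ A : Set (Eu n), Bornology.IsBounded A → μ A < ⊤) {p : ℝ} (hp : 0 < p)
    (g : ℕ → Eu n → ℝ) (hg : ∀ j, Measurable (g j))
    (M : ℝ≥0∞) (hM : M ≠ ⊤) (h1 : ∀ j, ∫⁻ x, ‖g j x‖ₑ ^ p ∂μ ≤ M)
    (h2 : ∀ ε : ℝ≥0∞, ε ≠ 0 → ∃ N : ℝ, ∀ j, ∫⁻ x in {x : Eu n | N < ‖x‖}, ‖g j x‖ₑ ^ p ∂μ ≤ ε)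
    (h3 : ∀ ε : ℝ≥0∞, ε ≠ 0 → ∃ s : ℝ, 0 < s ∧ ∀ j, ∀ h : Eu n, (∀ i, h i ∈ Set.Icc (-s) s) →
      ∫⁻ x, ‖g j (x + h) - g j x‖ₑ ^ p ∂μ ≤ ε) :
    ∃ φ : ℕ → ℕ, StrictMono φ ∧ ∀ ε : ℝ≥0∞, ε ≠ 0 → ∃ J, ∀ i ≥ J, ∀ j ≥ J,
      ∫⁻ x, ‖g (φ i) x - g (φ j) x‖ₑ ^ p ∂μ ≤ ε := by
  have hstep : ∀ ε : ℝ≥0∞, ε ≠ 0 → ∃ s : ℝ, 0 < s ∧ ∀ j, ∃ c : (Fin n → ℤ) → ℝ,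
      ∫⁻ x, ‖g j x - c (fkCell n s x)‖ₑ ^ p ∂μ ≤ ε := by
    intro ε hε
    obtain ⟨s, hs, hh⟩ := h3 (ε / 2 ^ n) (ENNReal.div_ne_zero.2 ⟨hε, by finiteness⟩)
    refine ⟨s, hs, fun j => ?_⟩
    obtain ⟨c, hc⟩ := fk_step μ (p := p) (hg j) hs (hh j)
    refine ⟨c, hc.trans (le_of_eq ?_)⟩
    exact ENNReal.mul_div_cancel (by simp) (by finiteness)
  choose s hs c hc using fun m : ℕ => hstep ((m : ℝ≥0∞)⁻¹) (by simp)
  have hCt : (2 : ℝ≥0∞) ^ p ≠ ⊤ := by finiteness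
  have hcm : ∀ m j, Measurable fun x => c m j (fkCell n (s m) x) := fun m j =>
    (measurable_of_countable (c m j)).comp (fkCell_measurable n (s m))
  set Q : ℕ → (Fin n → ℤ) → Set (Eu n) := fun m k => fkCell n (s m) ⁻¹' {k} with hQ
  have hQm : ∀ m k, MeasurableSet (Q m k) := fun m k =>
    fkCell_measurable n (s m) (measurableSet_singleton k)
  have hQt : ∀ m k, μ (Q m k) ≠ ⊤ := fun m k => (hμ _ (fk_bdd_cell n (hs m) k)).ne
  -- bound on coefficients
  set R : ℕ × (Fin n → ℤ) → ℝ≥0∞ := fun z =>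
    ((2 ^ p * ((z.1 : ℝ≥0∞)⁻¹ + M)) / μ (Q z.1 z.2)) ^ (1 / p) with hR
  have hcb : ∀ m j k, m ≠ 0 → μ (Q m k) ≠ 0 → c m j k ∈ Set.Icc (-(R (m, k)).toReal) (R (m, k)).toReal := by
    intro m j k hm hk
    have hmt : ((m : ℝ≥0∞)⁻¹) ≠ ⊤ := by simpa using hm
    have hRt : R (m, k) ≠ ⊤ := by
      refine ENNReal.rpow_ne_top_of_nonneg (by positivity) ?_
      exact ENNReal.div_ne_top (ENNReal.mul_ne_top hCt (ENNReal.add_ne_top.2 ⟨hmt, hM⟩)) hk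
    have e1 : ‖c m j k‖ₑ ^ p * μ (Q m k) ≤ 2 ^ p * ((m : ℝ≥0∞)⁻¹ + M) := by
      calc ‖c m j k‖ₑ ^ p * μ (Q m k)
          = ∫⁻ x in Q m k, ‖c m j (fkCell n (s m) x) - 0‖ₑ ^ p ∂μ := by
            rw [← setLIntegral_const]
            refine setLIntegral_congr_fun (hQm m k) fun x hx => ?_
            have : fkCell n (s m) x = k := hx
            simp only [this, sub_zero]
        _ ≤ ∫⁻ x, ‖c m j (fkCell n (s m) x) - 0‖ₑ ^ p ∂μ := setLIntegral_le_lintegral _ _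
        _ ≤ 2 ^ p * (∫⁻ x, ‖c m j (fkCell n (s m) x) - g j x‖ₑ ^ p ∂μ
              + ∫⁻ x, ‖g j x - 0‖ₑ ^ p ∂μ) := fk_tri_int μ hp (hcm m j) (hg j)
        _ ≤ _ := by
            gcongr
            · simp_rw [fun x => enorm_sub_rev (c m j (fkCell n (s m) x)) (g j x)]
              exact hc m j
            · simpa using h1 j
    have e2 : ‖c m j k‖ₑ ≤ R (m, k) := by
      have := ENNReal.rpow_le_rpow ((ENNReal.le_div_iff_mul_le (.inl hk) (.inl (hQt m k))).2 e1)
        (z := 1 / p) (by positivity)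
      rwa [← ENNReal.rpow_mul, mul_one_div_cancel hp.ne', ENNReal.rpow_one] at this
    rw [Set.mem_Icc, ← abs_le, ← Real.norm_eq_abs, ← toReal_enorm]
    exact ENNReal.toReal_mono hRt e2
  classical
  set X : ℕ → ℕ × (Fin n → ℤ) → ℝ := fun j z =>
    if z.1 = 0 ∨ μ (Q z.1 z.2) = 0 then 0 else c z.1 j z.2 with hX
  obtain ⟨L, -, φ, hφ, hL⟩ := (isCompact_univ_pi
    (fun z => isCompact_Icc (a := -(R z).toReal) (b := (R z).toReal))).tendsto_subseq (x := X) (by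
      intro j z _
      by_cases h : z.1 = 0 ∨ μ (Q z.1 z.2) = 0
      · simp [hX, h]
      · simp only [hX, h, if_false]
        push Not at h
        exact hcb _ _ _ h.1 h.2)
  rw [tendsto_pi_nhds] at hL
  refine ⟨φ, hφ, fun ε hε => ?_⟩
  set C : ℝ≥0∞ := 2 ^ p with hC
  have hD0 : C * 2 + C * (1 + C * 2) ≠ ⊤ := by finiteness
  set δ : ℝ≥0∞ := ε / (C * 2 + C * (1 + C * 2)) with hδ
  have hδ0 : δ ≠ 0 := ENNReal.div_ne_zero.2 ⟨hε, hD0⟩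
  obtain ⟨N, hN⟩ := h2 δ hδ0
  obtain ⟨m, hm⟩ := ENNReal.exists_inv_nat_lt hδ0
  have hm0 : m ≠ 0 := by rintro rfl; simp at hm
  obtain ⟨K, hK⟩ := fk_fin_cells n (hs m) N
  have hXc : ∀ i j k, ‖c m i k - c m j k‖ₑ ^ p * μ (Q m k)
      = ‖X i (m, k) - X j (m, k)‖ₑ ^ p * μ (Q m k) := by
    intro i j k
    by_cases h : μ (Q m k) = 0
    · simp [h]
    · simp [hX, h, hm0]
  have hT : Tendsto (fun z : ℕ × ℕ => ∑ k ∈ K,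
      ‖X (φ z.1) (m, k) - X (φ z.2) (m, k)‖ₑ ^ p * μ (Q m k)) (atTop ×ˢ atTop) (𝓝 0) := by
    rw [show (0 : ℝ≥0∞) = ∑ k ∈ K, ‖L (m, k) - L (m, k)‖ₑ ^ p * μ (Q m k) by simp [hp]]
    refine tendsto_finsetSum _ fun k _ => ?_
    refine ENNReal.Tendsto.mul_const ?_ (.inr (hQt m k))
    refine (ENNReal.continuous_rpow_const.tendsto _).comp ((continuous_enorm.tendsto _).comp ?_)
    exact ((hL (m, k)).comp tendsto_fst).sub ((hL (m, k)).comp tendsto_snd)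
  have hev := hT.eventually_le_const (pos_iff_ne_zero.2 hδ0)
  rw [prod_atTop_atTop_eq, eventually_atTop_prod_self'] at hev
  obtain ⟨J, hJ⟩ := hev
  refine ⟨J, fun i hi j hj => ?_⟩
  have hJ' := hJ i hi j hj
  have hA : MeasurableSet {x : Eu n | N < ‖x‖} := measurableSet_lt measurable_const measurable_norm
  set U : Set (Eu n) := ⋃ k ∈ K, Q m k with hU
  have hsub : {x : Eu n | N < ‖x‖}ᶜ ⊆ U := by
    intro x hx
    have : ‖x‖ ≤ N := by simpa using hx
    simp only [hU, Set.mem_iUnion]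
    exact ⟨_, hK x this, rfl⟩
  have e1 : ∫⁻ x in {x : Eu n | N < ‖x‖}, ‖g (φ i) x - g (φ j) x‖ₑ ^ p ∂μ ≤ C * (δ + δ) := by
    refine (fk_tri_int _ hp (hg _) (measurable_const (a := (0 : ℝ)))).trans ?_
    gcongr
    · simpa using hN (φ i)
    · simpa using hN (φ j)
  have e3 : ∫⁻ x in U, ‖c m (φ i) (fkCell n (s m) x) - c m (φ j) (fkCell n (s m) x)‖ₑ ^ p ∂μ ≤ δ := by
    refine le_trans (le_of_eq ?_) hJ'
    rw [hU, lintegral_biUnion_finset ?_ (fun k _ => hQm m k)]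
    · refine Finset.sum_congr rfl fun k _ => ?_
      simp only
      rw [← hXc, ← setLIntegral_const]
      refine setLIntegral_congr_fun (hQm m k) fun x hx => ?_
      have : fkCell n (s m) x = k := hx
      simp only [this]
    · intro a _ b _ hab
      refine Set.disjoint_left.2 fun x hxa hxb => hab ?_
      exact Eq.trans (Eq.symm hxa) hxb
  have e2 : ∫⁻ x in U, ‖g (φ i) x - g (φ j) x‖ₑ ^ p ∂μ ≤ C * (δ + C * (δ + δ)) := by
    refine (fk_tri_int _ hp (hg _) (hcm m (φ i))).trans ?_
    gcongr
    · exact (setLIntegral_le_lintegral _ _).trans ((hc m (φ i)).trans hm.le)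
    · refine (fk_tri_int _ hp (hcm m (φ i)) (hcm m (φ j))).trans ?_
      gcongr
      simp_rw [fun x => enorm_sub_rev (c m (φ j) (fkCell n (s m) x)) (g (φ j) x)]
      exact (setLIntegral_le_lintegral _ _).trans ((hc m (φ j)).trans hm.le)
  calc ∫⁻ x, ‖g (φ i) x - g (φ j) x‖ₑ ^ p ∂μ
      = _ := (lintegral_add_compl _ hA).symm
    _ ≤ C * (δ + δ) + C * (δ + C * (δ + δ)) :=
        add_le_add e1 ((lintegral_mono_set hsub).trans e2)
    _ = (C * 2 + C * (1 + C * 2)) * δ := by ring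
    _ ≤ ε := ENNReal.mul_div_le

lemma fk_wint {n : ℕ} {p : ℝ} (hp : 0 < p) {w : Eu n → ℝ}
    (hw : LocallyIntegrable w volume) {f : Eu n → ℝ} (hf : AEMeasurable f volume)
    (A : Set (Eu n)) (hA : MeasurableSet A) :
    ∫⁻ x in A, ENNReal.ofReal (|f x| ^ p * w x) =
      ∫⁻ x in A, ‖f x‖ₑ ^ p ∂(volume.withDensity fun x => ENNReal.ofReal (w x)) := by
  rw [restrict_withDensity hA, lintegral_withDensity_eq_lintegral_mul₀]
  · refine lintegral_congr fun x => ?_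
    rw [ENNReal.ofReal_mul (by positivity), Pi.mul_apply, mul_comm, Real.enorm_eq_ofReal_abs,
      ENNReal.ofReal_rpow_of_nonneg (abs_nonneg _) hp.le]
  · exact hw.aestronglyMeasurable.aemeasurable.ennreal_ofReal.restrict
  · exact (hf.enorm.pow_const p).restrict

lemma fk_wint' {n : ℕ} {p : ℝ} (hp : 0 < p) {w : Eu n → ℝ}
    (hw : LocallyIntegrable w volume) {f : Eu n → ℝ} (hf : AEMeasurable f volume) :
    ∫⁻ x, ENNReal.ofReal (|f x| ^ p * w x) =
      ∫⁻ x, ‖f x‖ₑ ^ p ∂(volume.withDensity fun x => ENNReal.ofReal (w x)) := by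
  simpa using fk_wint hp hw hf Set.univ MeasurableSet.univ

/-- weighted Fréchet–Kolmogorov theorem: a bounded subset of `L^p(w)`
which uniformly vanishes at infinity and is uniformly equicontinuous is sequentially
compact in `L^p(w)`. -/
theorem frechet_kolmogorov_weighted {n : ℕ} (p₀ : ℝ) (hp₀ : 1 < p₀)
    (w : Eu n → ℝ) (hw0 : ∀ x, 0 ≤ w x) (hw : LocallyIntegrable w volume)
    (hw' : LocallyIntegrable (fun x : Eu n => w x ^ (-(1 / (p₀ - 1)))) volume)
    (p : ℝ) (hp : 0 < p) (F : Set (Eu n → ℝ)) (hF : ∀ f ∈ F, MemWLp n p w f)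
    (h1 : ∃ M : ℝ, ∀ f ∈ F, wLpNorm n p w f ≤ ENNReal.ofReal M)
    (h2 : Tendsto
      (fun N : ℝ => ⨆ f ∈ F, ∫⁻ x in {x : Eu n | N < ‖x‖}, ENNReal.ofReal (|f x| ^ p * w x))
      atTop (nhds 0))
    (h3 : Tendsto
      (fun h : Eu n => ⨆ f ∈ F, ∫⁻ x, ENNReal.ofReal (|f (x + h) - f x| ^ p * w x))
      (nhds 0) (nhds 0)) :
    ∀ g : ℕ → Eu n → ℝ, (∀ j, g j ∈ F) →
      ∃ φ : ℕ → ℕ, StrictMono φ ∧ ∃ f₀ : Eu n → ℝ, MemWLp n p w f₀ ∧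
        Tendsto (fun j => wLpNorm n p w (fun x => g (φ j) x - f₀ x)) atTop (nhds 0) := by
  intro g hg
  set μ : Measure (Eu n) := volume.withDensity fun x => ENNReal.ofReal (w x) with hμdef
  have hμb : ∀ A : Set (Eu n), Bornology.IsBounded A → μ A < ⊤ := by
    intro A hA
    have hcomp : IsCompact (closure A) := hA.isCompact_closure
    refine (measure_mono subset_closure).trans_lt ?_
    rw [hμdef, withDensity_apply _ isClosed_closure.measurableSet]
    refine lt_of_le_of_lt (lintegral_mono fun x => ?_) (hw.integrableOn_isCompact hcomp).2
    exact Real.ofReal_le_enorm _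
  have hgm : ∀ j, AEStronglyMeasurable (g j) volume := fun j => (hF _ (hg j)).1
  set u : ℕ → Eu n → ℝ := fun j => (hgm j).mk (g j) with hu
  have hum : ∀ j, Measurable (u j) := fun j => (hgm j).stronglyMeasurable_mk.measurable
  have hgu : ∀ j, g j =ᵐ[volume] u j := fun j => (hgm j).ae_eq_mk
  obtain ⟨M, hM⟩ := h1
  have b1 : ∀ j, ∫⁻ x, ‖u j x‖ₑ ^ p ∂μ ≤ ENNReal.ofReal M ^ p := by
    intro j
    have h := ENNReal.rpow_le_rpow (hM _ (hg j)) hp.le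
    rw [wLpNorm, ← ENNReal.rpow_mul, one_div_mul_cancel hp.ne', ENNReal.rpow_one] at h
    rw [← fk_wint' hp hw (hum j).aemeasurable]
    refine le_trans (le_of_eq (lintegral_congr_ae ?_)) h
    filter_upwards [hgu j] with x hx
    rw [hx]
  have b2 : ∀ ε : ℝ≥0∞, ε ≠ 0 → ∃ N : ℝ, ∀ j,
      ∫⁻ x in {x : Eu n | N < ‖x‖}, ‖u j x‖ₑ ^ p ∂μ ≤ ε := by
    intro ε hε
    obtain ⟨N, hN⟩ := (h2.eventually_le_const (pos_iff_ne_zero.2 hε)).exists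
    refine ⟨N, fun j => ?_⟩
    have h : ∫⁻ x in {x : Eu n | N < ‖x‖}, ENNReal.ofReal (|g j x| ^ p * w x) ≤ ε :=
      (le_iSup₂ (f := fun (f : Eu n → ℝ) (_ : f ∈ F) =>
        ∫⁻ x in {x : Eu n | N < ‖x‖}, ENNReal.ofReal (|f x| ^ p * w x)) (g j) (hg j)).trans hN
    rw [← fk_wint hp hw (hum j).aemeasurable _
      (measurableSet_lt measurable_const measurable_norm)]
    refine le_trans (le_of_eq (lintegral_congr_ae (ae_restrict_of_ae ?_))) h
    filter_upwards [hgu j] with x hx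
    rw [hx]
  have b3 : ∀ ε : ℝ≥0∞, ε ≠ 0 → ∃ s : ℝ, 0 < s ∧ ∀ j, ∀ h : Eu n,
      (∀ i, h i ∈ Set.Icc (-s) s) → ∫⁻ x, ‖u j (x + h) - u j x‖ₑ ^ p ∂μ ≤ ε := by
    intro ε hε
    obtain ⟨d, hd, hball⟩ := Metric.eventually_nhds_iff.1
      (h3.eventually_le_const (pos_iff_ne_zero.2 hε))
    refine ⟨d / (n + 1), by positivity, fun j h hh => ?_⟩
    have hlt : dist h 0 < d := by
      rw [dist_zero_right, EuclideanSpace.norm_eq, Real.sqrt_lt' hd]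
      calc ∑ i, ‖h i‖ ^ 2 ≤ ∑ i : Fin n, (d / (n + 1)) ^ 2 := by
            refine Finset.sum_le_sum fun i _ => ?_
            gcongr
            rw [Real.norm_eq_abs]
            exact abs_le.2 (hh i)
        _ = n * (d / (n + 1)) ^ 2 := by simp
        _ < d ^ 2 := by
            rw [div_pow, ← mul_div_assoc, div_lt_iff₀ (by positivity)]
            have hn : (0 : ℝ) ≤ n := by positivity
            nlinarith [pow_pos hd 2, mul_nonneg hn (pow_pos hd 2).le,
              mul_nonneg (mul_nonneg hn hn) (pow_pos hd 2).le]
    have hle : ∫⁻ x, ENNReal.ofReal (|g j (x + h) - g j x| ^ p * w x) ≤ ε :=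
      (le_iSup₂ (f := fun (f : Eu n → ℝ) (_ : f ∈ F) =>
        ∫⁻ x, ENNReal.ofReal (|f (x + h) - f x| ^ p * w x)) (g j) (hg j)).trans (hball hlt)
    rw [← fk_wint' hp hw (f := fun x => u j (x + h) - u j x)
      (((hum j).comp (measurable_add_const h)).sub (hum j)).aemeasurable]
    refine le_trans (le_of_eq (lintegral_congr_ae ?_)) hle
    have hsh := (measurePreserving_add_right (volume : Measure (Eu n)) h).quasiMeasurePreserving.ae
      (hgu j)
    filter_upwards [hgu j, hsh] with x hx hx'
    rw [hx, hx']
  obtain ⟨φ, hφ, hcau⟩ := fk_core μ hμb hp u hum (ENNReal.ofReal M ^ p) (by finiteness) b1 b2 b3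
  obtain ⟨f₀, hf₀, hconv⟩ := fk_complete μ hp (fun j => u (φ j)) (fun j => hum _) hcau
  refine ⟨φ, hφ, f₀, ⟨hf₀.aestronglyMeasurable, ?_⟩, ?_⟩
  · obtain ⟨J, hJ⟩ := hconv 1 one_ne_zero
    rw [wLpNorm, fk_wint' hp hw hf₀.aemeasurable]
    refine ENNReal.rpow_lt_top_of_nonneg (by positivity) (ne_top_of_le_ne_top ?_
      (show _ ≤ 2 ^ p * ((1 : ℝ≥0∞) + ENNReal.ofReal M ^ p) from ?_))
    · finiteness
    · have ht := fk_tri_int μ hp (k := fun _ => (0 : ℝ)) hf₀ (hum (φ J))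
      simp only [sub_zero] at ht
      refine ht.trans ?_
      gcongr
      · simp_rw [fun x => enorm_sub_rev (f₀ x) (u (φ J) x)]
        exact hJ J le_rfl
      · exact b1 _
  · have hI : Tendsto (fun j => ∫⁻ x, ‖u (φ j) x - f₀ x‖ₑ ^ p ∂μ) atTop (𝓝 0) := by
      rw [ENNReal.tendsto_nhds_zero]
      intro ε hε
      obtain ⟨J, hJ⟩ := hconv ε hε.ne'
      exact eventually_atTop.2 ⟨J, hJ⟩
    have hI2 := ((ENNReal.continuous_rpow_const (y := 1 / p)).tendsto 0).comp hI
    rw [ENNReal.zero_rpow_of_pos (by positivity)] at hI2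
    refine hI2.congr fun j => ?_
    simp only [Function.comp, wLpNorm]
    congr 1
    rw [← fk_wint' hp hw (f := fun x => u (φ j) x - f₀ x) ((hum _).sub hf₀).aemeasurable]
    refine lintegral_congr_ae ?_
    filter_upwards [hgu (φ j)] with x hx
    rw [hx]

end
end
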